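/- Let P be a combinatorially two-orbit convex d-polytope (d ≥ 1). Then d = 3 and the face lattice L(P) is order-isomorphic to the face lattice of the cuboctahedron, the icosidodecahedron, the rhombic dodecahedron, or the rhombic triacontahedron. In particular, P is isomorphic to a convex polytope whose symmetry group has exactly two orbits on flags. -/

import Mathlib

/-! Generic definitions about flags, flag orbits, and abstract polytopes. -/

variable {α : Type*} [PartialOrder α]

/-- Two flags (maximal chains) are in the same orbit of the automorphism group
(the group of order automorphisms) if some order automorphism maps one onto the other. -/
def SameFlagOrbit (Φ Ψ : Flag α) : Prop :=
  ∃ γ : α ≃o α, γ '' (Φ : Set α) = (Ψ : Set α)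

/-- The automorphism group has exactly two orbits on the flags. -/
def TwoFlagOrbits (α : Type*) [PartialOrder α] : Prop :=
  ∃ Φ Ψ : Flag α, ¬ SameFlagOrbit Φ Ψ ∧
    ∀ Ω : Flag α, SameFlagOrbit Ω Φ ∨ SameFlagOrbit Ω Ψ

/-- `Ψ` is the flag `Φ^i`: it differs from `Φ` in exactly the rank-`i` element
(with respect to the rank function `rk`). -/
def IsIAdjacent (rk : α → ℤ) (i : ℤ) (Φ Ψ : Flag α) : Prop :=
  Φ ≠ Ψ ∧ ∀ x : α, rk x ≠ i → (x ∈ Φ ↔ x ∈ Ψ)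

/-- A two-orbit polytope (with rank function `rk`, adjacency indices `0, …, n-1`)
is in class `2_I` if, for every flag `Φ` and every `i < n`, the `i`-adjacent flag `Φ^i`
lies in the same orbit as `Φ` exactly when `i ∈ I`. -/
def InClass (rk : α → ℤ) (n : ℕ) (I : Set ℕ) : Prop :=
  TwoFlagOrbits α ∧
    ∀ (Φ Ψ : Flag α) (i : ℕ), i < n → IsIAdjacent rk i Φ Ψ →
      (SameFlagOrbit Φ Ψ ↔ i ∈ I)

/-- An abstract polytope of rank `d`: a bounded poset, graded by a rank function `rk`
taking values `-1, 0, …, d`, in which every flag (maximal chain) has exactly one element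
of each rank, satisfying the diamond condition and strong flag-connectivity. -/
structure IsAbstractPolytope (α : Type*) [PartialOrder α] [BoundedOrder α]
    (rk : α → ℤ) (d : ℕ) : Prop where
  rk_bot : rk ⊥ = -1
  rk_top : rk ⊤ = d
  rk_strictMono : StrictMono rk
  rk_cover : ∀ x y : α, x ⋖ y → rk y = rk x + 1
  flag_ranks : ∀ (Φ : Flag α) (i : ℤ), -1 ≤ i → i ≤ d → ∃! x, x ∈ Φ ∧ rk x = i
  diamond : ∀ x y : α, x < y → rk y = rk x + 2 →
    ∃ a b : α, a ≠ b ∧ ∀ z : α, (x < z ∧ z < y) ↔ (z = a ∨ z = b)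
  connected : ∀ Φ Ψ : Flag α, ∃ (n : ℕ) (c : Fin (n + 1) → Flag α),
    c 0 = Φ ∧ c (Fin.last n) = Ψ ∧
    (∀ k : Fin n, ∃ i : ℤ, IsIAdjacent rk i (c k.castSucc) (c k.succ)) ∧
    (∀ k, (Φ : Set α) ∩ (Ψ : Set α) ⊆ (c k : Set α))
/-! Definitions about convex polytopes and their face lattices. -/

/-- Euclidean `d`-space. -/
abbrev EucSp (d : ℕ) : Type := EuclideanSpace ℝ (Fin d)

/-- A convex `d`-polytope: the convex hull of a finite set of points of `ℝ^d`,
with nonempty interior. -/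
def IsConvexPolytope {d : ℕ} (P : Set (EucSp d)) : Prop :=
  (∃ S : Finset (EucSp d), P = convexHull ℝ (S : Set (EucSp d))) ∧ (interior P).Nonempty

/-- The face lattice of `P`: the exposed faces of `P` (intersections of `P` with supporting
hyperplanes, together with `∅` and `P` itself), ordered by inclusion. -/
def Faces {d : ℕ} (P : Set (EucSp d)) : Type := {F : Set (EucSp d) // IsExposed ℝ P F}

noncomputable instance {d : ℕ} (P : Set (EucSp d)) : PartialOrder (Faces P) :=
  Subtype.partialOrder _

open scoped Classical

/-- The rank of a face: `-1` for the empty face, and otherwise its affine dimension. -/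
noncomputable def faceRank {d : ℕ} {P : Set (EucSp d)} (F : Faces P) : ℤ :=
  if F.1 = ∅ then -1
  else (Module.finrank ℝ (affineSpan ℝ F.1).direction : ℤ)
/-! The four two-orbit polyhedra. -/

open scoped RealInnerProductSpace

/-- The point `(a, b, c)` of Euclidean 3-space. -/
noncomputable def pt3 (a b c : ℝ) : EucSp 3 := (WithLp.equiv 2 (Fin 3 → ℝ)).symm ![a, b, c]

/-- The golden ratio. -/
noncomputable def goldenφ : ℝ := (1 + Real.sqrt 5) / 2

/-- The 12 vertices of the cuboctahedron: all permutations of the coordinates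
of `(±1, ±1, 0)`. -/
def cuboctaVerts : Set (EucSp 3) :=
  {x | ∃ ε δ : ℝ, (ε = 1 ∨ ε = -1) ∧ (δ = 1 ∨ δ = -1) ∧
    (x = pt3 ε δ 0 ∨ x = pt3 ε 0 δ ∨ x = pt3 0 ε δ)}

/-- The cuboctahedron. -/
noncomputable def Cuboctahedron : Set (EucSp 3) := convexHull ℝ cuboctaVerts

/-- The 30 vertices of the icosidodecahedron: all cyclic permutations of the coordinates
of `(0, 0, ±φ)` and of `(±1/2, ±φ/2, ±φ²/2)`. -/
def icosidodecaVerts : Set (EucSp 3) :=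
  {x | (∃ ε : ℝ, (ε = 1 ∨ ε = -1) ∧
        (x = pt3 0 0 (ε * goldenφ) ∨ x = pt3 (ε * goldenφ) 0 0 ∨ x = pt3 0 (ε * goldenφ) 0)) ∨
      (∃ ε₁ ε₂ ε₃ : ℝ, (ε₁ = 1 ∨ ε₁ = -1) ∧ (ε₂ = 1 ∨ ε₂ = -1) ∧ (ε₃ = 1 ∨ ε₃ = -1) ∧
        (x = pt3 (ε₁ / 2) (ε₂ * goldenφ / 2) (ε₃ * goldenφ ^ 2 / 2) ∨
         x = pt3 (ε₃ * goldenφ ^ 2 / 2) (ε₁ / 2) (ε₂ * goldenφ / 2) ∨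
         x = pt3 (ε₂ * goldenφ / 2) (ε₃ * goldenφ ^ 2 / 2) (ε₁ / 2)))}

/-- The icosidodecahedron. -/
noncomputable def Icosidodecahedron : Set (EucSp 3) := convexHull ℝ icosidodecaVerts

/-- The 14 vertices of the rhombic dodecahedron: the points `(±1, ±1, ±1)` together with
`(±2, 0, 0)`, `(0, ±2, 0)`, `(0, 0, ±2)`. -/
def rhombicDodecaVerts : Set (EucSp 3) :=
  {x | (∃ ε₁ ε₂ ε₃ : ℝ, (ε₁ = 1 ∨ ε₁ = -1) ∧ (ε₂ = 1 ∨ ε₂ = -1) ∧ (ε₃ = 1 ∨ ε₃ = -1) ∧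
        x = pt3 ε₁ ε₂ ε₃) ∨
      (∃ ε : ℝ, (ε = 2 ∨ ε = -2) ∧ (x = pt3 ε 0 0 ∨ x = pt3 0 ε 0 ∨ x = pt3 0 0 ε))}

/-- The rhombic dodecahedron. -/
noncomputable def RhombicDodecahedron : Set (EucSp 3) := convexHull ℝ rhombicDodecaVerts

/-- The rhombic triacontahedron: the polar dual of the icosidodecahedron. -/
noncomputable def RhombicTriacontahedron : Set (EucSp 3) :=
  {y | ∀ x ∈ Icosidodecahedron, ⟪x, y⟫ ≤ 1}
/-! Geometric flag orbits: orbits of flags under the group of Euclidean symmetries. -/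

/-- Two flags of the face lattice of `Q ⊆ ℝ³` are in the same orbit of the symmetry group
if some Euclidean isometry mapping `Q` onto itself carries the set of faces of the first flag
onto the set of faces of the second. -/
def GeomSameFlagOrbit (Q : Set (EucSp 3)) (Φ Ψ : Flag (Faces Q)) : Prop :=
  ∃ γ : EucSp 3 ≃ᵢ EucSp 3, γ '' Q = Q ∧
    (fun F : Set (EucSp 3) => γ '' F) '' (Subtype.val '' (Φ : Set (Faces Q)))
      = Subtype.val '' (Ψ : Set (Faces Q))

/-- `Q` is a (geometrically) two-orbit polytope: its group of Euclidean symmetries has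
exactly two orbits on its flags. -/
def GeomTwoOrbit (Q : Set (EucSp 3)) : Prop :=
  ∃ Φ Ψ : Flag (Faces Q), ¬ GeomSameFlagOrbit Q Φ Ψ ∧
    ∀ Ω : Flag (Faces Q), GeomSameFlagOrbit Q Ω Φ ∨ GeomSameFlagOrbit Q Ω Ψ

open scoped Classical RealInnerProductSpace

/-! ### Abstract flag systems -/

/-- Reachability through moves with index in `I`. -/
def Reach {Ω : Type} (s : ℕ → Ω → Ω) (I : Set ℕ) : Ω → Ω → Prop :=
  Relation.ReflTransGen (fun x y => ∃ i, i ∈ I ∧ y = s i x)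

/-- Local period. -/
noncomputable def Per {Ω : Type} (s : ℕ → Ω → Ω) (i j : ℕ) (x : Ω) : ℕ :=
  Function.minimalPeriod (s i ∘ s j) x

/-- simple connectivity with respect to moves in `I`. -/
def SCon {Ω : Type} (s : ℕ → Ω → Ω) (I : Set ℕ) : Prop :=
  ∀ (Y : Type) (π : Y → Ω) (t : ℕ → Y → Y),
    (∀ i ∈ I, ∀ y, t i (t i y) = y) →
    (∀ i ∈ I, ∀ y, π (t i y) = s i (π y)) →
    (∀ i ∈ I, ∀ j ∈ I, i < j → ∀ y, (t i ∘ t j)^[Per s i j (π y)] y = y) →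
    ∀ y y', Reach t I y y' → π y = π y' → y = y'

structure FS {Ω : Type} (n : ℕ) (s : ℕ → Ω → Ω) : Prop where
  fin : Finite Ω
  invol : ∀ i, 0 < i → i < n → ∀ x, s i (s i x) = x
  nofix : ∀ i, 0 < i → i < n → ∀ x, s i x ≠ x
  ne : ∀ i j, 0 < i → i < j → j < n → ∀ x, s i x ≠ s j x
  comm : ∀ i j, 0 < i → i + 2 ≤ j → j < n → ∀ x, s i (s j x) = s j (s i x)
  per : ∀ i, 0 < i → i + 1 < n → ∀ x, s i (s (i + 1) (s i (s (i + 1) x))) ≠ x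
  conn : ∀ x y, Reach s (Set.Ioo 0 n) x y
  sc : ∀ a b, 0 < a → b ≤ n → SCon s (Set.Ico a b)

theorem Reach.refl {Ω : Type} {s : ℕ → Ω → Ω} {I : Set ℕ} (x : Ω) : Reach s I x x :=
  Relation.ReflTransGen.refl

theorem Reach.trans {Ω : Type} {s : ℕ → Ω → Ω} {I : Set ℕ} {x y z : Ω}
    (h : Reach s I x y) (h' : Reach s I y z) : Reach s I x z :=
  Relation.ReflTransGen.trans h h'

theorem Reach.step {Ω : Type} {s : ℕ → Ω → Ω} {I : Set ℕ} {x y : Ω}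
    (h : Reach s I x y) {i : ℕ} (hi : i ∈ I) : Reach s I x (s i y) :=
  Relation.ReflTransGen.tail h ⟨i, hi, rfl⟩

theorem Reach.one {Ω : Type} {s : ℕ → Ω → Ω} {I : Set ℕ} {x : Ω}
    {i : ℕ} (hi : i ∈ I) : Reach s I x (s i x) := (Reach.refl x).step hi

theorem Reach.mono {Ω : Type} {s : ℕ → Ω → Ω} {I J : Set ℕ} (hIJ : I ⊆ J) {x y : Ω}
    (h : Reach s I x y) : Reach s J x y := by
  induction h with
  | refl => exact Reach.refl _
  | tail _ h ih => obtain ⟨i, hi, rfl⟩ := h; exact ih.step (hIJ hi)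

theorem Reach.symm {Ω : Type} {s : ℕ → Ω → Ω} {I : Set ℕ}
    (hinv : ∀ i ∈ I, ∀ y, s i (s i y) = y) {x y : Ω}
    (h : Reach s I x y) : Reach s I y x := by
  induction h with
  | refl => exact Reach.refl _
  | tail _ h ih =>
    obtain ⟨i, hi, rfl⟩ := h
    refine Reach.trans ?_ ih
    have := Reach.one (s := s) (x := s i ‹_›) hi
    rwa [hinv i hi] at this

/-- an invariant of moves is an invariant of reachability -/
theorem Reach.inv {Ω : Type} {s : ℕ → Ω → Ω} {I : Set ℕ} {x y : Ω}
    (h : Reach s I x y) (p : Ω → Prop) (hp : ∀ i ∈ I, ∀ z, p z → p (s i z)) (hx : p x) : p y := by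
  induction h with
  | refl => exact hx
  | tail _ h ih => obtain ⟨i, hi, rfl⟩ := h; exact hp i hi _ ih

theorem Reach.map {Ω Ω' : Type} {s : ℕ → Ω → Ω} {t : ℕ → Ω' → Ω'} {I J : Set ℕ} (f : Ω → Ω')
    (u : ℕ → ℕ) (hu : ∀ i ∈ I, u i ∈ J)
    (hf : ∀ i ∈ I, ∀ x, f (s i x) = t (u i) (f x)) {x y : Ω}
    (h : Reach s I x y) : Reach t J (f x) (f y) := by
  induction h with
  | refl => exact Reach.refl _
  | tail _ h ih => obtain ⟨i, hi, rfl⟩ := h; rw [hf i hi]; exact ih.step (hu i hi)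

/-- lifting a path -/
theorem Reach.lift {Y Ω : Type} {s : ℕ → Ω → Ω} {t : ℕ → Y → Y} {I : Set ℕ} (π : Y → Ω)
    (hf : ∀ i ∈ I, ∀ y, π (t i y) = s i (π y)) {y : Y} {z : Ω}
    (h : Reach s I (π y) z) : ∃ y', Reach t I y y' ∧ π y' = z := by
  induction h with
  | refl => exact ⟨y, Reach.refl _, rfl⟩
  | tail _ h ih =>
    obtain ⟨i, hi, rfl⟩ := h
    obtain ⟨y', h1, h2⟩ := ih
    exact ⟨t i y', h1.step hi, by rw [hf i hi, h2]⟩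

theorem iter_swap {Ω : Type} {a b : Ω → Ω} (ha : ∀ x, a (a x) = x) (hb : ∀ x, b (b x) = x)
    (m : ℕ) (x : Ω) (h : (a ∘ b)^[m] x = x) : (b ∘ a)^[m] x = x := by
  have hl : Function.LeftInverse (b ∘ a) (a ∘ b) := fun x => by simp [ha, hb]
  have := (hl.iterate m) x
  rwa [h] at this

theorem minPer_eq_of_iff {Ω Ω' : Type} {f : Ω → Ω} {g : Ω' → Ω'} {x : Ω} {y : Ω'}
    (h : ∀ m, f^[m] x = x ↔ g^[m] y = y) :
    Function.minimalPeriod f x = Function.minimalPeriod g y :=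
  Function.minimalPeriod_eq_minimalPeriod_iff.2 h

theorem Per_swap {Ω : Type} {s : ℕ → Ω → Ω} {i j : ℕ} (hi : ∀ x, s i (s i x) = x)
    (hj : ∀ x, s j (s j x) = x) (x : Ω) : Per s i j x = Per s j i x :=
  minPer_eq_of_iff fun m => ⟨iter_swap hi hj m x, iter_swap hj hi m x⟩

theorem iter_Per {Ω : Type} {s : ℕ → Ω → Ω} {i j : ℕ} (x : Ω) :
    (s i ∘ s j)^[Per s i j x] x = x := Function.isPeriodicPt_minimalPeriod _ _

/-- periods transported by an injective semiconjugacy -/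
theorem Per_map {Ω Ω' : Type} {s : ℕ → Ω → Ω} {t : ℕ → Ω' → Ω'} {i j i' j' : ℕ} (f : Ω → Ω')
    (hinj : Function.Injective f)
    (h1 : ∀ x, f (s i x) = t i' (f x)) (h2 : ∀ x, f (s j x) = t j' (f x)) (x : Ω) :
    Per t i' j' (f x) = Per s i j x := by
  refine minPer_eq_of_iff fun m => ?_
  have hs : Function.Semiconj f (s i ∘ s j) (t i' ∘ t j') := fun z => by simp [h1, h2]
  have := (hs.iterate_right m) x
  rw [← this]
  exact hinj.eq_iff

theorem Per_left {Ω : Type} {s : ℕ → Ω → Ω} {i j : ℕ} (hi : ∀ x, s i (s i x) = x)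
    (hj : ∀ x, s j (s j x) = x) (x : Ω) : Per s i j (s i x) = Per s i j x := by
  rw [Per_swap hi hj x]
  refine minPer_eq_of_iff fun m => ?_
  have hs : Function.Semiconj (s i) (s j ∘ s i) (s i ∘ s j) := fun z => by simp
  rw [← (hs.iterate_right m) x]
  exact (Function.LeftInverse.injective hi).eq_iff

theorem Per_right {Ω : Type} {s : ℕ → Ω → Ω} {i j : ℕ} (hi : ∀ x, s i (s i x) = x)
    (hj : ∀ x, s j (s j x) = x) (x : Ω) : Per s i j (s j x) = Per s i j x := by
  rw [Per_swap hi hj, Per_left hj hi, Per_swap hi hj]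

theorem Per_pos {Ω : Type} [Finite Ω] {s : ℕ → Ω → Ω} {i j : ℕ} (hi : ∀ x, s i (s i x) = x)
    (hj : ∀ x, s j (s j x) = x) (x : Ω) : 0 < Per s i j x := by
  apply Function.minimalPeriod_pos_of_mem_periodicPts
  apply Function.Injective.mem_periodicPts
  exact (Function.LeftInverse.injective hi).comp (Function.LeftInverse.injective hj)

namespace FS
variable {Ω : Type} {n : ℕ} {s : ℕ → Ω → Ω}

theorem iv (F : FS n s) {i : ℕ} (h1 : 0 < i ∧ i < n) (x : Ω) : s i (s i x) = x := F.invol i h1.1 h1.2 x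

theorem Per_pos (F : FS n s) {i j : ℕ} (hi : 0 < i ∧ i < n) (hj : 0 < j ∧ j < n) (x : Ω) :
    0 < Per s i j x := by
  have := F.fin
  exact _root_.Per_pos (F.iv hi) (F.iv hj) x

theorem ne' (F : FS n s) {i j : ℕ} (hi : 0 < i ∧ i < n) (hj : 0 < j ∧ j < n) (hij : i ≠ j) (x : Ω) :
    s i x ≠ s j x := by
  rcases lt_or_gt_of_ne hij with h | h
  · exact F.ne i j hi.1 h hj.2 x
  · exact (F.ne j i hj.1 h hi.2 x).symm

theorem comm' (F : FS n s) {i j : ℕ} (hi : 0 < i ∧ i < n) (hj : 0 < j ∧ j < n)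
    (hij : i + 2 ≤ j ∨ j + 2 ≤ i) (x : Ω) : s i (s j x) = s j (s i x) := by
  rcases hij with h | h
  · exact F.comm i j hi.1 h hj.2 x
  · exact (F.comm j i hj.1 h hi.2 x).symm

theorem Per_comm (F : FS n s) {i j : ℕ} (hi : 0 < i ∧ i < n) (hj : 0 < j ∧ j < n)
    (hij : i + 2 ≤ j ∨ j + 2 ≤ i) (x : Ω) : Per s i j x = 2 := by
  have : Fact (Nat.Prime 2) := ⟨Nat.prime_two⟩
  refine Function.minimalPeriod_eq_prime ?_ ?_
  · show (s i ∘ s j)^[2] x = x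
    simp only [Function.iterate_succ, Function.iterate_zero, Function.comp, id]
    rw [F.comm' hi hj hij, F.iv hi, F.iv hj]
  · intro h
    apply F.ne' hi hj (by omega) x
    have h' : s i (s j x) = x := h
    rw [← h', F.iv hi, h']

theorem Per_ge (F : FS n s) {i : ℕ} (hi : 0 < i) (hj : i + 1 < n) (x : Ω) :
    3 ≤ Per s i (i + 1) x := by
  have h0 := F.Per_pos (i := i) (j := i + 1) ⟨hi, by omega⟩ ⟨by omega, hj⟩ x
  have hp := iter_Per (s := s) (i := i) (j := i + 1) x
  by_contra hlt
  have : Per s i (i + 1) x = 1 ∨ Per s i (i + 1) x = 2 := by omega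
  rcases this with h | h
  · rw [h] at hp
    simp at hp
    apply F.per i hi hj x
    rw [hp, hp]
  · rw [h] at hp
    exact F.per i hi hj x hp

theorem Per_sw (F : FS n s) {i j : ℕ} (hi : 0 < i ∧ i < n) (hj : 0 < j ∧ j < n) (x : Ω) :
    Per s i j x = Per s j i x := Per_swap (F.iv hi) (F.iv hj) x

theorem Per_ge' (F : FS n s) {i j : ℕ} (hi : 0 < i ∧ i < n) (hj : 0 < j ∧ j < n)
    (hij : i + 1 = j ∨ j + 1 = i) (x : Ω) : 3 ≤ Per s i j x := by
  rcases hij with rfl | rfl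
  · exact F.Per_ge hi.1 hj.2 x
  · rw [F.Per_sw hi hj]; exact F.Per_ge hj.1 hi.2 x

theorem reach_symm (F : FS n s) {I : Set ℕ} (hI : I ⊆ Set.Ioo 0 n) {x y : Ω} (h : Reach s I x y) :
    Reach s I y x := h.symm fun i hi => F.iv (hI hi)

theorem Per_other (F : FS n s) {i j k : ℕ} (hi : 0 < i ∧ i < n) (hj : 0 < j ∧ j < n)
    (hk : 0 < k ∧ k < n) (hki : k + 2 ≤ i ∨ i + 2 ≤ k) (hkj : k + 2 ≤ j ∨ j + 2 ≤ k) (x : Ω) :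
    Per s i j (s k x) = Per s i j x :=
  Per_map (s k) (Function.LeftInverse.injective (F.iv hk)) (fun x => F.comm' hk hi hki x)
    (fun x => F.comm' hk hj hkj x) x

end FS

/-- iterates on a product -/
theorem SCon_rev {Ω : Type} {s : ℕ → Ω → Ω} {I J : Set ℕ} (u : ℕ → ℕ)
    (hinv : ∀ i ∈ I, ∀ x, s i (s i x) = x)
    (huI : ∀ i ∈ I, u i ∈ J) (huJ : ∀ j ∈ J, u j ∈ I) (huu : ∀ i ∈ I, u (u i) = i)
    (huu' : ∀ i ∈ J, u (u i) = i)
    (h : SCon s I) : SCon (fun i => s (u i)) J := by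
  intro Y π t h1 h2 h3 y y' hr hp
  refine h Y π (fun i => t (u i)) (fun i hi => h1 _ (huI i hi)) ?_ ?_ y y' ?_ hp
  · intro i hi y
    have := h2 (u i) (huI i hi) y
    simp only [] at this
    rw [huu i hi] at this
    exact this
  · intro i hi j hj hij y
    have hne : u i ≠ u j := by
      intro e
      have := huu i hi
      rw [e, huu j hj] at this
      omega
    have key : ∀ y, Per s i j y = Per (fun i => s (u i)) (u i) (u j) y := by
      intro y; simp only [Per, huu i hi, huu j hj]
    rcases lt_or_gt_of_ne hne with hl | hl
    · rw [key]
      exact h3 (u i) (huI i hi) (u j) (huI j hj) hl y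
    · apply iter_swap (h1 _ (huI j hj)) (h1 _ (huI i hi))
      rw [Per_swap (hinv i hi) (hinv j hj)]
      have key : Per s j i (π y) = Per (fun i => s (u i)) (u j) (u i) (π y) := by
        simp only [Per, huu i hi, huu j hj]
      rw [key]
      exact h3 (u j) (huI j hj) (u i) (huI i hi) hl y
  · have := hr.map (s := t) (t := fun i => t (u i)) (J := I) id u huJ
      (fun i hi x => by simp [huu' i hi])
    exact this

theorem FS.rev {Ω : Type} {n : ℕ} {s : ℕ → Ω → Ω} (F : FS n s) : FS n (fun i => s (n - i)) where
  fin := F.fin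
  invol i h1 h2 x := F.iv (by omega) x
  nofix i h1 h2 x := F.nofix _ (by omega) (by omega) x
  ne i j h1 h2 h3 x := F.ne' (by omega) (by omega) (by omega) x
  comm i j h1 h2 h3 x := F.comm' (by omega) (by omega) (by omega) x
  per i h1 h2 x := by
    have h := F.per (n - (i + 1)) (by omega) (by omega)
    have e : n - (i + 1) + 1 = n - i := by omega
    rw [e] at h
    intro hx
    exact h _ (congrArg (s (n - (i + 1))) hx)
  conn x y := (F.conn x y).map (J := Set.Ioo 0 n) id (fun i => n - i)
    (fun i hi => by have := hi.1; have := hi.2; simp only [Set.mem_Ioo]; omega)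
    (fun i hi x => by
      have : n - (n - i) = i := by have := hi.2; omega
      simp [this])
  sc a b ha hb := by
    have hsc := F.sc (n + 1 - b) (n + 1 - a) (by omega) (by omega)
    refine SCon_rev (fun i => n - i) ?_ ?_ ?_ ?_ ?_ hsc
    · intro i hi x
      have := hi.1; have := hi.2
      exact F.iv (by omega) x
    all_goals
      intro i hi
      have := hi.1; have := hi.2
      try simp only [Set.mem_Ico]
      omega

/-- Representation lemma: cocycles with trivial rank-two loops integrate. -/
theorem SCon.rep {Ω H : Type} [Group H] {s : ℕ → Ω → Ω} {I : Set ℕ} (hsc : SCon s I)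
    (hinv : ∀ i ∈ I, ∀ x, s i (s i x) = x) (g : ℕ → Ω → H)
    (hg : ∀ i ∈ I, ∀ x, g i x * g i (s i x) = 1)
    (hl : ∀ i ∈ I, ∀ j ∈ I, i < j → ∀ x h,
      ((fun p : Ω × H => (s i p.1, p.2 * g i p.1)) ∘
        (fun p : Ω × H => (s j p.1, p.2 * g j p.1)))^[Per s i j x] (x, h) = (x, h)) (x0 : Ω) :
    ∃ h : Ω → H, ∀ x, Reach s I x0 x → ∀ i ∈ I, h (s i x) = h x * g i x := by
  set t : ℕ → Ω × H → Ω × H := fun i p => (s i p.1, p.2 * g i p.1) with ht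
  have ht1 : ∀ i ∈ I, ∀ y, t i (t i y) = y := by
    intro i hi y
    ext1
    · exact hinv i hi _
    · simp only [ht, mul_assoc, hg i hi, mul_one]
  have huniq := hsc (Ω × H) Prod.fst t ht1 (fun i _ y => rfl)
    (fun i hi j hj hij y => hl i hi j hj hij y.1 y.2)
  have hex : ∀ x, Reach s I x0 x → ∃ h : H, Reach t I (x0, 1) (x, h) := by
    intro x hx
    obtain ⟨y, h1, h2⟩ := Reach.lift (Y := Ω × H) (t := t) Prod.fst (fun i _ y => rfl)
      (y := (x0, (1 : H))) hx
    refine ⟨y.2, ?_⟩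
    rw [← h2]
    exact h1
  choose! h hh using hex
  refine ⟨h, fun x hx i hi => ?_⟩
  have h1 : Reach t I (x0, 1) (t i (x, h x)) := (hh x hx).step hi
  have h2 := hh (s i x) (hx.step hi)
  have := huniq _ _ ((h1.symm ht1).trans h2) rfl
  exact (congrArg Prod.snd this).symm

theorem prod_iter {Ω H : Type} [Group H] {a b : Ω → Ω} (ga gb : Ω → H) (A B : H) (p : Ω → Prop)
    (hpa : ∀ x, p x → p (a x)) (hpb : ∀ x, p x → p (b x))
    (hA : ∀ x, p x → ga x = A) (hB : ∀ x, p x → gb x = B) (m : ℕ) (x : Ω) (hx : p x) (h : H) :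
      ((fun p : Ω × H => (a p.1, p.2 * ga p.1)) ∘
        (fun p : Ω × H => (b p.1, p.2 * gb p.1)))^[m] (x, h) = ((a ∘ b)^[m] x, h * (B * A) ^ m) := by
  induction m generalizing x h with
  | zero => simp
  | succ m ih =>
    rw [Function.iterate_succ_apply, Function.iterate_succ_apply]
    simp only [Function.comp]
    rw [hB x hx, hA _ (hpb x hx)]
    have := ih (a (b x)) (hpa _ (hpb _ hx)) (h * B * A)
    simp only [Function.comp_def] at this ⊢
    rw [this]
    simp [pow_succ', mul_assoc]

theorem prod_iter_alt {Ω H : Type} [Group H] {a b : Ω → Ω} (ga gb : Ω → H) (B : Bool → H)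
    (c : Ω → Bool) (hca : ∀ x, c (a x) = !(c x)) (hcb : ∀ x, c (b x) = c x)
    (hA : ∀ x, ga x = 1) (hB : ∀ x, gb x = B (c x)) (m : ℕ) (x : Ω) (h : H) :
      ((fun p : Ω × H => (a p.1, p.2 * ga p.1)) ∘
        (fun p : Ω × H => (b p.1, p.2 * gb p.1)))^[2 * m] (x, h) =
        ((a ∘ b)^[2 * m] x, h * (B (c x) * B (!(c x))) ^ m) := by
  induction m generalizing x h with
  | zero => simp
  | succ m ih =>
    have e : 2 * (m + 1) = 2 * m + 1 + 1 := by ring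
    rw [e, Function.iterate_succ_apply, Function.iterate_succ_apply, Function.iterate_succ_apply,
      Function.iterate_succ_apply]
    have := ih (a (b (a (b x)))) (h * B (c x) * B (!(c x)))
    simp only [Function.comp_def, hA, hB, hca, hcb, mul_one, Bool.not_not] at this ⊢
    rw [this]
    simp [pow_succ', mul_assoc]

theorem FS.exists_map {Ω Ω' : Type} {n : ℕ} {s : ℕ → Ω → Ω} {s' : ℕ → Ω' → Ω'} (F : FS n s)
    (F' : FS n s') {C : Type} (c : Ω → C) (c' : Ω' → C) (a : ℕ → C → C)
    (hc : ∀ i, 0 < i → i < n → ∀ x, c (s i x) = a i (c x))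
    (hc' : ∀ i, 0 < i → i < n → ∀ x, c' (s' i x) = a i (c' x))
    (hper : ∀ i j, 0 < i → i < j → j < n → ∀ x x', c x = c' x' →
      Per s' i j x' ∣ Per s i j x) (x0 : Ω) (x0' : Ω') (h0 : c x0 = c' x0') :
    ∃ f : Ω → Ω', f x0 = x0' ∧ ∀ i, 0 < i → i < n → ∀ x, f (s i x) = s' i (f x) := by
  have hI : Set.Ioo 0 n = Set.Ico 1 n := by ext; simp [Nat.succ_le_iff]
  let Y : Type := {p : Ω × Ω' // c p.1 = c' p.2}
  have hY : ∀ (p : Y) i, 0 < i ∧ i < n → c (s i p.1.1) = c' (s' i p.1.2) := by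
    intro p i hi
    rw [hc i hi.1 hi.2, hc' i hi.1 hi.2, p.2]
  let t : ℕ → Y → Y := fun i p =>
    if h : 0 < i ∧ i < n then ⟨(s i p.1.1, s' i p.1.2), hY p i h⟩ else p
  have ht : ∀ i (h : i ∈ Set.Ico 1 n) p, t i p = ⟨(s i p.1.1, s' i p.1.2), hY p i h⟩ :=
    fun i h p => dif_pos h
  have ht1 : ∀ i ∈ Set.Ico 1 n, ∀ y, t i (t i y) = y := by
    intro i hi y
    rw [ht i hi, ht i hi]
    apply Subtype.ext
    ext1
    · exact F.iv hi _
    · exact F'.iv hi _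
  have hit : ∀ i ∈ Set.Ico 1 n, ∀ j ∈ Set.Ico 1 n, ∀ (m : ℕ) (y : Y),
      ((t i ∘ t j)^[m] y).1 = ((s i ∘ s j)^[m] y.1.1, (s' i ∘ s' j)^[m] y.1.2) := by
    intro i hi j hj m
    induction m with
    | zero => intro y; rfl
    | succ m ih =>
      intro y
      rw [Function.iterate_succ_apply, ih]
      simp only [Function.comp_apply, ht i hi, ht j hj, Function.iterate_succ_apply]
  have huniq := F.sc 1 n (by omega) le_rfl Y (fun p => p.1.1) t ht1
    (fun i hi y => by simp only [ht i hi]) (by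
      intro i hi j hj hij y
      apply Subtype.ext
      rw [hit i hi j hj]
      ext1
      · exact iter_Per _
      · exact Function.isPeriodicPt_iff_minimalPeriod_dvd.2
          (hper i j hi.1 hij hj.2 y.1.1 y.1.2 y.2))
  have hex : ∀ x, ∃ x', ∃ h : c x = c' x', Reach t (Set.Ico 1 n) ⟨(x0, x0'), h0⟩ ⟨(x, x'), h⟩ := by
    intro x
    have hx := F.conn x0 x
    rw [hI] at hx
    obtain ⟨y, h1, h2⟩ := Reach.lift (Y := Y) (t := t) (fun p => p.1.1)
      (fun i hi y => by simp only [ht i hi]) (y := ⟨(x0, x0'), h0⟩) hx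
    obtain ⟨⟨a, b⟩, hab⟩ := y
    simp only at h2
    subst h2
    exact ⟨b, hab, h1⟩
  choose f hf1 hf2 using hex
  have key : ∀ x x' h, Reach t (Set.Ico 1 n) ⟨(x0, x0'), h0⟩ ⟨(x, x'), h⟩ → f x = x' := by
    intro x x' h hr
    have := huniq _ _ (((hf2 x).symm ht1).trans hr) rfl
    exact congrArg (fun p : Y => p.1.2) this
  refine ⟨f, key _ _ h0 (Reach.refl _), fun i h1 h2 x => ?_⟩
  have hi : i ∈ Set.Ico 1 n := ⟨h1, h2⟩
  have := (hf2 x).step hi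
  rw [ht i hi] at this
  exact key _ _ _ this

open scoped Classical RealInnerProductSpace

/-! ### Finite reflection representations -/

/-- coordinate functionals of the Gram matrix (doubled) -/
noncomputable def cf {k : ℕ} (M : Fin k → Fin k → ℝ) (j : Fin k) : Module.Dual ℝ (Fin k → ℝ) :=
  (2 : ℝ) • ∑ i, M i j • LinearMap.proj i

theorem cf_apply {k : ℕ} (M : Fin k → Fin k → ℝ) (j : Fin k) (x : Fin k → ℝ) :
    cf M j x = 2 * ∑ i, M i j * x i := by
  simp [cf]

theorem cf_single {k : ℕ} (M : Fin k → Fin k → ℝ) (i j : Fin k) :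
    cf M j (Pi.single i 1) = 2 * M i j := by
  rw [cf_apply]
  simp [Pi.single_apply]

/-- the reflection attached to a diagonal-one Gram matrix -/
noncomputable def sg {k : ℕ} (M : Fin k → Fin k → ℝ) (hd : ∀ j, M j j = 1) (j : Fin k) :
    (Fin k → ℝ) ≃ₗ[ℝ] (Fin k → ℝ) :=
  Module.reflection (x := Pi.single j 1) (f := cf M j) (by rw [cf_single, hd]; norm_num)

theorem sg_apply {k : ℕ} (M : Fin k → Fin k → ℝ) (hd : ∀ j, M j j = 1) (j : Fin k)
    (x : Fin k → ℝ) : sg M hd j x = x - cf M j x • Pi.single j 1 :=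
  Module.reflection_apply _ _

theorem sg_mul_self {k : ℕ} (M : Fin k → Fin k → ℝ) (hd : ∀ j, M j j = 1) (j : Fin k) :
    sg M hd j * sg M hd j = 1 := by
  apply LinearEquiv.ext
  intro x
  exact Module.involutive_reflection _ x

theorem pos_def_of_finite {k : ℕ} (M : Fin k → Fin k → ℝ) (hd : ∀ j, M j j = 1)
    (hsym : ∀ i j, M i j = M j i)
    (hconn : ∀ c : Fin k → ℝ, (∀ i j, M i j ≠ 0 → c i = c j) → ∀ i j, c i = c j)
    (T : Set ((Fin k → ℝ) ≃ₗ[ℝ] (Fin k → ℝ))) (hT : T.Finite) (hne : T.Nonempty)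
    (hcl : ∀ w ∈ T, ∀ j, w * sg M hd j ∈ T) (v : Fin k → ℝ) (hv : v ≠ 0) :
    0 < ∑ j, v j * ∑ i, M i j * v i := by
  set Tf := hT.toFinset with hTf
  let ip : (Fin k → ℝ) → (Fin k → ℝ) → ℝ := fun x y => ∑ w ∈ Tf, ∑ l, w x l * w y l
  have ip_add : ∀ x y z, ip (x + y) z = ip x z + ip y z := by
    intro x y z
    simp only [ip, map_add, Pi.add_apply, add_mul, Finset.sum_add_distrib]
  have ip_smul : ∀ (a : ℝ) x z, ip (a • x) z = a * ip x z := by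
    intro a x z
    simp only [ip, map_smul, Pi.smul_apply, smul_eq_mul, Finset.mul_sum, mul_assoc]
  have ip_comm : ∀ x y, ip x y = ip y x := by
    intro x y
    simp only [ip, mul_comm]
  have ip_pos : ∀ x, x ≠ 0 → 0 < ip x x := by
    intro x hx
    obtain ⟨w, hw⟩ := hne
    refine Finset.sum_pos' (fun w _ => Finset.sum_nonneg fun l _ => mul_self_nonneg _)
      ⟨w, by simpa [hTf] using hw, ?_⟩
    have hwx : w x ≠ 0 := by simpa using hx
    obtain ⟨l, hl⟩ := Function.ne_iff.1 hwx
    exact Finset.sum_pos' (fun l _ => mul_self_nonneg _) ⟨l, Finset.mem_univ _,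
      mul_self_pos.2 hl⟩
  have ip_inv : ∀ j x y, ip (sg M hd j x) (sg M hd j y) = ip x y := by
    intro j x y
    refine Finset.sum_nbij (fun w => w * sg M hd j) ?_ ?_ ?_ ?_
    · intro w hw
      simp only [hTf, Set.Finite.mem_toFinset] at hw ⊢
      exact hcl w hw j
    · intro a _ b _ h
      exact mul_right_cancel h
    · intro w hw
      refine ⟨w * sg M hd j, ?_, ?_⟩
      · simp only [hTf, Set.Finite.coe_toFinset] at hw ⊢
        exact hcl w hw j
      · simp only [mul_assoc, sg_mul_self, mul_one]
    · intro w _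
      rfl
  let c : Fin k → ℝ := fun j => ip (Pi.single j 1) (Pi.single j 1)
  have hcp : ∀ j, 0 < c j := fun j => ip_pos _ (by simp)
  have hsj : ∀ j, sg M hd j (Pi.single j 1) = (-1 : ℝ) • Pi.single j 1 := by
    intro j
    rw [sg_apply, cf_single, hd]
    module
  have key : ∀ x j, ip x (Pi.single j 1) = c j * (cf M j x / 2) := by
    intro x j
    have h1 := ip_inv j x (Pi.single j 1)
    rw [hsj, ip_comm, ip_smul, sg_apply, ip_comm, sub_eq_add_neg, ip_add, ← neg_smul, ip_smul] at h1
    change -1 * (ip x (Pi.single j 1) + -(cf M j x) * c j) = _ at h1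
    linarith
  have hcc : ∀ i j, c i = c j := by
    apply hconn
    intro i j hij
    have h1 := key (Pi.single i 1) j
    have h2 := key (Pi.single j 1) i
    rw [cf_single] at h1 h2
    rw [ip_comm, h2, hsym j i] at h1
    have : (c i - c j) * M i j = 0 := by linarith
    rcases mul_eq_zero.1 this with h | h
    · linarith
    · exact absurd h hij
  have hip : ∀ x y, ip x y = ∑ j, y j * ip x (Pi.single j 1) := by
    intro x y
    have hy : y = ∑ j, y j • (Pi.single j (1 : ℝ) : Fin k → ℝ) := by
      ext l; simp [Finset.sum_apply, Pi.single_apply]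
    have hsum : ∀ (S : Finset (Fin k)), ip (∑ j ∈ S, y j • (Pi.single j (1 : ℝ) : Fin k → ℝ)) x =
        ∑ j ∈ S, y j * ip x (Pi.single j 1) := by
      intro S
      induction S using Finset.induction_on with
      | empty =>
        have := ip_smul 0 0 x
        simpa using this
      | insert a S ha ih =>
        rw [Finset.sum_insert ha, Finset.sum_insert ha, ip_add, ip_smul, ih, ip_comm x]
    conv_lhs => rw [ip_comm, hy]
    exact hsum Finset.univ
  have hpos := ip_pos v hv
  obtain ⟨l, -⟩ := Function.ne_iff.1 hv
  rw [hip] at hpos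
  have e : ∑ j, v j * ip v (Pi.single j 1) = c l * ∑ j, v j * ∑ i, M i j * v i := by
    rw [Finset.mul_sum]
    refine Finset.sum_congr rfl fun j _ => ?_
    rw [key, cf_apply, hcc j l]
    ring
  rw [e] at hpos
  exact pos_of_mul_pos_right hpos (hcp l).le

theorem sg_pow {k : ℕ} (M : Fin k → Fin k → ℝ) (hd : ∀ j, M j j = 1) (i j : Fin k) (m : ℕ)
    (hm : 2 ≤ m) (h1 : M i j = -Real.cos (Real.pi / m)) (h2 : M j i = -Real.cos (Real.pi / m)) :
    (sg M hd i * sg M hd j) ^ m = 1 := by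
  have hm0 : (0 : ℝ) < m := by positivity
  set θ : ℝ := Real.pi / m with hθ
  have hmθ : m * θ = Real.pi := by rw [hθ]; field_simp
  rcases eq_or_lt_of_le hm with rfl | hm3
  · have hc : Real.cos θ = 0 := by
      rw [hθ]; push_cast; exact Real.cos_pi_div_two
    rw [hc, neg_zero] at h1 h2
    apply LinearEquiv.ext
    intro z
    rw [pow_two]
    simp only [LinearEquiv.mul_apply, sg_apply, map_sub, map_smul, cf_single, hd, h1, h2,
      LinearEquiv.coe_one, id]
    simp only [smul_eq_mul, mul_zero, sub_zero]
    module
  · have hs : Real.sin (2 * θ) ≠ 0 := by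
      apply ne_of_gt
      have hm3' : (3 : ℝ) ≤ m := by exact_mod_cast hm3
      apply Real.sin_pos_of_pos_of_lt_pi
      · rw [hθ]; positivity
      · have : 0 < θ := by rw [hθ]; positivity
        nlinarith
    have hS : ∀ n : ℤ, (Polynomial.Chebyshev.S ℝ n).eval (2 * Real.cos (2 * θ)) * Real.sin (2 * θ)
        = Real.sin ((n + 1) * (2 * θ)) := fun n =>
      Polynomial.Chebyshev.S_two_mul_real_cos (2 * θ) n
    have ht : 2 * Real.cos (2 * θ) = cf M i (Pi.single j 1) * cf M j (Pi.single i 1) - 2 := by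
      rw [cf_single, cf_single, h1, h2, Real.cos_two_mul]; ring
    apply LinearEquiv.ext
    intro z
    have := Module.reflection_mul_reflection_pow_apply (f := cf M i) (g := cf M j)
      (x := Pi.single i 1) (y := Pi.single j 1)
      (by rw [cf_single, hd]; norm_num) (by rw [cf_single, hd]; norm_num) m z _ ht
    refine this.trans ?_
    obtain ⟨q, hq | hq⟩ := Nat.even_or_odd' m
    · have e1 : ((m : ℤ) - 2) / 2 = q - 1 := by omega
      have e2 : ((m : ℤ) - 1) / 2 = q - 1 := by omega
      have hz : (Polynomial.Chebyshev.S ℝ ((q : ℤ) - 1)).eval (2 * Real.cos (2 * θ)) = 0 := by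
        have h := hS (q - 1)
        have e : ((((q : ℤ) - 1 : ℤ) : ℝ) + 1) * (2 * θ) = Real.pi := by
          rw [← hmθ, hq]; push_cast; ring
        rw [e, Real.sin_pi] at h
        exact (mul_eq_zero.1 h).resolve_right hs
      rw [e1, e2, hz]
      simp
    · have e1 : ((m : ℤ) - 2) / 2 = q - 1 := by omega
      have e2 : ((m : ℤ) - 1) / 2 = q := by omega
      have e3 : ((m : ℤ) - 3) / 2 = q - 1 := by omega
      have e4 : (m : ℤ) / 2 = q := by omega
      have hz : (Polynomial.Chebyshev.S ℝ (q : ℤ)).eval (2 * Real.cos (2 * θ)) +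
          (Polynomial.Chebyshev.S ℝ ((q : ℤ) - 1)).eval (2 * Real.cos (2 * θ)) = 0 := by
        have h := hS (q - 1)
        have h' := hS q
        have e : ((((q : ℤ) - 1 : ℤ) : ℝ) + 1) * (2 * θ) = Real.pi - θ := by
          rw [← hmθ, hq]; push_cast; ring
        have e' : ((((q : ℤ) : ℤ) : ℝ) + 1) * (2 * θ) = θ + Real.pi := by
          rw [← hmθ, hq]; push_cast; ring
        rw [e, Real.sin_pi_sub] at h
        rw [e', Real.sin_add_pi] at h'
        have : (((Polynomial.Chebyshev.S ℝ (q : ℤ)).eval (2 * Real.cos (2 * θ)) +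
          (Polynomial.Chebyshev.S ℝ ((q : ℤ) - 1)).eval (2 * Real.cos (2 * θ)))) * Real.sin (2 * θ)
            = 0 := by rw [add_mul, h, h']; ring
        exact (mul_eq_zero.1 this).resolve_right hs
      rw [e1, e2, e3, e4, hz]
      simp

/-- the rank-two loop at `(i,j)` is trivial for the cocycle `g` -/
def LoopTriv {Ω H : Type} [Group H] (s : ℕ → Ω → Ω) (g : ℕ → Ω → H) (i j : ℕ) : Prop :=
  ∀ x h, ((fun p : Ω × H => (s i p.1, p.2 * g i p.1)) ∘
        (fun p : Ω × H => (s j p.1, p.2 * g j p.1)))^[Per s i j x] (x, h) = (x, h)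

theorem LoopTriv.swap {Ω H : Type} [Group H] {s : ℕ → Ω → Ω} {g : ℕ → Ω → H} {i j : ℕ}
    (hi : ∀ x, s i (s i x) = x) (hj : ∀ x, s j (s j x) = x)
    (gi : ∀ x, g i x * g i (s i x) = 1) (gj : ∀ x, g j x * g j (s j x) = 1)
    (h : LoopTriv s g i j) : LoopTriv s g j i := by
  intro x k
  apply iter_swap
  · intro p
    simp only [hi, mul_assoc, gi, mul_one]
  · intro p
    simp only [hj, mul_assoc, gj, mul_one]
  · rw [Per_swap hj hi]
    exact h x k

theorem LoopTriv.of_const {Ω H : Type} [Group H] {s : ℕ → Ω → Ω} {g : ℕ → Ω → H} {i j : ℕ}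
    {C : Type} (c : Ω → C) (A B : C → H)
    (ci : ∀ x, c (s i x) = c x) (cj : ∀ x, c (s j x) = c x)
    (gi : ∀ x, g i x = A (c x)) (gj : ∀ x, g j x = B (c x))
    (hp : ∀ x, (B (c x) * A (c x)) ^ Per s i j x = 1) : LoopTriv s g i j := by
  intro x h
  rw [prod_iter (g i) (g j) (A (c x)) (B (c x)) (fun y => c y = c x)
    (fun y hy => by rw [ci, hy]) (fun y hy => by rw [cj, hy]) (fun y hy => by rw [gi, hy])
    (fun y hy => by rw [gj, hy]) _ x rfl, hp, mul_one, iter_Per]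

theorem LoopTriv.of_alt {Ω H : Type} [Group H] {s : ℕ → Ω → Ω} {g : ℕ → Ω → H} {i j : ℕ}
    (c : Ω → Bool) (B : Bool → H) (m : ℕ)
    (ci : ∀ x, c (s i x) = !(c x)) (cj : ∀ x, c (s j x) = c x)
    (gi : ∀ x, g i x = 1) (gj : ∀ x, g j x = B (c x))
    (hp : ∀ x, Per s i j x = 2 * m) (hB : ∀ b, (B b * B (!b)) ^ m = 1) : LoopTriv s g i j := by
  intro x h
  have e : (s i ∘ s j)^[2 * m] x = x := by rw [← hp x]; exact iter_Per x
  rw [hp, prod_iter_alt (g i) (g j) B c ci cj gi gj m x h, hB, mul_one, e]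

/-- combination of the representation lemma and positivity -/
theorem refl_pos {Ω : Type} [Finite Ω] {s : ℕ → Ω → Ω} {I : Set ℕ} (hsc : SCon s I)
    (hinv : ∀ i ∈ I, ∀ x, s i (s i x) = x) (x0 : Ω) {k : ℕ} (M : Fin k → Fin k → ℝ)
    (hd : ∀ j, M j j = 1)
    (hsym : ∀ i j, M i j = M j i)
    (hconn : ∀ c : Fin k → ℝ, (∀ i j, M i j ≠ 0 → c i = c j) → ∀ i j, c i = c j)
    (g : ℕ → Ω → ((Fin k → ℝ) ≃ₗ[ℝ] (Fin k → ℝ)))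
    (hg : ∀ i ∈ I, ∀ x, g i x * g i (s i x) = 1)
    (hl : ∀ i ∈ I, ∀ j ∈ I, i < j → LoopTriv s g i j)
    (hgen : ∀ h : Ω → ((Fin k → ℝ) ≃ₗ[ℝ] (Fin k → ℝ)), ∀ x,
      (∀ y, Reach s I x y → ∀ i ∈ I, h (s i y) = h y * g i y) → ∀ j, ∃ y, Reach s I x y ∧
        h y = h x * sg M hd j)
    (v : Fin k → ℝ) (hv : v ≠ 0) :
    0 < ∑ j, v j * ∑ i, M i j * v i := by
  obtain ⟨h, hh⟩ := hsc.rep hinv g hg hl x0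
  refine pos_def_of_finite M hd hsym hconn (h '' {x | Reach s I x0 x}) (Set.toFinite _)
    ⟨_, x0, Reach.refl _, rfl⟩ ?_ v hv
  rintro _ ⟨x, hx, rfl⟩ j
  obtain ⟨y, hy, e⟩ := hgen h x (fun y hy => hh y (hx.trans hy)) j
  exact ⟨y, hx.trans hy, e⟩

open scoped Classical RealInnerProductSpace

theorem cos_mono_aux {k a : ℕ} (hk : 2 ≤ k) (hka : k ≤ a) :
    Real.cos (Real.pi / k) ≤ Real.cos (Real.pi / a) := by
  have hk' : (0 : ℝ) < k := by positivity
  have hka' : (k : ℝ) ≤ a := by exact_mod_cast hka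
  have ha : (0 : ℝ) < a := by linarith
  apply Real.cos_le_cos_of_nonneg_of_le_pi
  · positivity
  · rw [div_le_iff₀ hk']
    have : (2 : ℝ) ≤ k := by exact_mod_cast hk
    nlinarith [Real.pi_pos]
  · gcongr

theorem cos_ge3 {a : ℕ} (h : 3 ≤ a) : 1 / 2 ≤ Real.cos (Real.pi / a) := by
  have := cos_mono_aux (k := 3) (by norm_num) h
  simpa using this

theorem cos_ge4 {a : ℕ} (h : 4 ≤ a) : 1 / 2 ≤ Real.cos (Real.pi / a) ^ 2 := by
  have := cos_mono_aux (k := 4) (by norm_num) h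
  have e : Real.cos (Real.pi / (4 : ℕ)) = √2 / 2 := by push_cast; exact Real.cos_pi_div_four
  rw [e] at this
  have h2 : √2 ^ 2 = 2 := Real.sq_sqrt (by norm_num)
  have h3 : 0 ≤ √2 := Real.sqrt_nonneg _
  nlinarith

theorem cos_ge6 {a : ℕ} (h : 6 ≤ a) : 3 / 4 ≤ Real.cos (Real.pi / a) ^ 2 := by
  have := cos_mono_aux (k := 6) (by norm_num) h
  have e : Real.cos (Real.pi / (6 : ℕ)) = √3 / 2 := by push_cast; exact Real.cos_pi_div_six
  rw [e] at this
  have h2 : √3 ^ 2 = 3 := Real.sq_sqrt (by norm_num)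
  have h3 : 0 ≤ √3 := Real.sqrt_nonneg _
  nlinarith

theorem cos_nonneg2 {a : ℕ} (h : 2 ≤ a) : 0 ≤ Real.cos (Real.pi / a) := by
  have := cos_mono_aux (k := 2) le_rfl h
  simpa using this

/-- both periods at least four: impossible -/
theorem FS.noR1 {Ω : Type} {n : ℕ} {s : ℕ → Ω → Ω} (F : FS n s) (x0 : Ω) {i : ℕ} (hi : 0 < i)
    (hn : i + 2 < n) {p q : ℕ} (hp : 4 ≤ p) (hq : 4 ≤ q) (h1 : ∀ x, Per s i (i + 1) x = p)
    (h2 : ∀ x, Per s (i + 1) (i + 2) x = q) : False := by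
  have := F.fin
  set c1 := Real.cos (Real.pi / p) with hc1
  set c2 := Real.cos (Real.pi / q) with hc2
  have hc1' := cos_ge3 (a := p) (by omega)
  have hc2' := cos_ge3 (a := q) (by omega)
  let M : Fin 3 → Fin 3 → ℝ := ![![1, -c1, 0], ![-c1, 1, -c2], ![0, -c2, 1]]
  have hd : ∀ j, M j j = 1 := by intro j; fin_cases j <;> rfl
  have hsym : ∀ i j, M i j = M j i := by intro i j; fin_cases i <;> fin_cases j <;> rfl
  have hI : ∀ j ∈ Set.Ico i (i + 3), j = i ∨ j = i + 1 ∨ j = i + 2 := by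
    intro j hj; have := hj.1; have := hj.2; omega
  have hIn : ∀ j ∈ Set.Ico i (i + 3), 0 < j ∧ j < n := by
    intro j hj; have := hj.1; have := hj.2; omega
  let g : ℕ → Ω → ((Fin 3 → ℝ) ≃ₗ[ℝ] (Fin 3 → ℝ)) := fun j _ =>
    if j = i then sg M hd 0 else if j = i + 1 then sg M hd 1 else sg M hd 2
  have g0 : ∀ x, g i x = sg M hd 0 := fun x => by simp [g]
  have g1 : ∀ x, g (i + 1) x = sg M hd 1 := fun x => by simp [g]
  have g2 : ∀ x, g (i + 2) x = sg M hd 2 := fun x => by simp [g]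
  have hpos := refl_pos (F.sc i (i + 3) hi (by omega)) (fun j hj => F.iv (hIn j hj)) x0 M hd hsym
    (by
      intro c hc
      have h01 := hc 0 1 (by simp [M]; linarith)
      have h12 := hc 1 2 (by simp [M]; linarith)
      intro a b; fin_cases a <;> fin_cases b <;> simp [h01, h12])
    g
    (by
      intro j hj x
      rcases hI j hj with rfl | rfl | rfl
      · rw [g0 x, sg_mul_self]
      · rw [g1 x, sg_mul_self]
      · rw [g2 x, sg_mul_self])
    (by
      intro j hj k hk hjk
      have hcase : (j = i ∧ k = i + 1) ∨ (j = i ∧ k = i + 2) ∨ (j = i + 1 ∧ k = i + 2) := by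
        have := hI j hj; have := hI k hk; omega
      rcases hcase with ⟨rfl, rfl⟩ | ⟨rfl, rfl⟩ | ⟨rfl, rfl⟩
      · refine LoopTriv.of_const (fun _ => ()) (fun _ => sg M hd 0) (fun _ => sg M hd 1)
          (fun _ => rfl) (fun _ => rfl) g0 g1 (fun x => ?_)
        rw [h1]
        exact sg_pow M hd 1 0 p (by omega) rfl rfl
      · refine LoopTriv.of_const (fun _ => ()) (fun _ => sg M hd 0) (fun _ => sg M hd 2)
          (fun _ => rfl) (fun _ => rfl) g0 g2 (fun x => ?_)
        rw [F.Per_comm (hIn _ hj) (hIn _ hk) (by omega)]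
        exact sg_pow M hd 2 0 2 (by omega) (by simp [M]) (by simp [M])
      · refine LoopTriv.of_const (fun _ => ()) (fun _ => sg M hd 1) (fun _ => sg M hd 2)
          (fun _ => rfl) (fun _ => rfl) g1 g2 (fun x => ?_)
        rw [h2]
        exact sg_pow M hd 2 1 q (by omega) rfl rfl)
    (by
      intro h x hh j
      have hi0 : i ∈ Set.Ico i (i + 3) := by simp
      have hi1 : i + 1 ∈ Set.Ico i (i + 3) := by simp
      have hi2 : i + 2 ∈ Set.Ico i (i + 3) := by simp
      fin_cases j
      · exact ⟨s i x, Reach.one hi0, by rw [hh x (Reach.refl x) i hi0, g0 x]; rfl⟩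
      · exact ⟨s (i + 1) x, Reach.one hi1, by rw [hh x (Reach.refl x) _ hi1, g1 x]; rfl⟩
      · exact ⟨s (i + 2) x, Reach.one hi2, by rw [hh x (Reach.refl x) _ hi2, g2 x]; rfl⟩)
    ![c1, 1, c2] (by intro h; have := congrFun h 1; simp at this)
  simp [Fin.sum_univ_three, M] at hpos
  have := cos_ge4 hp
  have := cos_ge4 hq
  nlinarith

/-- the color flips under `s 1` only: positivity in rank 4 -/
theorem FS.R2 {Ω : Type} {n : ℕ} {s : ℕ → Ω → Ω} (F : FS n s) (x0 : Ω) (hn : 4 ≤ n)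
    (col : Ω → Bool) (k1 : ∀ x, col (s 1 x) = !(col x)) (k2 : ∀ x, col (s 2 x) = col x)
    (k3 : ∀ x, col (s 3 x) = col x) (m : ℕ) (p : Bool → ℕ) (hm : 2 ≤ m) (hp : ∀ b, 3 ≤ p b)
    (h1 : ∀ x, Per s 1 2 x = 2 * m)
    (h2 : ∀ x, Per s 2 3 x = p (col x)) (v : Fin 3 → ℝ) (hv : v ≠ 0) :
    0 < v 0 ^ 2 + v 1 ^ 2 + v 2 ^ 2 - 2 * v 0 * v 1 * Real.cos (Real.pi / m)
      - 2 * v 0 * v 2 * Real.cos (Real.pi / p true) - 2 * v 1 * v 2 * Real.cos (Real.pi / p false)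
      := by
  have := F.fin
  set c0 := Real.cos (Real.pi / m) with hc0
  set c1 := Real.cos (Real.pi / p true) with hc1
  set c2 := Real.cos (Real.pi / p false) with hc2
  have hc1' := cos_ge3 (hp true)
  have hc2' := cos_ge3 (hp false)
  let M : Fin 3 → Fin 3 → ℝ := ![![1, -c0, -c1], ![-c0, 1, -c2], ![-c1, -c2, 1]]
  have hd : ∀ j, M j j = 1 := by intro j; fin_cases j <;> rfl
  have hsym : ∀ i j, M i j = M j i := by intro i j; fin_cases i <;> fin_cases j <;> rfl
  have hI : ∀ j ∈ Set.Ico 1 4, j = 1 ∨ j = 2 ∨ j = 3 := by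
    intro j hj; have := hj.1; have := hj.2; omega
  have hIn : ∀ j ∈ Set.Ico 1 4, 0 < j ∧ j < n := by
    intro j hj; have := hj.1; have := hj.2; omega
  let B : Bool → ((Fin 3 → ℝ) ≃ₗ[ℝ] (Fin 3 → ℝ)) := fun b => cond b (sg M hd 0) (sg M hd 1)
  have hBB : ∀ b, B b * B b = 1 := by intro b; cases b <;> exact sg_mul_self M hd _
  let g : ℕ → Ω → ((Fin 3 → ℝ) ≃ₗ[ℝ] (Fin 3 → ℝ)) := fun j x =>
    if j = 1 then 1 else if j = 2 then B (col x) else sg M hd 2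
  have g0 : ∀ x, g 1 x = 1 := fun x => by simp [g]
  have g1 : ∀ x, g 2 x = B (col x) := fun x => by simp [g]
  have g2 : ∀ x, g 3 x = sg M hd 2 := fun x => by simp [g]
  have hpos := refl_pos (F.sc 1 4 (by norm_num) (by omega)) (fun j hj => F.iv (hIn j hj)) x0 M hd
    hsym
    (by
      intro c hc
      have h01 := hc 0 2 (by simp [M]; linarith)
      have h12 := hc 1 2 (by simp [M]; linarith)
      intro a b; fin_cases a <;> fin_cases b <;> simp [h01, h12])
    g
    (by
      intro j hj x
      rcases hI j hj with rfl | rfl | rfl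
      · rw [g0 x, g0 (s _ x), one_mul]
      · rw [g1, g1, k2, hBB]
      · rw [g2 x, g2 (s _ x), sg_mul_self])
    (by
      intro j hj k hk hjk
      have hcase : (j = 1 ∧ k = 2) ∨ (j = 1 ∧ k = 3) ∨ (j = 2 ∧ k = 3) := by
        have := hI j hj; have := hI k hk; omega
      rcases hcase with ⟨rfl, rfl⟩ | ⟨rfl, rfl⟩ | ⟨rfl, rfl⟩
      · refine LoopTriv.of_alt col B m k1 k2 g0 g1 h1 ?_
        intro b
        cases b
        · exact sg_pow M hd 1 0 m (by omega) rfl rfl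
        · exact sg_pow M hd 0 1 m (by omega) rfl rfl
      · refine LoopTriv.of_const (fun _ => ()) (fun _ => 1) (fun _ => sg M hd 2)
          (fun _ => rfl) (fun _ => rfl) g0 g2 (fun x => ?_)
        rw [F.Per_comm (hIn _ hj) (hIn _ hk) (by omega), mul_one, pow_two, sg_mul_self]
      · refine LoopTriv.of_const col B (fun _ => sg M hd 2) k2 k3 g1 g2 (fun x => ?_)
        rw [h2]
        have := hp (col x)
        cases hcx : col x
        · exact sg_pow M hd 2 1 (p false) (by rw [hcx] at this; omega) rfl rfl
        · exact sg_pow M hd 2 0 (p true) (by rw [hcx] at this; omega) rfl rfl)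
    (by
      intro h x hh j
      have hi0 : 1 ∈ Set.Ico 1 4 := by simp
      have hi1 : 2 ∈ Set.Ico 1 4 := by simp
      have hi2 : 3 ∈ Set.Ico 1 4 := by simp
      have hB : ∀ b, ∃ y, Reach s (Set.Ico 1 4) x y ∧ h y = h x * B b := by
        intro b
        by_cases hb : col x = b
        · exact ⟨s 2 x, Reach.one hi1, by rw [hh x (Reach.refl x) _ hi1, g1, hb]⟩
        · refine ⟨s 2 (s 1 x), (Reach.one hi0).step hi1, ?_⟩
          rw [hh _ (Reach.one hi0) _ hi1, g1, hh x (Reach.refl x) _ hi0, g0, mul_one, k1]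
          congr 2
          revert hb; cases col x <;> cases b <;> simp
      fin_cases j
      · exact hB true
      · exact hB false
      · exact ⟨s 3 x, Reach.one hi2, by rw [hh x (Reach.refl x) _ hi2, g2 x]; rfl⟩)
    v hv
  simp [Fin.sum_univ_three, M] at hpos
  nlinarith

theorem FS.R2' {Ω : Type} {n : ℕ} {s : ℕ → Ω → Ω} (F : FS n s) (x0 : Ω) (hn : 4 ≤ n)
    (col : Ω → Bool) (k1 : ∀ x, col (s 1 x) = !(col x)) (k2 : ∀ x, col (s 2 x) = col x)
    (k3 : ∀ x, col (s 3 x) = col x) (m : ℕ) (p : Bool → ℕ) (hm : 2 ≤ m) (hp : ∀ b, 3 ≤ p b)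
    (h1 : ∀ x, Per s 1 2 x = 2 * m)
    (h2 : ∀ x, Per s 2 3 x = p (col x)) (hpp : p true ≠ p false) :
    m = 2 ∧ ((p true = 3 ∧ (p false = 4 ∨ p false = 5)) ∨
      (p false = 3 ∧ (p true = 4 ∨ p true = 5))) := by
  have key := F.R2 x0 hn col k1 k2 k3 m p hm hp h1 h2
  have a1 := cos_ge3 (hp true)
  have a2 := cos_ge3 (hp false)
  have hm2 : m = 2 := by
    by_contra hne
    have a0 := cos_ge3 (a := m) (by omega)
    have h := key ![1, 1, 1] (by intro h; have := congrFun h 1; simp at this)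
    simp at h
    have : 4 ≤ p true ∨ 4 ≤ p false := by
      have := hp true; have := hp false; omega
    rcases this with hc | hc
    · have := cos_ge4 hc
      nlinarith
    · have := cos_ge4 hc
      nlinarith
  refine ⟨hm2, ?_⟩
  subst hm2
  have h := key ![Real.cos (Real.pi / p true), Real.cos (Real.pi / p false), 1]
    (by intro h; have := congrFun h 2; simp at this)
  simp at h
  have hb := hp true
  have hb' := hp false
  rcases Nat.lt_or_ge 3 (p true) with ht | ht <;> rcases Nat.lt_or_ge 3 (p false) with hf | hf
  · have := cos_ge4 ht
    have := cos_ge4 hf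
    nlinarith
  · right
    refine ⟨by omega, ?_⟩
    by_contra hne
    have := cos_ge6 (a := p true) (by omega)
    nlinarith
  · left
    refine ⟨by omega, ?_⟩
    by_contra hne
    have := cos_ge6 (a := p false) (by omega)
    nlinarith
  · omega

/-- rank at least five, color flips only under `s 1` among the first four -/
theorem FS.noR3 {Ω : Type} {n : ℕ} {s : ℕ → Ω → Ω} (F : FS n s) (x0 : Ω) (hn : 5 ≤ n)
    (col : Ω → Bool) (k1 : ∀ x, col (s 1 x) = !(col x)) (k2 : ∀ x, col (s 2 x) = col x)
    (k3 : ∀ x, col (s 3 x) = col x) (k4 : ∀ x, col (s 4 x) = col x)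
    (m : ℕ) (p : Bool → ℕ) (hm : 2 ≤ m) (hp : ∀ b, 3 ≤ p b) (q : ℕ) (hq : 3 ≤ q)
    (h1 : ∀ x, Per s 1 2 x = 2 * m)
    (h2 : ∀ x, Per s 2 3 x = p (col x)) (h3 : ∀ x, Per s 3 4 x = q)
    (hpp : p true ≠ p false) : False := by
  have := F.fin
  set c0 := Real.cos (Real.pi / m) with hc0
  set c1 := Real.cos (Real.pi / p true) with hc1
  set c2 := Real.cos (Real.pi / p false) with hc2
  set c3 := Real.cos (Real.pi / q) with hc3
  have hc0' : 0 ≤ c0 := cos_nonneg2 hm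
  have hc1' : 1 / 2 ≤ c1 := cos_ge3 (hp true)
  have hc2' : 1 / 2 ≤ c2 := cos_ge3 (hp false)
  have hc3' : 1 / 2 ≤ c3 := cos_ge3 hq
  let M : Fin 4 → Fin 4 → ℝ := ![![1, -c0, -c1, 0], ![-c0, 1, -c2, 0], ![-c1, -c2, 1, -c3],
    ![0, 0, -c3, 1]]
  have hd : ∀ j, M j j = 1 := by intro j; fin_cases j <;> rfl
  have hsym : ∀ i j, M i j = M j i := by intro i j; fin_cases i <;> fin_cases j <;> rfl
  have hI : ∀ j ∈ Set.Ico 1 5, j = 1 ∨ j = 2 ∨ j = 3 ∨ j = 4 := by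
    intro j hj; have := hj.1; have := hj.2; omega
  have hIn : ∀ j ∈ Set.Ico 1 5, 0 < j ∧ j < n := by
    intro j hj; have := hj.1; have := hj.2; omega
  let B : Bool → ((Fin 4 → ℝ) ≃ₗ[ℝ] (Fin 4 → ℝ)) := fun b => cond b (sg M hd 0) (sg M hd 1)
  have hBB : ∀ b, B b * B b = 1 := by intro b; cases b <;> exact sg_mul_self M hd _
  let g : ℕ → Ω → ((Fin 4 → ℝ) ≃ₗ[ℝ] (Fin 4 → ℝ)) := fun j x =>
    if j = 1 then 1 else if j = 2 then B (col x) else if j = 3 then sg M hd 2 else sg M hd 3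
  have g0 : ∀ x, g 1 x = 1 := fun x => by simp [g]
  have g1 : ∀ x, g 2 x = B (col x) := fun x => by simp [g]
  have g2 : ∀ x, g 3 x = sg M hd 2 := fun x => by simp [g]
  have g3 : ∀ x, g 4 x = sg M hd 3 := fun x => by simp [g]
  have hpos := refl_pos (F.sc 1 5 (by norm_num) (by omega)) (fun j hj => F.iv (hIn j hj)) x0 M hd
    hsym
    (by
      intro c hc
      have h02 := hc 0 2 (by simp [M]; linarith)
      have h12 := hc 1 2 (by simp [M]; linarith)
      have h23 := hc 2 3 (by simp [M]; linarith)
      intro a b; fin_cases a <;> fin_cases b <;> simp [h02, h12, h23])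
    g
    (by
      intro j hj x
      rcases hI j hj with rfl | rfl | rfl | rfl
      · rw [g0 x, g0 (s _ x), one_mul]
      · rw [g1, g1, k2, hBB]
      · rw [g2 x, g2 (s _ x), sg_mul_self]
      · rw [g3 x, g3 (s _ x), sg_mul_self])
    (by
      intro j hj k hk hjk
      have hcase : (j = 1 ∧ k = 2) ∨ (j = 1 ∧ k = 3) ∨ (j = 2 ∧ k = 3) ∨ (j = 1 ∧ k = 4) ∨
          (j = 2 ∧ k = 4) ∨ (j = 3 ∧ k = 4) := by
        have := hI j hj; have := hI k hk; omega
      rcases hcase with ⟨rfl, rfl⟩ | ⟨rfl, rfl⟩ | ⟨rfl, rfl⟩ | ⟨rfl, rfl⟩ | ⟨rfl, rfl⟩ | ⟨rfl, rfl⟩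
      · refine LoopTriv.of_alt col B m k1 k2 g0 g1 h1 ?_
        intro b
        cases b
        · exact sg_pow M hd 1 0 m (by omega) rfl rfl
        · exact sg_pow M hd 0 1 m (by omega) rfl rfl
      · refine LoopTriv.of_const (fun _ => ()) (fun _ => 1) (fun _ => sg M hd 2)
          (fun _ => rfl) (fun _ => rfl) g0 g2 (fun x => ?_)
        rw [F.Per_comm (hIn _ hj) (hIn _ hk) (by omega), mul_one, pow_two, sg_mul_self]
      · refine LoopTriv.of_const col B (fun _ => sg M hd 2) k2 k3 g1 g2 (fun x => ?_)
        rw [h2]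
        have := hp (col x)
        cases hcx : col x
        · exact sg_pow M hd 2 1 (p false) (by rw [hcx] at this; omega) rfl rfl
        · exact sg_pow M hd 2 0 (p true) (by rw [hcx] at this; omega) rfl rfl
      · refine LoopTriv.of_const (fun _ => ()) (fun _ => 1) (fun _ => sg M hd 3)
          (fun _ => rfl) (fun _ => rfl) g0 g3 (fun x => ?_)
        rw [F.Per_comm (hIn _ hj) (hIn _ hk) (by omega), mul_one, pow_two, sg_mul_self]
      · refine LoopTriv.of_const col B (fun _ => sg M hd 3) k2 k4 g1 g3 (fun x => ?_)
        rw [F.Per_comm (hIn _ hj) (hIn _ hk) (by omega)]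
        cases hcx : col x
        · exact sg_pow M hd 3 1 2 (by omega) (by simp [M]) (by simp [M])
        · exact sg_pow M hd 3 0 2 (by omega) (by simp [M]) (by simp [M])
      · refine LoopTriv.of_const (fun _ => ()) (fun _ => sg M hd 2) (fun _ => sg M hd 3)
          (fun _ => rfl) (fun _ => rfl) g2 g3 (fun x => ?_)
        rw [h3]
        exact sg_pow M hd 3 2 q (by omega) rfl rfl)
    (by
      intro h x hh j
      have hi0 : 1 ∈ Set.Ico 1 5 := by simp
      have hi1 : 2 ∈ Set.Ico 1 5 := by simp
      have hi2 : 3 ∈ Set.Ico 1 5 := by simp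
      have hi3 : 4 ∈ Set.Ico 1 5 := by simp
      have hB : ∀ b, ∃ y, Reach s (Set.Ico 1 5) x y ∧ h y = h x * B b := by
        intro b
        by_cases hb : col x = b
        · exact ⟨s 2 x, Reach.one hi1, by rw [hh x (Reach.refl x) _ hi1, g1, hb]⟩
        · refine ⟨s 2 (s 1 x), (Reach.one hi0).step hi1, ?_⟩
          rw [hh _ (Reach.one hi0) _ hi1, g1, hh x (Reach.refl x) _ hi0, g0, mul_one, k1]
          congr 2
          revert hb; cases col x <;> cases b <;> simp
      fin_cases j
      · exact hB true
      · exact hB false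
      · exact ⟨s 3 x, Reach.one hi2, by rw [hh x (Reach.refl x) _ hi2, g2 x]; rfl⟩
      · exact ⟨s 4 x, Reach.one hi3, by rw [hh x (Reach.refl x) _ hi3, g3 x]; rfl⟩)
    ![c1, c2, 1, c3] (by intro h; have := congrFun h 2; simp at this)
  simp [Fin.sum_univ_four, M] at hpos
  have hcc : 0 ≤ c0 * (c1 * c2) := by positivity
  have : 4 ≤ p true ∨ 4 ≤ p false := by
    have := hp true; have := hp false; omega
  rcases this with hc | hc
  · have : 1 / 2 ≤ c1 ^ 2 := cos_ge4 hc
    nlinarith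
  · have : 1 / 2 ≤ c2 ^ 2 := cos_ge4 hc
    nlinarith

/-- rank five, color flips under `s 1` and `s 4` -/
theorem FS.noR4 {Ω : Type} {s : ℕ → Ω → Ω} (F : FS 5 s) (x0 : Ω)
    (col : Ω → Bool) (k1 : ∀ x, col (s 1 x) = !(col x)) (k2 : ∀ x, col (s 2 x) = col x)
    (k3 : ∀ x, col (s 3 x) = col x) (k4 : ∀ x, col (s 4 x) = !(col x))
    (m l : ℕ) (p : Bool → ℕ) (hm : 2 ≤ m) (hl : 2 ≤ l) (hp : ∀ b, 3 ≤ p b)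
    (h1 : ∀ x, Per s 1 2 x = 2 * m)
    (h2 : ∀ x, Per s 2 3 x = p (col x)) (h3 : ∀ x, Per s 3 4 x = 2 * l)
    (hpp : p true ≠ p false) : False := by
  have := F.fin
  have hI : ∀ j ∈ Set.Ico 1 5, j = 1 ∨ j = 2 ∨ j = 3 ∨ j = 4 := by
    intro j hj; have := hj.1; have := hj.2; omega
  have hIn : ∀ j ∈ Set.Ico 1 5, 0 < j ∧ j < 5 := by
    intro j hj; have := hj.1; have := hj.2; omega
  have hI5 : Set.Ioo 0 5 = Set.Ico 1 5 := by ext; simp [Nat.succ_le_iff]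
  obtain ⟨ε, e1, e2, e3, e4⟩ : ∃ ε : Ω → Bool, (∀ x, ε (s 1 x) = !(ε x)) ∧
      (∀ x, ε (s 2 x) = ε x) ∧ (∀ x, ε (s 3 x) = ε x) ∧ (∀ x, ε (s 4 x) = ε x) := by
    let a : Multiplicative (ZMod 2) := Multiplicative.ofAdd 1
    have haa : a ^ 2 = 1 := by decide
    let g : ℕ → Ω → Multiplicative (ZMod 2) := fun j _ => if j = 1 then a else 1
    have g1 : ∀ x, g 1 x = a := fun x => by simp [g]
    have gj : ∀ j, j ≠ 1 → ∀ x, g j x = 1 := fun j hj x => by simp [g, hj]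
    obtain ⟨h, hh⟩ := (F.sc 1 5 (by norm_num) le_rfl).rep (fun j hj => F.iv (hIn j hj)) g
      (by
        intro i _ x
        by_cases hi : i = 1
        · subst hi; rw [g1 x]; change a * a = 1; rw [← pow_two, haa]
        · rw [gj i hi x, one_mul])
      (by
        intro i hi j hj hij
        by_cases hi1 : i = 1
        · subst hi1
          refine LoopTriv.of_const (fun _ => ()) (fun _ => a) (fun _ => 1)
            (fun _ => rfl) (fun _ => rfl) g1 (gj j (by omega)) (fun x => ?_)
          rw [one_mul]
          by_cases hj2 : j = 2
          · subst hj2; rw [h1, pow_mul, haa, one_pow]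
          · rw [F.Per_comm (hIn _ hi) (hIn _ hj) (by omega), haa]
        · have := hi.1
          refine LoopTriv.of_const (fun _ => ()) (fun _ => 1) (fun _ => 1)
            (fun _ => rfl) (fun _ => rfl) (gj i hi1) (gj j (by omega)) (fun x => ?_)
          rw [one_mul, one_pow]) x0
    have hr : ∀ x, Reach s (Set.Ico 1 5) x0 x := by
      intro x; rw [← hI5]; exact F.conn x0 x
    refine ⟨fun x => decide (h x = 1), fun x => ?_, fun x => ?_, fun x => ?_, fun x => ?_⟩
    · have := hh x (hr x) 1 (by simp)
      beta_reduce
      rw [this, g1 x]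
      have : ∀ z : Multiplicative (ZMod 2), decide (z * a = 1) = !decide (z = 1) := by
        intro z
        have h := (by decide : ∀ z : Multiplicative (ZMod 2), z * a = 1 ↔ ¬ z = 1) z
        simp only [h, decide_not]
      exact this _
    all_goals
      beta_reduce
      rw [hh x (hr x) _ (by simp), gj _ (by norm_num) x, mul_one]
  obtain ⟨δ, d1, d2, d3, d4, hδ⟩ : ∃ δ : Ω → Bool, (∀ x, δ (s 1 x) = δ x) ∧
      (∀ x, δ (s 2 x) = δ x) ∧ (∀ x, δ (s 3 x) = δ x) ∧ (∀ x, δ (s 4 x) = !(δ x)) ∧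
      ∀ x, col x = xor (ε x) (δ x) := by
    refine ⟨fun x => xor (col x) (ε x), fun x => ?_, fun x => ?_, fun x => ?_, fun x => ?_,
      fun x => ?_⟩
    · simp [k1, e1]
    · simp [k2, e2]
    · simp [k3, e3]
    · simp [k4, e4]
    · beta_reduce
      cases col x <;> cases ε x <;> rfl
  set c0 := Real.cos (Real.pi / m) with hc0
  set c1 := Real.cos (Real.pi / p true) with hc1
  set c2 := Real.cos (Real.pi / p false) with hc2
  set c3 := Real.cos (Real.pi / l) with hc3
  have hc0' : 0 ≤ c0 := cos_nonneg2 hm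
  have hc1' : 1 / 2 ≤ c1 := cos_ge3 (hp true)
  have hc2' : 1 / 2 ≤ c2 := cos_ge3 (hp false)
  have hc3' : 0 ≤ c3 := cos_nonneg2 hl
  let M : Fin 4 → Fin 4 → ℝ := ![![1, -c0, -c2, -c1], ![-c0, 1, -c1, -c2], ![-c2, -c1, 1, -c3],
    ![-c1, -c2, -c3, 1]]
  have hd : ∀ j, M j j = 1 := by intro j; fin_cases j <;> rfl
  have hsym : ∀ i j, M i j = M j i := by intro i j; fin_cases i <;> fin_cases j <;> rfl
  let A : Bool → ((Fin 4 → ℝ) ≃ₗ[ℝ] (Fin 4 → ℝ)) := fun b => cond b (sg M hd 0) (sg M hd 1)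
  let B : Bool → ((Fin 4 → ℝ) ≃ₗ[ℝ] (Fin 4 → ℝ)) := fun b => cond b (sg M hd 2) (sg M hd 3)
  have hAA : ∀ b, A b * A b = 1 := by intro b; cases b <;> exact sg_mul_self M hd _
  have hBB : ∀ b, B b * B b = 1 := by intro b; cases b <;> exact sg_mul_self M hd _
  let g : ℕ → Ω → ((Fin 4 → ℝ) ≃ₗ[ℝ] (Fin 4 → ℝ)) := fun j x =>
    if j = 2 then A (ε x) else if j = 3 then B (δ x) else 1
  have g0 : ∀ x, g 1 x = 1 := fun x => by simp [g]
  have g1 : ∀ x, g 2 x = A (ε x) := fun x => by simp [g]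
  have g2 : ∀ x, g 3 x = B (δ x) := fun x => by simp [g]
  have g3 : ∀ x, g 4 x = 1 := fun x => by simp [g]
  have hgg : ∀ j ∈ Set.Ico 1 5, ∀ x, g j x * g j (s j x) = 1 := by
    intro j hj x
    rcases hI j hj with rfl | rfl | rfl | rfl
    · rw [g0 x, g0 (s _ x), one_mul]
    · rw [g1, g1, e2, hAA]
    · rw [g2, g2, d3, hBB]
    · rw [g3 x, g3 (s _ x), one_mul]
  have hpos := refl_pos (F.sc 1 5 (by norm_num) (by omega)) (fun j hj => F.iv (hIn j hj)) x0 M hd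
    hsym
    (by
      intro c hc
      have h02 := hc 0 2 (by simp [M]; linarith)
      have h12 := hc 1 2 (by simp [M]; linarith)
      have h03 := hc 0 3 (by simp [M]; linarith)
      intro a b; fin_cases a <;> fin_cases b <;> simp [← h02, h12, ← h03])
    g hgg
    (by
      intro j hj k hk hjk
      have hcase : (j = 1 ∧ k = 2) ∨ (j = 1 ∧ k = 3) ∨ (j = 2 ∧ k = 3) ∨ (j = 1 ∧ k = 4) ∨
          (j = 2 ∧ k = 4) ∨ (j = 3 ∧ k = 4) := by
        have := hI j hj; have := hI k hk; omega
      rcases hcase with ⟨rfl, rfl⟩ | ⟨rfl, rfl⟩ | ⟨rfl, rfl⟩ | ⟨rfl, rfl⟩ | ⟨rfl, rfl⟩ | ⟨rfl, rfl⟩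
      · refine LoopTriv.of_alt ε A m e1 e2 g0 g1 h1 ?_
        intro b
        cases b
        · exact sg_pow M hd 1 0 m (by omega) rfl rfl
        · exact sg_pow M hd 0 1 m (by omega) rfl rfl
      · refine LoopTriv.of_const δ (fun _ => 1) B d1 d3 g0 g2 (fun x => ?_)
        rw [F.Per_comm (hIn _ hj) (hIn _ hk) (by omega), mul_one, pow_two, hBB]
      · refine LoopTriv.of_const (fun x => (ε x, δ x)) (fun c => A c.1) (fun c => B c.2)
          (fun x => by rw [e2, d2]) (fun x => by rw [e3, d3]) g1 g2 (fun x => ?_)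
        rw [h2, hδ]
        have := hp true
        have := hp false
        cases ε x <;> cases δ x
        · exact sg_pow M hd 3 1 (p false) (by omega) rfl rfl
        · exact sg_pow M hd 2 1 (p true) (by omega) rfl rfl
        · exact sg_pow M hd 3 0 (p true) (by omega) rfl rfl
        · exact sg_pow M hd 2 0 (p false) (by omega) rfl rfl
      · refine LoopTriv.of_const (fun _ => ()) (fun _ => 1) (fun _ => 1)
          (fun _ => rfl) (fun _ => rfl) g0 g3 (fun x => ?_)
        rw [mul_one, one_pow]
      · refine LoopTriv.of_const ε A (fun _ => 1) e2 e4 g1 g3 (fun x => ?_)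
        rw [F.Per_comm (hIn _ hj) (hIn _ hk) (by omega), one_mul, pow_two, hAA]
      · refine LoopTriv.swap (F.iv (hIn _ hk)) (F.iv (hIn _ hj)) (hgg _ hk) (hgg _ hj) ?_
        refine LoopTriv.of_alt δ B l d4 d3 g3 g2
          (fun x => by rw [F.Per_sw (hIn _ hk) (hIn _ hj), h3]) ?_
        intro b
        cases b
        · exact sg_pow M hd 3 2 l (by omega) rfl rfl
        · exact sg_pow M hd 2 3 l (by omega) rfl rfl)
    (by
      intro h x hh j
      have hi0 : 1 ∈ Set.Ico 1 5 := by simp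
      have hi1 : 2 ∈ Set.Ico 1 5 := by simp
      have hi2 : 3 ∈ Set.Ico 1 5 := by simp
      have hi3 : 4 ∈ Set.Ico 1 5 := by simp
      have hA : ∀ b, ∃ y, Reach s (Set.Ico 1 5) x y ∧ h y = h x * A b := by
        intro b
        by_cases hb : ε x = b
        · exact ⟨s 2 x, Reach.one hi1, by rw [hh x (Reach.refl x) _ hi1, g1, hb]⟩
        · refine ⟨s 2 (s 1 x), (Reach.one hi0).step hi1, ?_⟩
          rw [hh _ (Reach.one hi0) _ hi1, g1, hh x (Reach.refl x) _ hi0, g0, mul_one, e1]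
          congr 2
          revert hb; cases ε x <;> cases b <;> simp
      have hB : ∀ b, ∃ y, Reach s (Set.Ico 1 5) x y ∧ h y = h x * B b := by
        intro b
        by_cases hb : δ x = b
        · exact ⟨s 3 x, Reach.one hi2, by rw [hh x (Reach.refl x) _ hi2, g2, hb]⟩
        · refine ⟨s 3 (s 4 x), (Reach.one hi3).step hi2, ?_⟩
          rw [hh _ (Reach.one hi3) _ hi2, g2, hh x (Reach.refl x) _ hi3, g3, mul_one, d4]
          congr 2
          revert hb; cases δ x <;> cases b <;> simp
      fin_cases j
      · exact hA true
      · exact hA false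
      · exact hB true
      · exact hB false)
    ![1, 1, 1, 1] (by intro h; have := congrFun h 2; simp at this)
  simp [Fin.sum_univ_four, M] at hpos
  have : 4 ≤ p true ∨ 4 ≤ p false := by
    have := hp true; have := hp false; omega
  rcases this with hc | hc
  · have : 1 / 2 ≤ c1 ^ 2 := cos_ge4 hc
    nlinarith
  · have : 1 / 2 ≤ c2 ^ 2 := cos_ge4 hc
    nlinarith

open scoped Classical RealInnerProductSpace

/-! ### Classification of two-orbit flag systems -/

/-- The type of the rhombic solids: color flips under `s 1` only. -/
def RType {Ω : Type} (s : ℕ → Ω → Ω) (q : ℕ) : Prop :=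
  ∃ col : Ω → Bool, (∀ x, col (s 1 x) = !(col x)) ∧ (∀ x, col (s 2 x) = col x) ∧
    (∀ x, col (s 3 x) = col x) ∧ (∀ x, Per s 1 2 x = 4) ∧
    ∀ x, Per s 2 3 x = cond (col x) 3 q

/-- parity of periods -/
theorem even_per {Ω : Type} {s : ℕ → Ω → Ω} {i j : ℕ} (col : Ω → Bool)
    (hi : ∀ x, col (s i x) = !(col x)) (hj : ∀ x, col (s j x) = col x) (x : Ω) :
    ∃ m, Per s i j x = 2 * m := by
  have key : ∀ m x, col ((s i ∘ s j)^[m] x) = xor (col x) (decide (m % 2 = 1)) := by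
    intro m
    induction m with
    | zero => intro x; simp
    | succ m ih =>
      intro x
      rw [Function.iterate_succ_apply, ih]
      simp only [Function.comp_apply, hi, hj]
      rcases Nat.mod_two_eq_zero_or_one m with h | h
      · have : (m + 1) % 2 = 1 := by omega
        simp [h, this]
      · have : (m + 1) % 2 = 0 := by omega
        simp [h, this]
  have h := key (Per s i j x) x
  rw [iter_Per] at h
  rcases Nat.mod_two_eq_zero_or_one (Per s i j x) with h' | h'
  · exact ⟨Per s i j x / 2, by omega⟩
  · rw [h'] at h
    revert h; cases col x <;> simp

theorem FS.low {Ω : Type} {n : ℕ} {s : ℕ → Ω → Ω} (F : FS n s) (hn : 4 ≤ n) (col : Ω → Bool)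
    (xt xf : Ω) (hxt : col xt = true) (hxf : col xf = false)
    (hper : ∀ i j, 0 < i → i < n → 0 < j → j < n → ∀ x y, col x = col y → Per s i j x = Per s i j y)
    (k1 : ∀ x, col (s 1 x) = !(col x)) (k2 : ∀ x, col (s 2 x) = col x)
    (k3 : ∀ x, col (s 3 x) = col x)
    (k4 : 4 < n → ((∀ x, col (s 4 x) = !(col x)) ∧ n = 5) ∨ ∀ x, col (s 4 x) = col x)
    (hne : Per s 2 3 xt ≠ Per s 2 3 xf) :
    n = 4 ∧ (RType s 4 ∨ RType s 5) := by
  have hv : ∀ i, 0 < i → i ≤ 3 → 0 < i ∧ i < n := fun i _ _ => by omega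
  -- constant periods
  have hconst : ∀ i j k, 0 < i → i < n → 0 < j → j < n → (∀ x, col (s k x) = !(col x)) →
      (∀ x, Per s i j (s k x) = Per s i j x) → ∀ x, Per s i j x = Per s i j xt := by
    intro i j k h1 h2 h3 h4 hk hpk x
    by_cases hx : col x = true
    · exact hper i j h1 h2 h3 h4 _ _ (by rw [hx, hxt])
    · rw [← hpk x]
      apply hper i j h1 h2 h3 h4
      rw [hk, hxt]
      simpa using hx
  have h12 := hconst 1 2 1 (by omega) (by omega) (by omega) (by omega) k1
    (fun x => Per_left (F.iv (by omega)) (F.iv (by omega)) x)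
  obtain ⟨m, hm⟩ := even_per col k1 k2 xt
  have hm3 := F.Per_ge (i := 1) (by omega) (by omega) xt
  have hm2 : 2 ≤ m := by norm_num at hm3; omega
  have h12' : ∀ x, Per s 1 2 x = 2 * m := fun x => by rw [h12, hm]
  let p : Bool → ℕ := fun b => cond b (Per s 2 3 xt) (Per s 2 3 xf)
  have h23 : ∀ x, Per s 2 3 x = p (col x) := by
    intro x
    cases hx : col x
    · exact hper 2 3 (by omega) (by omega) (by omega) (by omega) _ _ (by rw [hx, hxf])
    · exact hper 2 3 (by omega) (by omega) (by omega) (by omega) _ _ (by rw [hx, hxt])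
  have hp3 : ∀ b, 3 ≤ p b := by
    intro b; cases b <;> exact F.Per_ge (i := 2) (by omega) (by omega) _
  have hpp : p true ≠ p false := hne
  rcases Nat.lt_or_ge 4 n with h4 | h4
  · exfalso
    have h34 := hconst 3 4 1 (by omega) (by omega) (by omega) (by omega) k1
      (fun x => F.Per_other (by omega) (by omega) (by omega) (by omega) (by omega) x)
    rcases k4 h4 with ⟨k5, hn5⟩ | k5
    · subst hn5
      obtain ⟨l, hl⟩ := even_per col k5 k3 xt
      rw [F.Per_sw (by omega) (by omega)] at hl
      have hl3 := F.Per_ge (i := 3) (by omega) (by omega) xt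
      norm_num at hl3
      exact F.noR4 xt col k1 k2 k3 k5 m l p hm2 (by omega) hp3 h12' h23
        (fun x => by rw [h34, hl]) hpp
    · exact F.noR3 xt h4 col k1 k2 k3 k5 m p hm2 hp3 _ (F.Per_ge (i := 3) (by omega) (by omega) xt)
        h12' h23 h34 hpp
  · have hn4 : n = 4 := by omega
    refine ⟨hn4, ?_⟩
    obtain ⟨hm', h⟩ := F.R2' xt hn col k1 k2 k3 m p hm2 hp3 h12' h23 hpp
    subst hm'
    have main : ∀ q, (p true = 3 ∧ p false = q) ∨ (p false = 3 ∧ p true = q) → RType s q := by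
      intro q hq
      rcases hq with ⟨h1, h2⟩ | ⟨h1, h2⟩
      · refine ⟨col, k1, k2, k3, h12', fun x => ?_⟩
        rw [h23]
        cases col x
        · exact h2
        · exact h1
      · refine ⟨fun x => !(col x), fun x => by simp [k1], fun x => by simp [k2],
          fun x => by simp [k3], h12', fun x => ?_⟩
        rw [h23]
        show p (col x) = cond (!(col x)) 3 q
        cases col x
        · exact h1
        · exact h2
    rcases h with ⟨h1, h2 | h2⟩ | ⟨h1, h2 | h2⟩
    · exact Or.inl (main 4 (Or.inl ⟨h1, h2⟩))
    · exact Or.inr (main 5 (Or.inl ⟨h1, h2⟩))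
    · exact Or.inl (main 4 (Or.inr ⟨h1, h2⟩))
    · exact Or.inr (main 5 (Or.inr ⟨h1, h2⟩))

/-- The classification at the level of flag systems. -/
theorem FS.classify {Ω : Type} {n : ℕ} {s : ℕ → Ω → Ω} (F : FS n s) (col : Ω → Bool)
    (xt xf : Ω) (hxt : col xt = true) (hxf : col xf = false)
    (H2 : ∀ x y, col x = col y → ∃ f : Ω → Ω, Function.Injective f ∧ f x = y ∧
      ∀ i, 0 < i → i < n → ∀ z, f (s i z) = s i (f z))
    (H3 : ∀ x y, col x ≠ col y → ¬ ∃ f : Ω → Ω, f x = y ∧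
      ∀ i, 0 < i → i < n → ∀ z, f (s i z) = s i (f z)) :
    n = 4 ∧ ∃ q, (q = 4 ∨ q = 5) ∧ (RType s q ∨ RType (fun i => s (n - i)) q) := by
  have hper : ∀ i j, 0 < i → i < n → 0 < j → j < n → ∀ x y, col x = col y →
      Per s i j x = Per s i j y := by
    intro i j hi hi' hj hj' x y hxy
    obtain ⟨f, finj, rfl, hf⟩ := H2 x y hxy
    exact (Per_map f finj (hf i hi hi') (hf j hj hj') x).symm
  have hcf : ∀ i, 0 < i → i < n → ∀ x y, col x = col y → col (s i x) = col (s i y) := by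
    intro i hi hi' x y hxy
    obtain ⟨f, finj, rfl, hf⟩ := H2 x y hxy
    by_contra hne
    rw [← hf i hi hi'] at hne
    exact H3 _ _ hne ⟨f, rfl, hf⟩
  have hdich : ∀ i, 0 < i → i < n → (∀ x, col (s i x) = !(col x)) ∨ (∀ x, col (s i x) = col x) := by
    intro i hi hi'
    by_cases h : ∀ x, col (s i x) = col x
    · exact Or.inr h
    · left
      push Not at h
      obtain ⟨x, hx⟩ := h
      intro y
      by_cases hxy : col y = col x
      · rw [hcf i hi hi' y x hxy, hxy]
        revert hx; cases col (s i x) <;> cases col x <;> simp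
      · have e : col y = col (s i x) := by
          revert hx hxy; cases col (s i x) <;> cases col x <;> cases col y <;> simp
        rw [hcf i hi hi' y _ e, F.iv ⟨hi, hi'⟩]
        revert hxy; cases col x <;> cases col y <;> simp
  have hnb : ∀ i, ¬ ((∀ x, col (s i x) = !(col x)) ∧ (∀ x, col (s i x) = col x)) := by
    rintro i ⟨h1, h2⟩
    have := h1 xt; rw [h2 xt] at this; revert this; cases col xt <;> simp
  -- some period differs
  obtain ⟨i, hi, hi', hne⟩ : ∃ i, 0 < i ∧ i + 1 < n ∧ Per s i (i + 1) xt ≠ Per s i (i + 1) xf := by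
    by_contra hcon
    push Not at hcon
    have hall : ∀ i, 0 < i → i + 1 < n → ∀ x x', Per s i (i + 1) x = Per s i (i + 1) x' := by
      intro i hi hi'
      have : ∀ x, Per s i (i + 1) x = Per s i (i + 1) xt := by
        intro x
        cases hx : col x
        · rw [hcon i hi hi']
          exact hper i (i + 1) hi (by omega) (by omega) hi' _ _ (by rw [hx, hxf])
        · exact hper i (i + 1) hi (by omega) (by omega) hi' _ _ (by rw [hx, hxt])
      intro x x'; rw [this x, this x']
    obtain ⟨f, hf, hf'⟩ := F.exists_map F (C := Unit) (fun _ => ()) (fun _ => ()) (fun _ _ => ())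
      (fun _ _ _ _ => rfl) (fun _ _ _ _ => rfl) (by
        intro i j hi hij hj x x' _
        rcases eq_or_ne j (i + 1) with rfl | hne
        · rw [hall i hi hj x x']
        · rw [F.Per_comm (by omega) (by omega) (by omega),
            F.Per_comm (by omega) (by omega) (by omega)]) xt xf rfl
    exact H3 xt xf (by rw [hxt, hxf]; simp) ⟨f, hf, hf'⟩
  have hpres : ∀ k, 0 < k → k < n → k + 1 ≠ i → k ≠ i + 2 → ∀ x, col (s k x) = col x := by
    intro k hk hk' hk1 hk2
    refine (hdich k hk hk').resolve_left fun hfl => hne ?_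
    have hinv : ∀ x, Per s i (i + 1) (s k x) = Per s i (i + 1) x := by
      intro x
      rcases eq_or_ne k i with rfl | h1
      · exact Per_left (F.iv (by omega)) (F.iv (by omega)) x
      · rcases eq_or_ne k (i + 1) with rfl | h2
        · exact Per_right (F.iv (by omega)) (F.iv (by omega)) x
        · exact F.Per_other (by omega) (by omega) (by omega) (by omega) (by omega) x
    rw [← hinv xt]
    exact hper i (i + 1) hi (by omega) (by omega) hi' _ _ (by rw [hfl, hxt, hxf]; rfl)
  have hR1 : ∀ k, 0 < k → k + 2 < n → (∀ x, col (s (k + 1) x) = !(col x)) →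
      (∀ x, col (s k x) = col x) → (∀ x, col (s (k + 2) x) = col x) → False := by
    intro k hk hk' hf h1 h2
    have hc1 : ∀ x, Per s k (k + 1) x = Per s k (k + 1) xt := by
      intro x
      by_cases hx : col x = true
      · exact hper _ _ (by omega) (by omega) (by omega) (by omega) _ _ (by rw [hx, hxt])
      · rw [← Per_right (F.iv (i := k) (by omega)) (F.iv (i := k + 1) (by omega)) x]
        apply hper _ _ (by omega) (by omega) (by omega) (by omega)
        rw [hf, hxt]
        simpa using hx
    have hc2 : ∀ x, Per s (k + 1) (k + 2) x = Per s (k + 1) (k + 2) xt := by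
      intro x
      by_cases hx : col x = true
      · exact hper _ _ (by omega) (by omega) (by omega) (by omega) _ _ (by rw [hx, hxt])
      · rw [← Per_left (F.iv (i := k + 1) (by omega)) (F.iv (i := k + 2) (by omega)) x]
        apply hper _ _ (by omega) (by omega) (by omega) (by omega)
        rw [hf, hxt]
        simpa using hx
    obtain ⟨m, hm⟩ := even_per col hf h1 xt
    rw [F.Per_sw (by omega) (by omega)] at hm
    obtain ⟨l, hl⟩ := even_per col hf h2 xt
    have g1 := F.Per_ge (i := k) hk (by omega) xt
    have g2 : 3 ≤ Per s (k + 1) (k + 2) xt := F.Per_ge (i := k + 1) (by omega) (by omega) xt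
    exact F.noR1 xt hk hk' (p := Per s k (k + 1) xt) (q := Per s (k + 1) (k + 2) xt)
      (by omega) (by omega) hc1 hc2
  have hlow : 1 < i → (∀ x, col (s (i - 1) x) = !(col x)) → i = 2 := by
    intro h1 hf
    by_contra h2
    obtain ⟨k, rfl⟩ : ∃ k, i = k + 2 := ⟨i - 2, by omega⟩
    exact hR1 k (by omega) (by omega) hf (hpres k (by omega) (by omega) (by omega) (by omega))
      (hpres _ (by omega) (by omega) (by omega) (by omega))
  have hhigh : i + 2 < n → (∀ x, col (s (i + 2) x) = !(col x)) → n = i + 3 := by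
    intro h1 hf
    by_contra h2
    exact hR1 (i + 1) (by omega) (by omega) hf
      (hpres _ (by omega) (by omega) (by omega) (by omega))
      (hpres _ (by omega) (by omega) (by omega) (by omega))
  by_cases hL : 1 < i ∧ ∀ x, col (s (i - 1) x) = !(col x)
  · have hi2 := hlow hL.1 hL.2
    subst hi2
    obtain ⟨h4, h5⟩ := F.low (by omega) col xt xf hxt hxf hper hL.2
      (hpres 2 (by omega) (by omega) (by omega) (by omega))
      (hpres 3 (by omega) (by omega) (by omega) (by omega))
      (fun h4 => (hdich 4 (by omega) h4).imp (fun h => ⟨h, hhigh h4 h⟩) id) hne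
    refine ⟨h4, ?_⟩
    rcases h5 with h5 | h5
    · exact ⟨4, Or.inl rfl, Or.inl h5⟩
    · exact ⟨5, Or.inr rfl, Or.inl h5⟩
  · have hLp : ∀ k, 0 < k → k < n → k ≠ i + 2 → ∀ x, col (s k x) = col x := by
      intro k hk hk' hk2
      by_cases hki : k + 1 = i
      · refine (hdich k hk hk').resolve_left fun hf => hL ⟨by omega, ?_⟩
        have : i - 1 = k := by omega
        rw [this]; exact hf
      · exact hpres k hk hk' hki hk2
    have hH : i + 2 < n ∧ ∀ x, col (s (i + 2) x) = !(col x) := by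
      by_contra hcon
      have hallp : ∀ k ∈ Set.Ioo 0 n, ∀ x, col (s k x) = col x := by
        intro k hk
        rcases eq_or_ne k (i + 2) with rfl | hk2
        · exact (hdich _ hk.1 hk.2).resolve_left fun hf => hcon ⟨hk.2, hf⟩
        · exact hLp k hk.1 hk.2 hk2
      have := (F.conn xt xf).inv (fun z => col z = true) (fun k hk z hz => by rw [hallp k hk, hz]) hxt
      rw [hxf] at this
      simp at this
    have hn := hhigh hH.1 hH.2
    obtain ⟨h4, h5⟩ := F.rev.low (by omega) col xt xf hxt hxf
      (fun a b ha ha' hb hb' x y hxy =>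
        hper (n - a) (n - b) (by omega) (by omega) (by omega) (by omega) x y hxy)
      (by
        have : n - 1 = i + 2 := by omega
        simp only [this]; exact hH.2)
      (hLp (n - 2) (by omega) (by omega) (by omega))
      (hLp (n - 3) (by omega) (by omega) (by omega))
      (fun h4 => Or.inr (hLp (n - 4) (by omega) (by omega) (by omega)))
      (by
        have e1 : n - 2 = i + 1 := by omega
        have e2 : n - 3 = i := by omega
        have key : ∀ x, Per (fun i => s (n - i)) 2 3 x = Per s i (i + 1) x := by
          intro x
          rw [← F.Per_sw (by omega) (by omega)]
          simp only [Per, e1, e2]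
        rw [key, key]
        exact hne)
    refine ⟨h4, ?_⟩
    rcases h5 with h5 | h5
    · exact ⟨4, Or.inl rfl, Or.inr h5⟩
    · exact ⟨5, Or.inr rfl, Or.inr h5⟩

theorem FS.surj {Ω Ω' : Type} {n : ℕ} {s : ℕ → Ω → Ω} {s' : ℕ → Ω' → Ω'} (F' : FS n s')
    (f : Ω → Ω') (hf : ∀ i, 0 < i → i < n → ∀ x, f (s i x) = s' i (f x)) (x0 : Ω) :
    Function.Surjective f := by
  intro y
  refine (F'.conn (f x0) y).inv (fun z => ∃ x, f x = z) ?_ ⟨x0, rfl⟩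
  rintro i hi _ ⟨x, rfl⟩
  exact ⟨s i x, hf i hi.1 hi.2 x⟩

/-- Uniqueness of flag systems of a given rhombic type. -/
theorem RType.exists_map {Ω Ω' : Type} {s : ℕ → Ω → Ω} {s' : ℕ → Ω' → Ω'} {q : ℕ} (F : FS 4 s)
    (F' : FS 4 s') (h : RType s q) (h' : RType s' q) (x0 : Ω) (x0' : Ω') :
    ∃ f : Ω → Ω', ∀ i, 0 < i → i < 4 → ∀ x, f (s i x) = s' i (f x) := by
  obtain ⟨c, k1, k2, k3, p1, p2⟩ := h
  obtain ⟨c', k1', k2', k3', p1', p2'⟩ := h'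
  obtain ⟨y0, hy0⟩ : ∃ y0, c x0 = c' y0 := by
    by_cases e : c x0 = c' x0'
    · exact ⟨_, e⟩
    · refine ⟨s' 1 x0', ?_⟩
      rw [k1']
      revert e; cases c x0 <;> cases c' x0' <;> simp
  obtain ⟨f, -, hf⟩ := F.exists_map F' c c' (fun i b => if i = 1 then !b else b)
    (by
      intro i hi hi' x
      obtain rfl | rfl | rfl : i = 1 ∨ i = 2 ∨ i = 3 := by omega
      · simp [k1]
      · simp [k2]
      · simp [k3])
    (by
      intro i hi hi' x
      obtain rfl | rfl | rfl : i = 1 ∨ i = 2 ∨ i = 3 := by omega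
      · simp [k1']
      · simp [k2']
      · simp [k3'])
    (by
      intro i j hi hij hj x x' hxx
      have : (i = 1 ∧ j = 2) ∨ (i = 1 ∧ j = 3) ∨ (i = 2 ∧ j = 3) := by omega
      rcases this with ⟨rfl, rfl⟩ | ⟨rfl, rfl⟩ | ⟨rfl, rfl⟩
      · rw [p1, p1']
      · rw [F.Per_comm (by omega) (by omega) (by omega),
            F'.Per_comm (by omega) (by omega) (by omega)]
      · rw [p2, p2', hxx]) x0 y0 hy0
  exact ⟨f, hf⟩

theorem RType.exists_equiv {Ω Ω' : Type} {s : ℕ → Ω → Ω} {s' : ℕ → Ω' → Ω'} {q : ℕ} (F : FS 4 s)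
    (F' : FS 4 s') (h : RType s q) (h' : RType s' q) (x0 : Ω) (x0' : Ω') :
    ∃ f : Ω → Ω', Function.Bijective f ∧ ∀ i, 0 < i → i < 4 → ∀ x, f (s i x) = s' i (f x) := by
  obtain ⟨f, hf⟩ := RType.exists_map F F' h h' x0 x0'
  obtain ⟨g, hg⟩ := RType.exists_map F' F h' h x0' x0
  have h1 := F'.surj f hf x0
  have h2 := F.surj g hg x0'
  have := F.fin
  refine ⟨f, ⟨?_, h1⟩, hf⟩
  exact (Finite.injective_iff_surjective.2 (h2.comp h1)).of_comp

open scoped Classical RealInnerProductSpace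

/-! ### Polytope-like posets and their flags -/

/-- A graded poset with the properties of face lattices which we need. -/
structure PPoset (L : Type) [PartialOrder L] (ρ : L → ℕ) (n : ℕ) : Prop where
  fin : Finite L
  bot : ∃ b, (∀ x, b ≤ x) ∧ ρ b = 0
  top : ∃ t, (∀ x, x ≤ t) ∧ ρ t = n
  mono : ∀ x y : L, x < y → ρ x < ρ y
  gap : ∀ x y : L, x < y → ρ x + 2 ≤ ρ y → ∃ z, x < z ∧ z < y
  diamond : ∀ x y : L, ρ y = ρ x + 2 → ∀ z, x < z → z < y →
    ∃ z', z' ≠ z ∧ (x < z' ∧ z' < y) ∧ ∀ w, x < w → w < y → w = z ∨ w = z'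
  lin : ∀ a b e f : L, a ≠ b → ρ a = ρ b → a < e → b < e → a < f → b < f →
    ρ e = ρ a + 1 → ρ f = ρ a + 1 → e = f
  sweep : ∀ X Y : L, X < Y → ∃ θ : L → ℕ,
    (∀ v w, X < v → X < w → v ≤ Y → w ≤ Y → ρ v = ρ X + 1 → ρ w = ρ X + 1 → θ v = θ w → v = w) ∧
    (∀ v w, X < v → X < w → v ≤ Y → w ≤ Y → ρ v = ρ X + 1 → ρ w = ρ X + 1 → θ w < θ v →
      ∃ e v', v < e ∧ v' < e ∧ e ≤ Y ∧ ρ e = ρ X + 2 ∧ X < v' ∧ ρ v' = ρ X + 1 ∧ θ v' < θ v) ∧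
    (∀ v, X < v → v ≤ Y → ρ v = ρ X + 1 → ∀ e e' v1 v2, v < e → v < e' → e ≤ Y → e' ≤ Y →
      ρ e = ρ X + 2 → ρ e' = ρ X + 2 → X < v1 → v1 < e → θ v1 < θ v → X < v2 → v2 < e' →
      θ v2 < θ v →
      Relation.ReflTransGen (fun e e' => v < e ∧ v < e' ∧ e ≠ e' ∧ ρ e = ρ X + 2 ∧ ρ e' = ρ X + 2 ∧
        ∃ f, e < f ∧ e' < f ∧ f ≤ Y ∧ ρ f = ρ X + 3 ∧
          ∀ w, X < w → w < f → ρ w = ρ X + 1 → w ≠ v → θ w < θ v) e e')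

abbrev Fl (L : Type) [PartialOrder L] (ρ : L → ℕ) (n : ℕ) : Type :=
  {c : ℕ → L // (∀ i, i ≤ n → ρ (c i) = i) ∧ (∀ i, i < n → c i < c (i + 1)) ∧ ∀ i, n ≤ i → c i = c n}

/-- the other element of a diamond -/
noncomputable def oth {L : Type} [PartialOrder L] (x z y : L) : L :=
  if h : ∃ z', z' ≠ z ∧ (x < z' ∧ z' < y) ∧ ∀ w, x < w → w < y → w = z ∨ w = z' then h.choose else z

namespace PPoset
variable {L : Type} [PartialOrder L] {ρ : L → ℕ} {n : ℕ}

theorem oth_spec (H : PPoset L ρ n) {x z y : L} (h1 : x < z) (h2 : z < y) (h3 : ρ y = ρ x + 2) :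
    oth x z y ≠ z ∧ (x < oth x z y ∧ oth x z y < y) ∧ ∀ w, x < w → w < y → w = z ∨ w = oth x z y := by
  have h := H.diamond x y h3 z h1 h2
  unfold oth
  rw [dif_pos h]
  exact h.choose_spec

theorem eq_of_le (H : PPoset L ρ n) {x y : L} (h : x ≤ y) (h' : ρ y ≤ ρ x) : x = y := by
  rcases eq_or_lt_of_le h with h | h
  · exact h
  · have := H.mono _ _ h; omega

theorem lt_of_le (H : PPoset L ρ n) {x y : L} (h : x ≤ y) (h' : ρ x < ρ y) : x < y :=
  lt_of_le_of_ne h (by rintro rfl; omega)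

theorem le_mono (H : PPoset L ρ n) {x y : L} (h : x ≤ y) : ρ x ≤ ρ y := by
  rcases eq_or_lt_of_le h with h | h
  · rw [h]
  · exact (H.mono _ _ h).le

theorem exists_atom (H : PPoset L ρ n) : ∀ m (x y : L), ρ y ≤ m → x < y →
    ∃ z, x < z ∧ z ≤ y ∧ ρ z = ρ x + 1 := by
  intro m
  induction m with
  | zero => intro x y h1 h2; have := H.mono _ _ h2; omega
  | succ m ih =>
    intro x y h1 h2
    have h3 := H.mono _ _ h2
    rcases Nat.lt_or_ge (ρ y) (ρ x + 2) with h4 | h4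
    · exact ⟨y, h2, le_rfl, by omega⟩
    · obtain ⟨z, hz1, hz2⟩ := H.gap x y h2 h4
      have := H.mono _ _ hz2
      obtain ⟨w, hw1, hw2, hw3⟩ := ih x z (by omega) hz1
      exact ⟨w, hw1, hw2.trans hz2.le, hw3⟩

theorem exists_chain (H : PPoset L ρ n) : ∀ m (e y : L), e ≤ y → ρ y = ρ e + m →
    ∃ c : ℕ → L, c (ρ e) = e ∧ c (ρ y) = y ∧ (∀ i, ρ e ≤ i → i ≤ ρ y → ρ (c i) = i) ∧
      ∀ i, ρ e ≤ i → i < ρ y → c i < c (i + 1) := by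
  intro m
  induction m with
  | zero =>
    intro e y h1 h2
    obtain rfl := H.eq_of_le h1 (by omega)
    exact ⟨fun _ => e, rfl, rfl, fun i _ _ => by dsimp only; omega, fun i _ _ => by omega⟩
  | succ m ih =>
    intro e y h1 h2
    have h3 := H.lt_of_le h1 (by omega)
    obtain ⟨e', he1, he2, he3⟩ := H.exists_atom _ e y le_rfl h3
    obtain ⟨c, c1, c2, c3, c4⟩ := ih e' y he2 (by omega)
    refine ⟨Function.update c (ρ e) e, by simp, ?_, ?_, ?_⟩
    · rw [Function.update_of_ne (by omega), c2]
    · intro i hi hi'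
      rcases eq_or_ne i (ρ e) with rfl | hne
      · simp
      · rw [Function.update_of_ne hne, c3 i (by omega) hi']
    · intro i hi hi'
      rw [Function.update_of_ne (a := i + 1) (by omega)]
      rcases eq_or_ne i (ρ e) with rfl | hne
      · rw [Function.update_self, ← he3, c1]; exact he1
      · rw [Function.update_of_ne hne]; exact c4 i (by omega) hi'

theorem Fl.mono' (x : Fl L ρ n) {i j : ℕ} (h : i ≤ j) : x.1 i ≤ x.1 j := by
  induction h with
  | refl => exact le_rfl
  | step h ih =>
    rename_i m
    refine ih.trans ?_
    rcases Nat.lt_or_ge m n with h' | h'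
    · exact (x.2.2.1 m h').le
    · rw [x.2.2.2 m h', x.2.2.2 (m + 1) (by omega)]

theorem Fl.lt' (x : Fl L ρ n) {i j : ℕ} (h : i < j) (hj : j ≤ n) : x.1 i < x.1 j :=
  (x.2.2.1 i (by omega)).trans_le (Fl.mono' x (by omega))

theorem Fl.rk (x : Fl L ρ n) {i : ℕ} (h : i ≤ n) : ρ (x.1 i) = i := x.2.1 i h

theorem Fl.ext' {x y : Fl L ρ n} (h : ∀ i, x.1 i = y.1 i) : x = y := Subtype.ext (funext h)

theorem Fl.zero (H : PPoset L ρ n) (x y : Fl L ρ n) : x.1 0 = y.1 0 := by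
  obtain ⟨b, hb, hb'⟩ := H.bot
  have : ∀ z : Fl L ρ n, b = z.1 0 := fun z => H.eq_of_le (hb _) (by rw [Fl.rk z (by omega)]; omega)
  rw [← this, ← this]

theorem Fl.last (H : PPoset L ρ n) (x y : Fl L ρ n) : x.1 n = y.1 n := by
  obtain ⟨b, hb, hb'⟩ := H.top
  have : ∀ z : Fl L ρ n, z.1 n = b := fun z => H.eq_of_le (hb _) (by rw [Fl.rk z (by omega)]; omega)
  rw [this, this]

/-- the adjacency maps -/
noncomputable def adj (H : PPoset L ρ n) (i : ℕ) (x : Fl L ρ n) : Fl L ρ n :=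
  if h : 0 < i ∧ i < n then
    ⟨Function.update x.1 i (oth (x.1 (i - 1)) (x.1 i) (x.1 (i + 1))), by
      have h1 : x.1 (i - 1) < x.1 i := Fl.lt' x (by omega) (by omega)
      have h2 : x.1 i < x.1 (i + 1) := Fl.lt' x (by omega) (by omega)
      obtain ⟨-, ⟨k1, k2⟩, -⟩ := H.oth_spec h1 h2
        (by rw [Fl.rk x (by omega), Fl.rk x (by omega)]; omega)
      have k3 := H.mono _ _ k1
      have k4 := H.mono _ _ k2
      rw [Fl.rk x (by omega)] at k3 k4
      refine ⟨?_, ?_, ?_⟩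
      · intro j hj
        rcases eq_or_ne j i with rfl | hne
        · rw [Function.update_self]; omega
        · rw [Function.update_of_ne hne, Fl.rk x hj]
      · intro j hj
        rcases eq_or_ne j i with rfl | hne
        · rw [Function.update_self, Function.update_of_ne (by omega)]; exact k2
        · rw [Function.update_of_ne hne]
          rcases eq_or_ne (j + 1) i with rfl | hne'
          · rw [Function.update_self]; exact k1
          · rw [Function.update_of_ne hne']; exact x.2.2.1 j hj
      · intro j hj
        rw [Function.update_of_ne (by omega), Function.update_of_ne (by omega)]
        exact x.2.2.2 j hj⟩
  else x

theorem adj_off (H : PPoset L ρ n) {i j : ℕ} (x : Fl L ρ n) (hj : j ≠ i) :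
    (H.adj i x).1 j = x.1 j := by
  unfold adj
  split_ifs with h
  · exact Function.update_of_ne hj _ _
  · rfl

theorem adj_on (H : PPoset L ρ n) {i : ℕ} (hi : 0 < i ∧ i < n) (x : Fl L ρ n) :
    (H.adj i x).1 i = oth (x.1 (i - 1)) (x.1 i) (x.1 (i + 1)) := by
  unfold adj
  rw [dif_pos hi]
  exact Function.update_self _ _ _

theorem adj_spec (H : PPoset L ρ n) {i : ℕ} (hi : 0 < i ∧ i < n) (x : Fl L ρ n) :
    (H.adj i x).1 i ≠ x.1 i ∧ ∀ w, x.1 (i - 1) < w → w < x.1 (i + 1) → w = x.1 i ∨ w = (H.adj i x).1 i := by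
  rw [H.adj_on hi]
  have h1 : x.1 (i - 1) < x.1 i := Fl.lt' x (by omega) (by omega)
  have h2 : x.1 i < x.1 (i + 1) := Fl.lt' x (by omega) (by omega)
  obtain ⟨k0, -, k1⟩ := H.oth_spec h1 h2
        (by rw [Fl.rk x (by omega), Fl.rk x (by omega)]; omega)
  exact ⟨k0, k1⟩

theorem adj_uniq (H : PPoset L ρ n) {i : ℕ} (hi : 0 < i ∧ i < n) {x y : Fl L ρ n}
    (h : ∀ j, j ≠ i → y.1 j = x.1 j) : y = x ∨ y = H.adj i x := by
  have h1 : y.1 (i - 1) < y.1 i := Fl.lt' y (by omega) (by omega)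
  have h2 : y.1 i < y.1 (i + 1) := Fl.lt' y (by omega) (by omega)
  rw [h (i - 1) (by omega)] at h1
  rw [h (i + 1) (by omega)] at h2
  rcases (H.adj_spec hi x).2 _ h1 h2 with h3 | h3
  · left; apply Fl.ext'; intro j
    rcases eq_or_ne j i with rfl | hj
    · exact h3
    · exact h j hj
  · right; apply Fl.ext'; intro j
    rcases eq_or_ne j i with rfl | hj
    · exact h3
    · rw [h j hj, H.adj_off x hj]

theorem adj_eq (H : PPoset L ρ n) {i : ℕ} (hi : 0 < i ∧ i < n) {x y : Fl L ρ n}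
    (h : ∀ j, j ≠ i → y.1 j = x.1 j) (h' : y ≠ x) : y = H.adj i x :=
  (H.adj_uniq hi h).resolve_left h'

theorem adj_ne (H : PPoset L ρ n) {i : ℕ} (hi : 0 < i ∧ i < n) (x : Fl L ρ n) : H.adj i x ≠ x :=
  fun h => (H.adj_spec hi x).1 (by rw [h])

theorem adj_invol (H : PPoset L ρ n) {i : ℕ} (hi : 0 < i ∧ i < n) (x : Fl L ρ n) :
    H.adj i (H.adj i x) = x :=
  (H.adj_uniq hi (x := x) (fun j hj => by rw [H.adj_off _ hj, H.adj_off _ hj])).resolve_right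
    (H.adj_ne hi _)

theorem adj_comm (H : PPoset L ρ n) {i j : ℕ} (hi : 0 < i) (hij : i + 2 ≤ j) (hj : j < n)
    (x : Fl L ρ n) : H.adj i (H.adj j x) = H.adj j (H.adj i x) := by
  symm
  apply H.adj_eq (by omega)
  · intro k hk
    rcases eq_or_ne k j with rfl | hkj
    · rw [H.adj_on (by omega), H.adj_on (by omega), H.adj_off _ (by omega), H.adj_off _ (by omega),
        H.adj_off _ (by omega)]
    · rw [H.adj_off _ hkj, H.adj_off _ hkj, H.adj_off _ hk]
  · intro h
    have : (H.adj j (H.adj i x)).1 i = (H.adj j x).1 i := by rw [h]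
    rw [H.adj_off (i := j) (j := i) _ (by omega), H.adj_off (i := j) (j := i) _ (by omega)] at this
    exact (H.adj_spec (i := i) (by omega) x).1 this

theorem adj_per (H : PPoset L ρ n) {i : ℕ} (hi : 0 < i) (hi' : i + 1 < n) (x : Fl L ρ n) :
    H.adj i (H.adj (i + 1) (H.adj i (H.adj (i + 1) x))) ≠ x := by
  intro h
  set y := H.adj (i + 1) x with hy
  set z := H.adj i y with hz
  set w := H.adj (i + 1) z with hw
  have e1 : w.1 (i + 1) = x.1 (i + 1) := by
    have := H.adj_off (i := i) (j := i + 1) w (by omega)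
    rw [h] at this
    exact this.symm
  have e2 : w.1 i = z.1 i := H.adj_off _ (by omega)
  have e3 : z.1 (i + 1) = y.1 (i + 1) := H.adj_off _ (by omega)
  have e4 : y.1 i = x.1 i := H.adj_off _ (by omega)
  have n1 : y.1 (i + 1) ≠ x.1 (i + 1) := (H.adj_spec (by omega) x).1
  have n2 : z.1 i ≠ y.1 i := (H.adj_spec (by omega) y).1
  apply n1
  have l1 : z.1 i < z.1 (i + 1) := Fl.lt' z (by omega) (by omega)
  have l2 : w.1 i < w.1 (i + 1) := Fl.lt' w (by omega) (by omega)
  have l3 : x.1 i < x.1 (i + 1) := Fl.lt' x (by omega) (by omega)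
  have l4 : y.1 i < y.1 (i + 1) := Fl.lt' y (by omega) (by omega)
  refine H.lin (z.1 i) (x.1 i) _ _ (by rw [← e4]; exact n2) ?_ (by rw [← e3]; exact l1)
    (by rw [← e4]; exact l4) (by rw [← e1, ← e2]; exact l2) l3 ?_ ?_
  · rw [Fl.rk z (by omega), Fl.rk x (by omega)]
  · rw [Fl.rk y (by omega), Fl.rk z (by omega)]
  · rw [Fl.rk x (by omega), Fl.rk z (by omega)]

/-- gluing a chain into a flag -/
theorem glue (H : PPoset L ρ n) (x : Fl L ρ n) {a b : ℕ} (hab : a ≤ b) (hb : b ≤ n) (e : L)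
    (he : ρ e = a) (h1 : ∀ i, i < a → x.1 i < e) (h2 : e ≤ x.1 b) :
    ∃ z : Fl L ρ n, z.1 a = e ∧ ∀ i, i < a ∨ b ≤ i → z.1 i = x.1 i := by
  have hrb : ρ (x.1 b) = b := Fl.rk x hb
  obtain ⟨c, c1, c2, c3, c4⟩ := H.exists_chain (b - a) e (x.1 b) h2 (by omega)
  rw [he] at c1 c3 c4
  rw [hrb] at c2 c3 c4
  have key : ∀ i, ¬ (i < a ∨ b < i) → i = a ∨ i = b ∨ (a < i ∧ i < b) := fun i h => by omega
  refine ⟨⟨fun i => if i < a ∨ b < i then x.1 i else c i, ?_, ?_, ?_⟩, ?_, ?_⟩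
  · intro i hi
    dsimp only
    split_ifs with h
    · exact Fl.rk x hi
    · exact c3 i (by omega) (by omega)
  · intro i hi
    dsimp only
    by_cases ha : i < a ∨ b < i
    · rw [if_pos ha]
      by_cases hb : i + 1 < a ∨ b < i + 1
      · rw [if_pos hb]; exact x.2.2.1 i hi
      · rw [if_neg hb]
        have : i + 1 = a := by omega
        rw [this, c1]; exact h1 i (by omega)
    · rw [if_neg ha]
      by_cases hb : i + 1 < a ∨ b < i + 1
      · rw [if_pos hb]
        have : i = b := by omega
        rw [this, c2]; exact x.2.2.1 b (by omega)
      · rw [if_neg hb]; exact c4 i (by omega) (by omega)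
  · intro i hi
    dsimp only
    rcases eq_or_ne i n with rfl | hne
    · rfl
    · rw [if_pos (by omega)]
      split_ifs with h
      · exact x.2.2.2 i hi
      · have : n = b := by omega
        have h3 := x.2.2.2 i hi
        have h4 : c n = x.1 n := by subst this; exact c2
        rw [h3, h4]
  · dsimp only; rw [if_neg (by omega), c1]
  · intro i hi
    dsimp only
    split_ifs with h
    · rfl
    · have : i = b := by omega
      rw [this, c2]

theorem exists_flag (H : PPoset L ρ n) : Nonempty (Fl L ρ n) := by
  obtain ⟨b, hb, hb'⟩ := H.bot
  obtain ⟨t, ht, ht'⟩ := H.top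
  obtain ⟨c, c1, c2, c3, c4⟩ := H.exists_chain n b t (hb t) (by omega)
  rw [hb'] at c1 c3 c4
  rw [ht'] at c2 c3 c4
  refine ⟨⟨fun i => if i ≤ n then c i else c n, ?_, ?_, ?_⟩⟩
  · intro i hi; dsimp only; rw [if_pos hi]; exact c3 i (by omega) hi
  · intro i hi; dsimp only; rw [if_pos (by omega), if_pos (by omega)]; exact c4 i (by omega) hi
  · intro i hi
    dsimp only
    rw [if_pos le_rfl]
    split_ifs with h
    · have : i = n := by omega
      rw [this]
    · rfl

theorem rk_le (H : PPoset L ρ n) (x : L) : ρ x ≤ n := by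
  obtain ⟨t, ht, ht'⟩ := H.top
  rw [← ht']; exact H.le_mono (ht x)

theorem exists_flag_le (H : PPoset L ρ n) {F G : L} (h : F ≤ G) :
    ∃ x : Fl L ρ n, x.1 (ρ F) = F ∧ x.1 (ρ G) = G := by
  obtain ⟨x⟩ := H.exists_flag
  obtain ⟨b, hb, hb'⟩ := H.bot
  obtain ⟨t, ht, ht'⟩ := H.top
  have hxn : x.1 n = t := H.eq_of_le (ht _) (by rw [Fl.rk x le_rfl]; omega)
  have hx0 : x.1 0 = b := (H.eq_of_le (hb _) (by rw [Fl.rk x (by omega)]; omega)).symm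
  -- first a chain from bot to G
  have glue2 : ∀ (x : Fl L ρ n) (a c : ℕ), a ≤ c → c ≤ n → ∀ G : L, ρ G = c → x.1 a ≤ G →
      ∃ z : Fl L ρ n, z.1 c = G ∧ ∀ i, i ≤ a → z.1 i = x.1 i := by
    intro x a c hac hcn G hG hxG
    obtain ⟨c1, k1, k2, k3, k4⟩ := H.exists_chain (c - a) (x.1 a) G hxG
      (by rw [Fl.rk x (by omega)]; omega)
    rw [Fl.rk x (by omega)] at k1 k3 k4
    rw [hG] at k2 k3 k4
    obtain ⟨c2, l1, l2, l3, l4⟩ := H.exists_chain (n - c) G t (ht G) (by omega)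
    rw [hG] at l1 l3 l4
    rw [ht'] at l2 l3 l4
    refine ⟨⟨fun i => if i < a then x.1 i else if i < c then c1 i else if i ≤ n then c2 i else t,
      ?_, ?_, ?_⟩, ?_, ?_⟩
    · intro i hi
      dsimp only
      split_ifs with h1 h2
      · exact Fl.rk x hi
      · exact k3 i (by omega) (by omega)
      · exact l3 i (by omega) (by omega)
    · intro i hi
      dsimp only
      by_cases h1 : i < a
      · rw [if_pos h1]
        by_cases h2 : i + 1 < a
        · rw [if_pos h2]; exact x.2.2.1 i hi
        · have h3 : i + 1 = a := by omega
          have : (if i + 1 < a then x.1 (i + 1) else if i + 1 < c then c1 (i + 1) else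
            if i + 1 ≤ n then c2 (i + 1) else t) = x.1 a := by
            rw [if_neg h2]
            split_ifs with h4 h5
            · rw [h3, k1]
            · have : a = c := by omega
              rw [h3, this, l1, ← k2, ← this, k1]
            · omega
          rw [this]
          exact Fl.lt' x h1 (by omega)
      · rw [if_neg h1, if_neg (by omega : ¬ i + 1 < a)]
        by_cases h2 : i < c
        · rw [if_pos h2]
          split_ifs with h4 h6
          · exact k4 i (by omega) h2
          · have : i + 1 = c := by omega
            have h5 := k4 i (by omega) h2
            rw [this] at h5 ⊢
            rw [l1, ← k2]; exact h5
          · omega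
        · rw [if_neg h2, if_neg (by omega : ¬ i + 1 < c), if_pos (by omega : i ≤ n),
            if_pos (by omega : i + 1 ≤ n)]
          exact l4 i (by omega) hi
    · intro i hi
      dsimp only
      rcases eq_or_ne i n with rfl | hne
      · rfl
      · rw [if_neg (by omega : ¬ i < a), if_neg (by omega : ¬ i < c), if_neg (by omega : ¬ i ≤ n),
          if_neg (by omega : ¬ n < a), if_neg (by omega : ¬ n < c), if_pos le_rfl, l2]
    · dsimp only; rw [if_neg (by omega : ¬ c < a), if_neg (by omega : ¬ c < c), if_pos hcn, l1]
    · intro i hi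
      dsimp only
      split_ifs with h1 h2 h3
      · rfl
      · have : i = a := by omega
        rw [this, k1]
      · have e : i = a := by omega
        have : a = c := by omega
        rw [e, this, l1, ← k2, ← this, k1]
      · omega
  obtain ⟨y, y1, -⟩ := glue2 x 0 (ρ F) (by omega) (H.rk_le F) F rfl (by rw [hx0]; exact hb F)
  obtain ⟨z, z1, z2⟩ := glue2 y (ρ F) (ρ G) (H.le_mono h) (H.rk_le G) G rfl (by rw [y1]; exact h)
  exact ⟨z, by rw [z2 _ le_rfl, y1], z1⟩

theorem adj_prev (H : PPoset L ρ n) {I : Set ℕ} {x y : Fl L ρ n} (h : Reach H.adj I x y) {k : ℕ}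
    (hk : k ∉ I) : y.1 k = x.1 k := by
  refine h.inv (fun z => z.1 k = x.1 k) ?_ rfl
  intro i hi z hz
  rw [H.adj_off _ (by rintro rfl; exact hk hi), hz]

/-- extension of a flag through an element -/
theorem ext_flag (H : PPoset L ρ n) (x : Fl L ρ n) {a b : ℕ} (hab : a < b) (hb : b ≤ n) (e : L)
    (he : ρ e = a + 1) (h1 : x.1 a < e) (h2 : e ≤ x.1 b) :
    ∃ z : Fl L ρ n, z.1 (a + 1) = e ∧ ∀ i, i < a + 1 ∨ b ≤ i → z.1 i = x.1 i :=
  H.glue x hab hb e he (fun i hi => (Fl.mono' x (by omega)).trans_lt h1) h2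

theorem conn (H : PPoset L ρ n) : ∀ m a b, b ≤ a + m → 0 < a → b ≤ n → ∀ x y : Fl L ρ n,
    (∀ i, i < a ∨ b ≤ i → x.1 i = y.1 i) → Reach H.adj (Set.Ico a b) x y := by
  intro m
  induction m with
  | zero =>
    intro a b hm ha hb x y h
    have : x = y := Fl.ext' fun i => h i (by omega)
    rw [this]; exact Reach.refl _
  | succ m ih =>
    intro a b hm ha hb
    rcases Nat.lt_or_ge a b with hab | hab
    swap
    · intro x y h
      have : x = y := Fl.ext' fun i => h i (by omega)
      rw [this]; exact Reach.refl _
    have ih' := ih (a + 1) b (by omega) (by omega) hb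
    have hsub : Set.Ico (a + 1) b ⊆ Set.Ico a b := fun i hi => ⟨by have := hi.1; omega, hi.2⟩
    suffices hs : ∀ X Y, X < Y → ρ X = a - 1 → ρ Y = b → ∀ x y : Fl L ρ n,
        (∀ i, i < a ∨ b ≤ i → x.1 i = y.1 i) → x.1 (a - 1) = X → x.1 b = Y →
        Reach H.adj (Set.Ico a b) x y by
      intro x y h
      exact hs _ _ (Fl.lt' x (by omega) hb) (Fl.rk x (by omega)) (Fl.rk x hb) x y h rfl rfl
    intro X Y hXY hrX hrY
    obtain ⟨θ, T1, T2, -⟩ := H.sweep X Y hXY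
    suffices hs : ∀ k, ∀ x y : Fl L ρ n, θ (x.1 a) + θ (y.1 a) ≤ k →
        (∀ i, i < a ∨ b ≤ i → x.1 i = y.1 i) → x.1 (a - 1) = X → x.1 b = Y →
        Reach H.adj (Set.Ico a b) x y from fun x y h => hs _ x y le_rfl h
    intro k
    induction k using Nat.strong_induction_on with
    | _ k ihk =>
    have main : ∀ x y : Fl L ρ n, θ (x.1 a) + θ (y.1 a) ≤ k →
        (∀ i, i < a ∨ b ≤ i → x.1 i = y.1 i) → x.1 (a - 1) = X → x.1 b = Y → θ (y.1 a) < θ (x.1 a) →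
        Reach H.adj (Set.Ico a b) x y := by
      intro x y hk h hX hY hlt
      have hX' : y.1 (a - 1) = X := by rw [← h _ (by omega), hX]
      have hY' : y.1 b = Y := by rw [← h _ (by omega), hY]
      obtain ⟨e, v', e1, e2, e3, e4, e5, e6, e7⟩ := T2 (x.1 a) (y.1 a)
        (by rw [← hX]; exact Fl.lt' x (by omega) (by omega))
        (by rw [← hX']; exact Fl.lt' y (by omega) (by omega))
        (by rw [← hY]; exact Fl.mono' x (by omega))
        (by rw [← hY']; exact Fl.mono' y (by omega))
        (by rw [Fl.rk x (by omega)]; omega) (by rw [Fl.rk y (by omega)]; omega) hlt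
      obtain ⟨z, z1, z2⟩ := H.ext_flag x hab hb e (by omega) e1 (by rw [hY]; exact e3)
      have r1 : Reach H.adj (Set.Ico a b) x z := (ih' x z fun i hi => (z2 i hi).symm).mono hsub
      have r2 := r1.step (i := a) ⟨le_rfl, hab⟩
      refine r2.trans ?_
      have hv : (H.adj a z).1 a = v' := by
        have := (H.adj_spec (i := a) (by omega) z).2 v' (by rw [z2 _ (by omega), hX]; exact e5)
          (by rw [z1]; exact e2)
        rw [z2 a (by omega)] at this
        rcases this with h | h
        · rw [h] at e7; omega
        · exact h.symm
      refine ihk (θ v' + θ (y.1 a)) (by omega) _ _ (by rw [hv]) ?_ ?_ ?_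
      · intro i hi
        rw [H.adj_off _ (by omega), z2 _ (by omega), h i hi]
      · rw [H.adj_off _ (by omega), z2 _ (by omega), hX]
      · rw [H.adj_off _ (by omega), z2 _ (by omega), hY]
    intro x y hk h hX hY
    have hX' : y.1 (a - 1) = X := by rw [← h _ (by omega), hX]
    have hY' : y.1 b = Y := by rw [← h _ (by omega), hY]
    rcases lt_trichotomy (θ (y.1 a)) (θ (x.1 a)) with hlt | heq | hlt
    · exact main x y hk h hX hY hlt
    · refine (ih' x y fun i hi => ?_).mono hsub
      rcases eq_or_ne i a with rfl | hne
      · refine (T1 _ _ ?_ ?_ ?_ ?_ ?_ ?_ heq).symm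
        · rw [← hX']; exact Fl.lt' y (by omega) (by omega)
        · rw [← hX]; exact Fl.lt' x (by omega) (by omega)
        · rw [← hY']; exact Fl.mono' y (by omega)
        · rw [← hY]; exact Fl.mono' x (by omega)
        · rw [Fl.rk y (by omega)]; omega
        · rw [Fl.rk x (by omega)]; omega
      · exact h i (by omega)
    · exact (main y x (by omega) (fun i hi => (h i hi).symm) hX' hY' hlt).symm
        (fun i hi y => H.adj_invol (i := i) ⟨by have := hi.1; omega, by have := hi.2; omega⟩ y)

end PPoset

open scoped Classical RealInnerProductSpace

/-! ### Simple connectivity of the flag system -/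

theorem dihedral {Ω : Type} : ∀ (m : ℕ) {a b : Ω → Ω}, (∀ x, a (a x) = x) → (∀ x, b (b x) = x) →
    (∀ x, a x ≠ x) → (∀ x, b x ≠ x) → ∀ x, (a ∘ b)^[m] x ≠ b x := by
  intro m
  induction m with
  | zero => intro a b _ _ _ hb x h; exact hb x h.symm
  | succ m ih =>
    intro a b ha hb na nb x h
    rw [Function.iterate_succ_apply] at h
    have hs : Function.Semiconj a (b ∘ a) (a ∘ b) := fun z => by simp
    have h2 := (hs.iterate_right m) (b x)
    simp only [Function.comp_apply] at h
    rw [h] at h2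
    apply ih hb ha nb na (b x)
    rw [← h2, ha]
    exact congrArg _ h2

namespace PPoset
variable {L : Type} [PartialOrder L] {ρ : L → ℕ} {n : ℕ}

theorem finFl (H : PPoset L ρ n) : Finite (Fl L ρ n) := by
  have := H.fin
  refine Finite.of_injective (fun (x : Fl L ρ n) (i : Fin (n + 1)) => x.1 i.1) ?_
  intro x y h
  apply Fl.ext'
  intro i
  have key : ∀ i, i ≤ n → x.1 i = y.1 i := fun i hi => congrFun h ⟨i, by omega⟩
  rcases le_total i n with hi | hi
  · exact key i hi
  · rw [x.2.2.2 i hi, y.2.2.2 i hi]; exact key n le_rfl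

theorem sc (H : PPoset L ρ n) : ∀ m a b, b ≤ a + m → 0 < a → b ≤ n →
    SCon H.adj (Set.Ico a b) := by
  intro m
  induction m with
  | zero =>
    intro a b hm ha hb Y π t _ _ _ y y' hR _
    refine (hR.inv (fun z => z = y) ?_ rfl).symm
    intro i hi; have := hi.1; have := hi.2; omega
  | succ m ih =>
  intro a b hm ha hb
  rcases Nat.lt_or_ge a b with hab | hab
  swap
  · intro Y π t _ _ _ y y' hR _
    refine (hR.inv (fun z => z = y) ?_ rfl).symm
    intro i hi; have := hi.1; have := hi.2; omega
  have ih1 := ih (a + 1) b (by omega) (by omega) hb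
  have hsub : Set.Ico (a + 1) b ⊆ Set.Ico a b := fun i hi => ⟨by have := hi.1; omega, hi.2⟩
  have hsub2 : Set.Ico (a + 2) b ⊆ Set.Ico (a + 1) b := fun i hi => ⟨by have := hi.1; omega, hi.2⟩
  have haI : a ∈ Set.Ico a b := ⟨le_rfl, hab⟩
  intro Y π t hinv hπ hloop y0 y0' hR0 hπ0
  obtain ⟨X, hX⟩ : ∃ X, X = (π y0).1 (a - 1) := ⟨_, rfl⟩
  obtain ⟨T, hT⟩ : ∃ T, T = (π y0).1 b := ⟨_, rfl⟩
  have hrX : ρ X = a - 1 := by rw [hX]; exact Fl.rk _ (by omega)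
  have hrT : ρ T = b := by rw [hT]; exact Fl.rk _ hb
  have hXT : X < T := by rw [hX, hT]; exact Fl.lt' _ (by omega) hb
  obtain ⟨θ, T1, T2, T3⟩ := H.sweep X T hXT
  -- basic notions
  let K : Y → Prop := fun y => (π y).1 (a - 1) = X ∧ (π y).1 b = T
  let v : Y → L := fun y => (π y).1 a
  let Sh : Y → Y → Prop := Reach t (Set.Ico (a + 1) b)
  let D : Y → Y → Prop := Relation.ReflTransGen
    (fun y z => (∃ i ∈ Set.Ico (a + 1) b, z = t i y) ∨ (z = t a y ∧ θ (v z) < θ (v y)))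
  let bottom : Y → Prop := fun z => ∀ w, X < w → w ≤ T → ρ w = ρ X + 1 → θ (v z) ≤ θ w
  have Shsymm : ∀ {y z}, Sh y z → Sh z y := fun h => Reach.symm (fun i hi => hinv i (hsub hi)) h
  have off : ∀ i ∈ Set.Ico a b, ∀ y k, k ≠ i → (π (t i y)).1 k = (π y).1 k := by
    intro i hi y k hk; rw [hπ i hi, H.adj_off _ hk]
  have Shoff : ∀ {y z}, Sh y z → ∀ k, k < a + 1 ∨ b ≤ k → (π z).1 k = (π y).1 k := by
    intro y z h k hk
    refine Reach.inv h (fun w => (π w).1 k = (π y).1 k) ?_ rfl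
    intro i hi w hw
    rw [off i (hsub hi) w k (by rintro rfl; have := hi.1; have := hi.2; omega), hw]
  have Shv : ∀ {y z}, Sh y z → v z = v y := fun h => Shoff h a (by omega)
  have KSh : ∀ {y z}, K y → Sh y z → K z := by
    intro y z hK h
    exact ⟨by rw [Shoff h _ (by omega), hK.1], by rw [Shoff h _ (by omega), hK.2]⟩
  have Ka : ∀ {y}, K y → K (t a y) := by
    intro y hK
    exact ⟨by rw [off a haI _ _ (by omega), hK.1], by rw [off a haI _ _ (by omega), hK.2]⟩
  have hat : ∀ {y}, K y → X < v y ∧ v y ≤ T ∧ ρ (v y) = ρ X + 1 := by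
    intro y hK
    refine ⟨?_, ?_, ?_⟩
    · rw [← hK.1]; exact Fl.lt' _ (by omega) (by omega)
    · rw [← hK.2]; exact Fl.mono' _ (by omega)
    · have : ρ (v y) = a := Fl.rk _ (by omega)
      omega
  have ShD : ∀ {y z}, Sh y z → D y z := by
    intro y z h
    induction h with
    | refl => exact Relation.ReflTransGen.refl
    | tail _ h ih => exact ih.tail (Or.inl h)
  have KD : ∀ {y z}, K y → D y z → K z := by
    intro y z hK h
    induction h with
    | refl => exact hK
    | tail _ h ih =>
      rcases h with ⟨i, hi, rfl⟩ | ⟨rfl, -⟩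
      · exact KSh ih (Reach.one hi)
      · exact Ka ih
  have va : ∀ {y}, v (t a y) ≠ v y := by
    intro y
    show (π (t a y)).1 a ≠ (π y).1 a
    rw [hπ a haI]
    exact (H.adj_spec (by omega) _).1
  have sc1 : ∀ {y z}, Sh y z → π y = π z → y = z := by
    intro y z h1 h2
    exact ih1 Y π t (fun i hi => hinv i (hsub hi)) (fun i hi => hπ i (hsub hi))
      (fun i hi j hj => hloop i (hsub hi) j (hsub hj)) y z h1 h2
  have commT : ∀ j ∈ Set.Ico (a + 2) b, ∀ y, t a (t j y) = t j (t a y) := by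
    intro j hj y
    have hj' := hsub (hsub2 hj)
    have hj1 := hj.1
    have hj2 := hj.2
    have h1 : Per H.adj a j (π y) ∣ 2 := by
      apply Function.IsPeriodicPt.minimalPeriod_dvd
      show (H.adj a ∘ H.adj j)^[2] (π y) = π y
      simp only [Function.iterate_succ, Function.iterate_zero, Function.comp_apply, id_eq]
      rw [← H.adj_comm (i := a) (j := j) ha (by omega) (by omega), H.adj_invol (by omega),
        H.adj_invol (by omega)]
    have h2 := hloop a haI j hj' (by omega) y
    obtain ⟨c, hc⟩ := h1
    have h3 : (t a ∘ t j)^[2] y = y := by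
      rw [hc, Function.iterate_mul]
      exact Function.iterate_fixed h2 c
    simp only [Function.iterate_succ, Function.iterate_zero, Function.comp_apply, id_eq] at h3
    have h4 := congrArg (t a) h3
    rw [hinv a haI] at h4
    have h5 := congrArg (t j) h4
    rw [hinv j hj'] at h5
    exact h5
  have Dcase : ∀ {y z}, D y z → Sh y z ∨ ∃ y1, Sh y y1 ∧ θ (v (t a y1)) < θ (v y1) ∧ D (t a y1) z := by
    intro y z h
    induction h using Relation.ReflTransGen.head_induction_on with
    | refl => exact Or.inl (Reach.refl _)
    | head h1 h2 ih =>
      rcases h1 with ⟨i, hi, rfl⟩ | ⟨rfl, hlt⟩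
      · rcases ih with ih | ⟨y1, k1, k2, k3⟩
        · exact Or.inl ((Reach.one hi).trans ih)
        · exact Or.inr ⟨y1, (Reach.one hi).trans k1, k2, k3⟩
      · exact Or.inr ⟨_, Reach.refl _, hlt, h2⟩
  have lift2 : ∀ {y y'} {z : Fl L ρ n}, π y = π y' → Reach H.adj (Set.Ico (a + 1) b) (π y) z →
      ∃ y1 y1', Sh y y1 ∧ Sh y' y1' ∧ π y1 = z ∧ π y1' = z ∧ (y1 = y1' → y = y') := by
    intro y y' z hyy h
    induction h with
    | refl => exact ⟨y, y', Reach.refl _, Reach.refl _, rfl, hyy.symm, id⟩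
    | tail _ h ih =>
      obtain ⟨i, hi, rfl⟩ := h
      obtain ⟨y1, y1', k1, k2, k3, k4, k5⟩ := ih
      refine ⟨t i y1, t i y1', k1.step hi, k2.step hi, by rw [hπ i (hsub hi), k3],
        by rw [hπ i (hsub hi), k4], fun h => k5 ?_⟩
      have := congrArg (t i) h
      rwa [hinv i (hsub hi), hinv i (hsub hi)] at this
  have pair : ∀ k, ∀ y y', θ (v y) ≤ k → K y → π y = π y' →
      ∃ z z', D y z ∧ D y' z' ∧ bottom z ∧ bottom z' ∧ π z = π z' ∧ (z = z' → y = y') := by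
    intro k
    induction k using Nat.strong_induction_on with
    | _ k ihk =>
    intro y y' hk hK hyy
    by_cases hbot : bottom y
    · refine ⟨y, y', Relation.ReflTransGen.refl, Relation.ReflTransGen.refl, hbot, ?_, hyy, id⟩
      intro w h1 h2 h3
      have := hbot w h1 h2 h3
      have e : v y' = v y := by show (π y').1 a = (π y).1 a; rw [hyy]
      rw [e]; exact this
    · simp only [bottom] at hbot
      push Not at hbot
      obtain ⟨w, w1, w2, w3, w4⟩ := hbot
      obtain ⟨h1, h2, h3⟩ := hat hK
      obtain ⟨e, v', e1, e2, e3, e4, e5, e6, e7⟩ := T2 (v y) w h1 w1 h2 w2 h3 w3 w4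
      obtain ⟨z, z1, z2⟩ := H.ext_flag (π y) hab hb e (by omega) e1 (by rw [hK.2]; exact e3)
      have hr := H.conn m (a + 1) b (by omega) (by omega) hb (π y) z (fun i hi => (z2 i hi).symm)
      obtain ⟨y1, y1', k1, k2, k3, k4, k5⟩ := lift2 hyy hr
      have hv : v (t a y1) = v' := by
        show (π (t a y1)).1 a = v'
        rw [hπ a haI, k3]
        have := (H.adj_spec (i := a) (by omega) z).2 v' (by rw [z2 _ (by omega), hK.1]; exact e5)
          (by rw [z1]; exact e2)
        rw [z2 a (by omega)] at this
        rcases this with h | h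
        · rw [h] at e7; exact absurd e7 (lt_irrefl _)
        · exact h.symm
      have hlt1 : θ (v (t a y1)) < θ (v y1) := by rw [hv, Shv k1]; exact e7
      have hvv : v y1' = v y1 := by show (π y1').1 a = (π y1).1 a; rw [k3, k4]
      have hvv' : v (t a y1') = v (t a y1) := by
        show (π (t a y1')).1 a = (π (t a y1)).1 a
        rw [hπ a haI, hπ a haI, k3, k4]
      obtain ⟨z, z', d1, d2, d3, d4, d5, d6⟩ := ihk (θ v') (by omega) (t a y1) (t a y1')
        (by rw [hv]) (Ka (KSh hK k1)) (by rw [hπ a haI, hπ a haI, k3, k4])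
      refine ⟨z, z', ?_, ?_, d3, d4, d5, fun h => k5 ?_⟩
      · exact ((ShD k1).tail (Or.inr ⟨rfl, hlt1⟩)).trans d1
      · exact ((ShD k2).tail (Or.inr ⟨rfl, by rw [hvv, hvv']; exact hlt1⟩)).trans d2
      · have := congrArg (t a) (d6 h)
        rwa [hinv a haI, hinv a haI] at this
  have exbot : ∀ {y}, K y → ∃ z, D y z ∧ bottom z := by
    intro y hK
    obtain ⟨z, -, h1, -, h2, -⟩ := pair _ y y le_rfl hK rfl
    exact ⟨z, h1, h2⟩
  let E : Y → Y → Prop := fun u u' => ∀ z z', D u z → bottom z → D u' z' → bottom z' → Sh z z'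
  have Esymm : ∀ {u u'}, E u u' → E u' u := fun h z z' h1 h2 h3 h4 => Shsymm (h z' z h3 h4 h1 h2)
  have Etrans : ∀ {u w u'}, K w → E u w → E w u' → E u u' := by
    intro u w u' hK h1 h2 z z' k1 k2 k3 k4
    obtain ⟨q, q1, q2⟩ := exbot hK
    exact Reach.trans (h1 z q k1 k2 q1 q2) (h2 q z' q1 q2 k3 k4)
  have conf : ∀ k, ∀ y, θ (v y) = k → K y → E y y := by
    intro k
    induction k using Nat.strong_induction_on with
    | _ k ihk =>
    intro y hk hK
    have ED : ∀ {u u'}, K u → θ (v u) < k → D u u' → E u u' := by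
      intro u u' h1 h2 h3 z z' k1 k2 k3 k4
      exact ihk _ h2 u rfl h1 z z' k1 k2 (h3.trans k3) k4
    have sameEdge : ∀ {w w'}, Sh y w → Sh y w' → (π w).1 (a + 1) = (π w').1 (a + 1) →
        Sh (t a w) (t a w') := by
      intro w w' h1 h2 h3
      have hr := H.conn m (a + 2) b (by omega) (by omega) hb (π w) (π w') (by
        intro i hi
        rcases eq_or_ne i (a + 1) with rfl | hne
        · exact h3
        · rw [Shoff h1 i (by omega), Shoff h2 i (by omega)])
      obtain ⟨w'', k1, k2⟩ := Reach.lift π (t := t) (fun i hi => hπ i (hsub (hsub2 hi))) hr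
      have k3 : w'' = w' := sc1 ((Shsymm (k1.mono hsub2)).trans ((Shsymm h1).trans h2)) k2
      rw [k3] at k1
      exact (Reach.map (t := t) (t a) id (fun i hi => hi) (fun i hi x => commT i hi x) k1).mono hsub2
    have walk : ∀ f w2, Sh y w2 → a + 1 < b → (π w2).1 (a + 2) = f →
        (∀ w, X < w → w < f → ρ w = ρ X + 1 → w ≠ v y → θ w < θ (v y)) →
        E (t a (t (a + 1) w2)) (t a w2) := by
      intro f w2 hw2 hab1 hf hlow
      have h1I : a + 1 ∈ Set.Ico a b := ⟨by omega, hab1⟩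
      have h1I' : a + 1 ∈ Set.Ico (a + 1) b := ⟨by omega, hab1⟩
      have hKw2 := KSh hK hw2
      let x : ℕ → Y := fun m => (t a ∘ t (a + 1))^[m] w2
      let s' := (H.adj a ∘ H.adj (a + 1))
      have hx1 : ∀ m, x (m + 1) = t a (t (a + 1) (x m)) := by
        intro m; simp only [x, Function.iterate_succ_apply', Function.comp_apply]
      have hπx : ∀ m, π (x m) = s'^[m] (π w2) := by
        intro m
        induction m with
        | zero => rfl
        | succ m ih =>
          rw [hx1, hπ a haI, hπ _ h1I, ih, Function.iterate_succ_apply']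
          rfl
      have hKx : ∀ m, K (x m) := by
        intro m
        induction m with
        | zero => exact hKw2
        | succ m ih => rw [hx1]; exact Ka (KSh ih (Reach.one h1I'))
      have hoffx : ∀ m k, k ≠ a → k ≠ a + 1 → (π (x m)).1 k = (π w2).1 k := by
        intro m k hk hk'
        induction m with
        | zero => rfl
        | succ m ih => rw [hx1, off a haI _ _ hk, off _ h1I _ _ hk', ih]
      obtain ⟨p, hp⟩ : ∃ p, p = Per H.adj a (a + 1) (π w2) := ⟨_, rfl⟩
      have hfin := H.finFl
      have hp0 : 0 < p := by
        rw [hp]; exact Per_pos (H.adj_invol (by omega)) (H.adj_invol (by omega)) _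
      have hxp : x p = w2 := by
        rw [hp]; exact hloop a haI (a + 1) h1I (by omega) w2
      have hp1 : p ≠ 1 := by
        intro h
        have h2 := hπx 1
        rw [← h, hxp, h] at h2
        have h3 : H.adj a (π w2) = H.adj (a + 1) (π w2) := by
          have := congrArg (H.adj a) h2
          rw [this]
          exact H.adj_invol (by omega) _
        have h4 := (H.adj_spec (i := a) (by omega) (π w2)).1
        rw [h3] at h4
        exact h4 (H.adj_off _ (by omega))
      have hlt : ∀ m, 0 < m → m < p → θ (v (x m)) < k := by
        intro m hm0 hmp
        rw [← hk]
        obtain ⟨q1, q2, q3⟩ := hat (hKx m)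
        refine hlow _ q1 ?_ q3 ?_
        · rw [← hf, ← hoffx m (a + 2) (by omega) (by omega)]
          exact Fl.lt' _ (by omega) (by omega)
        · intro heq
          rw [← Shv hw2] at heq
          rcases H.adj_uniq (i := a + 1) (by omega) (x := π w2) (y := π (x m)) (by
            intro j hj
            rcases eq_or_ne j a with rfl | hja
            · exact heq
            · exact hoffx m j hja hj) with h | h
          · rw [hπx] at h
            rw [hp] at hmp
            exact Function.not_isPeriodicPt_of_pos_of_lt_minimalPeriod (by omega) hmp h
          · rw [hπx] at h
            exact dihedral m (H.adj_invol (by omega)) (H.adj_invol (by omega)) (H.adj_ne (by omega))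
              (H.adj_ne (by omega)) _ h
      have key : ∀ m, m + 1 < p → E (x 1) (x (m + 1)) := by
        intro m
        induction m with
        | zero => intro h; exact ED (hKx 1) (hlt 1 (by omega) h) Relation.ReflTransGen.refl
        | succ m ih =>
          intro h
          refine Etrans (hKx (m + 1)) (ih (by omega)) ?_
          have hl1 := hlt (m + 1) (by omega) (by omega)
          have hl2 := hlt (m + 2) (by omega) (by omega)
          have hS : Sh (x (m + 1)) (t (a + 1) (x (m + 1))) := Reach.one h1I'
          have hKu := KSh (hKx (m + 1)) hS
          have e2 := hx1 (m + 1)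
          rcases lt_trichotomy (θ (v (x (m + 1 + 1)))) (θ (v (t (a + 1) (x (m + 1))))) with h | h | h
          · exact ED (hKx _) hl1 ((ShD hS).tail (Or.inr ⟨e2, h⟩))
          · exfalso
            obtain ⟨q1, q2, q3⟩ := hat (hKx (m + 1 + 1))
            obtain ⟨r1, r2, r3⟩ := hat hKu
            have := T1 _ _ q1 r1 q2 r2 q3 r3 h
            rw [e2] at this
            exact va this
          · refine Etrans hKu (ED (hKx _) hl1 (ShD hS)) (Esymm (ED (hKx _) hl2 ?_))
            refine Relation.ReflTransGen.single (Or.inr ⟨?_, h⟩)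
            rw [e2, hinv a haI]
      have hxw : t (a + 1) (x (p - 1)) = t a w2 := by
        have := hx1 (p - 1)
        rw [show p - 1 + 1 = p by omega, hxp] at this
        rw [this, hinv a haI]
      have k1 := key (p - 2) (by omega)
      rw [show p - 2 + 1 = p - 1 by omega] at k1
      have k2 : E (x (p - 1)) (t a w2) := by
        apply ED (hKx _) (hlt _ (by omega) (by omega))
        rw [← hxw]
        exact ShD (Reach.one h1I')
      have := Etrans (hKx (p - 1)) k1 k2
      rwa [hx1 0] at this
    intro z z' d1 b1 d2 b2
    have hbb : ∀ {z}, Sh y z → bottom z → bottom y := by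
      intro z h1 h2 w q1 q2 q3
      rw [← Shv h1]; exact h2 w q1 q2 q3
    have hbn : ∀ {y1}, bottom y → Sh y y1 → θ (v (t a y1)) < θ (v y1) → False := by
      intro y1 h1 h2 h3
      obtain ⟨q1, q2, q3⟩ := hat (Ka (KSh hK h2))
      have := h1 _ q1 q2 q3
      rw [Shv h2] at h3
      omega
    rcases Dcase d1 with h1 | ⟨y1, s1, l1, d1'⟩
    · rcases Dcase d2 with h2 | ⟨y2, s2, l2, d2'⟩
      · exact (Shsymm h1).trans h2
      · exact (hbn (hbb h1 b1) s2 l2).elim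
    · rcases Dcase d2 with h2 | ⟨y2, s2, l2, d2'⟩
      · exact (hbn (hbb h2 b2) s1 l1).elim
      · have lo1 : θ (v (t a y1)) < k := by rw [← hk, ← Shv s1]; exact l1
        have edge : ∀ {w}, Sh y w → v y < (π w).1 (a + 1) ∧ (π w).1 (a + 1) ≤ T ∧
            ρ ((π w).1 (a + 1)) = ρ X + 2 ∧ v (t a w) < (π w).1 (a + 1) := by
          intro w hw
          refine ⟨?_, ?_, ?_, ?_⟩
          · rw [← Shv hw]; exact Fl.lt' _ (by omega) (by omega)
          · rw [← (KSh hK hw).2]; exact Fl.mono' _ (by omega)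
          · rw [Fl.rk (π w) (by omega)]; omega
          · rw [← off a haI w (a + 1) (by omega)]; exact Fl.lt' _ (by omega) (by omega)
        obtain ⟨u1, u2, u3⟩ := hat hK
        obtain ⟨p1, p2, p3, p4⟩ := edge s1
        obtain ⟨q1, q2, q3, q4⟩ := edge s2
        have hpath := T3 (v y) u1 u2 u3 _ _ _ _ p1 q1 p2 q2 p3 q3 (hat (Ka (KSh hK s1))).1 p4
          (by rw [← Shv s1]; exact l1) (hat (Ka (KSh hK s2))).1 q4 (by rw [← Shv s2]; exact l2)
        have main : ∀ e, Relation.ReflTransGen (fun e e' => v y < e ∧ v y < e' ∧ e ≠ e' ∧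
            ρ e = ρ X + 2 ∧ ρ e' = ρ X + 2 ∧ ∃ f, e < f ∧ e' < f ∧ f ≤ T ∧ ρ f = ρ X + 3 ∧
            ∀ w, X < w → w < f → ρ w = ρ X + 1 → w ≠ v y → θ w < θ (v y)) ((π y1).1 (a + 1)) e →
            ∀ w, Sh y w → (π w).1 (a + 1) = e → E (t a y1) (t a w) := by
          intro e he
          induction he with
          | refl =>
            intro w hw hwe
            exact ED (Ka (KSh hK s1)) lo1 (ShD (sameEdge s1 hw hwe.symm))
          | @tail e e' _ hR ih =>
            intro w' hw' hwe'
            obtain ⟨r1, r2, r3, r4, r5, f, f1, f2, f3, f4, f5⟩ := hR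
            have hb2 : a + 2 ≤ b := by
              have := H.le_mono f3; omega
            obtain ⟨x1, x11, x12⟩ := H.ext_flag (π y) hab hb e (by omega) r1
              (by rw [hK.2]; exact (f1.trans_le f3).le)
            obtain ⟨x2, x21, x22⟩ := H.ext_flag x1 (a := a + 1) (b := b) (by omega) hb f (by omega)
              (by rw [x11]; exact f1) (by rw [x12 b (by omega), hK.2]; exact f3)
            have hr := H.conn m (a + 1) b (by omega) (by omega) hb (π y) x2 (fun i hi => by
              rw [x22 i (by omega), x12 i hi])
            obtain ⟨w2, k1, k2⟩ := Reach.lift π (t := t) (fun i hi => hπ i (hsub hi)) hr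
            have e1 : (π w2).1 (a + 1) = e := by rw [k2, x22 _ (by omega), x11]
            have e2 : (π w2).1 (a + 2) = f := by rw [k2]; exact x21
            have k3 := ih w2 k1 e1
            have k4 := Esymm (walk f w2 k1 (by omega) e2 f5)
            have k1' : Sh y (t (a + 1) w2) := k1.step ⟨le_rfl, by omega⟩
            have e3 : (π (t (a + 1) w2)).1 (a + 1) = e' := by
              rw [hπ _ ⟨by omega, by omega⟩]
              rcases (H.adj_spec (i := a + 1) (by omega) (π w2)).2 e'
                (by rw [show a + 1 - 1 = a by omega]; rw [← Shv k1] at r2; exact r2)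
                (by rw [show a + 1 + 1 = a + 2 by omega, e2]; exact f2) with h | h
              · exact absurd (h.trans e1).symm r3
              · exact h.symm
            have k5 := sameEdge k1' hw' (e3.trans hwe'.symm)
            have lo3 : θ (v (t a (t (a + 1) w2))) < k := by
              rw [← hk]
              have hKu := Ka (KSh hK k1')
              refine f5 _ (hat hKu).1 ?_ (hat hKu).2.2 ?_
              · rw [← e2, ← off (a + 1) ⟨by omega, by omega⟩ w2 (a + 2) (by omega),
                  ← off a haI _ (a + 2) (by omega)]
                exact Fl.lt' _ (by omega) (by omega)
              · rw [← Shv k1']; exact va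
            exact Etrans (Ka (KSh hK k1)) k3
              (Etrans (Ka (KSh hK k1')) k4 (ED (Ka (KSh hK k1')) lo3 (ShD k5)))
        exact main _ hpath y2 s2 rfl z z' d1' b1 d2' b2
  have hK0 : K y0 := ⟨hX.symm, hT.symm⟩
  have ED : ∀ {u u'}, K u → D u u' → E u u' := by
    intro u u' h1 h3 z z' k1 k2 k3 k4
    exact conf _ u rfl h1 z z' k1 k2 (h3.trans k3) k4
  have hE : K y0' ∧ E y0 y0' := by
    refine hR0.inv (fun z => K z ∧ E y0 z) ?_ ⟨hK0, conf _ y0 rfl hK0⟩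
    rintro i hi z ⟨hKz, hEz⟩
    rcases eq_or_ne i a with rfl | hne
    · refine ⟨Ka hKz, Etrans hKz hEz ?_⟩
      rcases lt_trichotomy (θ (v (t i z))) (θ (v z)) with h | h | h
      · exact ED hKz (Relation.ReflTransGen.single (Or.inr ⟨rfl, h⟩))
      · exfalso
        obtain ⟨q1, q2, q3⟩ := hat (Ka hKz)
        obtain ⟨r1, r2, r3⟩ := hat hKz
        exact va (T1 _ _ q1 r1 q2 r2 q3 r3 h)
      · exact Esymm (ED (Ka hKz) (Relation.ReflTransGen.single (Or.inr ⟨(hinv i hi z).symm, h⟩)))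
    · have hi' : i ∈ Set.Ico (a + 1) b := ⟨by have := hi.1; omega, hi.2⟩
      exact ⟨KSh hKz (Reach.one hi'), Etrans hKz hEz (ED hKz (ShD (Reach.one hi')))⟩
  obtain ⟨z, z', d1, d2, d3, d4, d5, d6⟩ := pair _ y0 y0' le_rfl hK0 hπ0
  exact d6 (sc1 (hE.2 z z' d1 d3 d2 d4) d5)

theorem fs (H : PPoset L ρ n) : FS n H.adj where
  fin := H.finFl
  invol i h1 h2 x := H.adj_invol ⟨h1, h2⟩ x
  nofix i h1 h2 x := H.adj_ne ⟨h1, h2⟩ x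
  ne i j h1 h2 h3 x h := by
    have h4 := (H.adj_spec (i := i) (by omega) x).1
    rw [h] at h4
    exact h4 (H.adj_off _ (by omega))
  comm i j h1 h2 h3 x := H.adj_comm h1 h2 h3 x
  per i h1 h2 x := H.adj_per h1 h2 x
  conn x y := by
    have := H.conn n 1 n (by omega) (by omega) le_rfl x y (by
      intro i hi
      rcases hi with hi | hi
      · have : i = 0 := by omega
        rw [this]; exact Fl.zero H x y
      · rw [x.2.2.2 i hi, y.2.2.2 i hi]; exact Fl.last H x y)
    refine this.mono (J := Set.Ioo 0 n) (fun i hi => ?_)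
    exact ⟨by have := hi.1; omega, hi.2⟩
  sc a b h1 h2 := H.sc b a b (by omega) h1 h2

end PPoset

open scoped Classical RealInnerProductSpace

/-! ### Isomorphisms and flags -/

namespace PPoset
variable {L L' : Type} [PartialOrder L] [PartialOrder L'] {ρ : L → ℕ} {ρ' : L' → ℕ} {n : ℕ}

theorem conn_through (H : PPoset L ρ n) {r : ℕ} (hr : r ≤ n) (x y : Fl L ρ n) (h : x.1 r = y.1 r) :
    Reach H.adj {i | 0 < i ∧ i < n ∧ i ≠ r} x y := by
  have hmix : (∀ i, i ≤ n → ρ (if i ≤ r then x.1 i else y.1 i) = i) ∧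
      (∀ i, i < n → (if i ≤ r then x.1 i else y.1 i) < (if i + 1 ≤ r then x.1 (i + 1) else y.1 (i + 1)))
      ∧ ∀ i, n ≤ i → (if i ≤ r then x.1 i else y.1 i) = (if n ≤ r then x.1 n else y.1 n) := by
    refine ⟨?_, ?_, ?_⟩
    · intro i hi
      split_ifs
      · exact Fl.rk x hi
      · exact Fl.rk y hi
    · intro i hi
      by_cases h1 : i + 1 ≤ r
      · rw [if_pos h1, if_pos (by omega)]; exact x.2.2.1 i hi
      · rw [if_neg h1]
        by_cases h2 : i ≤ r
        · have : i = r := by omega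
          rw [if_pos h2, this, h]; exact y.2.2.1 r (by omega)
        · rw [if_neg h2]; exact y.2.2.1 i hi
    · intro i hi
      have hl := Fl.last H x y
      have e1 := x.2.2.2 i hi
      have e2 := y.2.2.2 i hi
      split_ifs
      · exact e1
      · rw [e1, hl]
      · rw [e2, hl]
      · exact e2
  obtain ⟨z, hz⟩ : ∃ z : Fl L ρ n, ∀ i, z.1 i = if i ≤ r then x.1 i else y.1 i := ⟨⟨_, hmix⟩, fun _ => rfl⟩
  have h1 := H.conn n (r + 1) n (by omega) (by omega) le_rfl x z (by
    intro i hi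
    rw [hz]
    split_ifs with h'
    · rfl
    · have : n ≤ i := by omega
      rw [x.2.2.2 i this, y.2.2.2 i this]; exact Fl.last H x y)
  have h2 := H.conn n 1 r (by omega) (by omega) hr z y (by
    intro i hi
    rw [hz]
    split_ifs with h'
    · rcases hi with hi | hi
      · have : i = 0 := by omega
        rw [this]; exact Fl.zero H x y
      · have : i = r := by omega
        rw [this, h]
    · rfl)
  refine (h1.mono ?_).trans (h2.mono ?_)
  · intro i hi; have := hi.1; have := hi.2; exact ⟨by omega, by omega, by omega⟩
  · intro i hi; have := hi.1; have := hi.2; exact ⟨by omega, by omega, by omega⟩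

theorem exists_trans (H : PPoset L ρ n) (H' : PPoset L' ρ' n) (u : ℕ → ℕ)
    (hu : ∀ i r, 0 < i → i < n → r ≤ n → i ≠ r → u r ≠ u i) (f : Fl L ρ n → Fl L' ρ' n)
    (hf : ∀ i, 0 < i → i < n → ∀ x, f (H.adj i x) = H'.adj (u i) (f x)) :
    ∃ φ : L → L', ∀ x r, r ≤ n → φ (x.1 r) = (f x).1 (u r) := by
  have hex : ∀ F : L, ∃ x : Fl L ρ n, x.1 (ρ F) = F := fun F => by
    obtain ⟨x, hx, -⟩ := H.exists_flag_le (le_refl F); exact ⟨x, hx⟩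
  choose c hc using hex
  refine ⟨fun F => (f (c F)).1 (u (ρ F)), fun x r hr => ?_⟩
  have e : ρ (x.1 r) = r := Fl.rk x hr
  have h1 := hc (x.1 r)
  have h2 := H.conn_through hr (c (x.1 r)) x (by rw [e] at h1; exact h1)
  dsimp only
  rw [e]
  refine (h2.inv (fun z => (f z).1 (u r) = (f (c (x.1 r))).1 (u r)) ?_ rfl).symm
  rintro i ⟨i1, i2, i3⟩ z hz
  rw [hf i i1 i2, H'.adj_off _ (hu i r i1 i2 hr i3), hz]

theorem exists_trans_inv (H : PPoset L ρ n) (H' : PPoset L' ρ' n) (u : ℕ → ℕ)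
    (hu : ∀ i r, 0 < i → i < n → r ≤ n → i ≠ r → u r ≠ u i)
    (hu0 : ∀ r, r ≤ n → u r ≤ n ∧ u (u r) = r) (hu1 : ∀ i, 0 < i → i < n → 0 < u i ∧ u i < n)
    (f : Fl L ρ n → Fl L' ρ' n) (hbij : Function.Bijective f)
    (hf : ∀ i, 0 < i → i < n → ∀ x, f (H.adj i x) = H'.adj (u i) (f x)) :
    ∃ φ : L ≃ L', (∀ x r, r ≤ n → φ (x.1 r) = (f x).1 (u r)) ∧
      ∀ x r, r ≤ n → φ.symm ((f x).1 r) = x.1 (u r) := by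
  obtain ⟨g, hg1, hg2⟩ := Function.bijective_iff_has_inverse.1 hbij
  obtain ⟨φ, hφ⟩ := H.exists_trans H' u hu f hf
  obtain ⟨ψ, hψ⟩ := H'.exists_trans H u hu g (by
    intro i h1 h2 x
    apply hbij.1
    rw [hf _ (hu1 i h1 h2).1 (hu1 i h1 h2).2, hg2, hg2, (hu0 i h2.le).2])
  have e1 : ∀ F, ψ (φ F) = F := by
    intro F
    obtain ⟨x, hx, -⟩ := H.exists_flag_le (le_refl F)
    have hr := H.rk_le F
    rw [← hx, hφ x _ hr, hψ _ _ (hu0 _ hr).1, hg1, (hu0 _ hr).2]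
  have e2 : ∀ F, φ (ψ F) = F := by
    intro F
    obtain ⟨x, hx, -⟩ := H'.exists_flag_le (le_refl F)
    have hr := H'.rk_le F
    rw [← hx, hψ x _ hr, hφ _ _ (hu0 _ hr).1, hg2, (hu0 _ hr).2]
  refine ⟨⟨φ, ψ, e1, e2⟩, hφ, fun x r hr => ?_⟩
  show ψ _ = _
  rw [hψ _ _ hr, hg1]

/-- An equivariant bijection of flags gives an isomorphism. -/
theorem iso_straight (H : PPoset L ρ n) (H' : PPoset L' ρ' n)
    (f : Fl L ρ n → Fl L' ρ' n) (hbij : Function.Bijective f)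
    (hf : ∀ i, 0 < i → i < n → ∀ x, f (H.adj i x) = H'.adj i (f x)) :
    ∃ φ : L ≃o L', ∀ x r, r ≤ n → φ (x.1 r) = (f x).1 r := by
  obtain ⟨φ, h1, h2⟩ := H.exists_trans_inv H' id (fun i r _ _ _ h => h.symm)
    (fun r h => ⟨h, rfl⟩) (fun i h h' => ⟨h, h'⟩) f hbij hf
  have hm : ∀ F G, F ≤ G → φ F ≤ φ G := by
    intro F G h
    obtain ⟨x, x1, x2⟩ := H.exists_flag_le h
    rw [← x1, ← x2, h1 _ _ (H.rk_le F), h1 _ _ (H.rk_le G)]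
    exact Fl.mono' _ (H.le_mono h)
  have hm' : ∀ F G, F ≤ G → φ.symm F ≤ φ.symm G := by
    intro F G h
    obtain ⟨x, x1, x2⟩ := H'.exists_flag_le h
    obtain ⟨y, rfl⟩ := hbij.2 x
    rw [← x1, ← x2, h2 _ _ (H'.rk_le F), h2 _ _ (H'.rk_le G)]
    exact Fl.mono' _ (H'.le_mono h)
  refine ⟨⟨φ, fun {F G} => ⟨fun h => ?_, hm F G⟩⟩, h1⟩
  simpa using hm' _ _ h

theorem iso_dual (H : PPoset L ρ n) (H' : PPoset L' ρ' n)
    (f : Fl L ρ n → Fl L' ρ' n) (hbij : Function.Bijective f)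
    (hf : ∀ i, 0 < i → i < n → ∀ x, f (H.adj i x) = H'.adj (n - i) (f x)) :
    Nonempty (L ≃o L'ᵒᵈ) := by
  obtain ⟨φ, h1, h2⟩ := H.exists_trans_inv H' (fun i => n - i) (fun i r _ _ _ h => by omega)
    (fun r h => by omega) (fun i h h' => by omega) f hbij hf
  have hm : ∀ F G, F ≤ G → φ G ≤ φ F := by
    intro F G h
    obtain ⟨x, x1, x2⟩ := H.exists_flag_le h
    rw [← x1, ← x2, h1 _ _ (H.rk_le F), h1 _ _ (H.rk_le G)]
    exact Fl.mono' _ (by have := H.le_mono h; omega)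
  have hm' : ∀ F G, F ≤ G → φ.symm G ≤ φ.symm F := by
    intro F G h
    obtain ⟨x, x1, x2⟩ := H'.exists_flag_le h
    obtain ⟨y, rfl⟩ := hbij.2 x
    rw [← x1, ← x2, h2 _ _ (H'.rk_le F), h2 _ _ (H'.rk_le G)]
    exact Fl.mono' _ (by have := H'.le_mono h; omega)
  refine ⟨⟨φ.trans OrderDual.toDual, fun {F G} => ⟨fun h => ?_, fun h => hm F G h⟩⟩⟩
  have := hm' _ _ (show φ G ≤ φ F from h)
  simpa using this

theorem rk_le_iso {m : ℕ} (H : PPoset L ρ n) (H' : PPoset L' ρ' m) (γ : L ≃o L') :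
    ∀ F, ρ F ≤ ρ' (γ F) := by
  have : ∀ k F, ρ F = k → k ≤ ρ' (γ F) := by
    intro k
    induction k with
    | zero => intro F _; omega
    | succ k ih =>
      intro F hF
      obtain ⟨x, x1, -⟩ := H.exists_flag_le (le_refl F)
      have hr := H.rk_le F
      rw [hF] at x1 hr
      have h1 := ih (x.1 k) (Fl.rk x (by omega))
      have h2 : x.1 k < F := by rw [← x1]; exact Fl.lt' x (by omega) hr
      have := H'.mono _ _ (γ.lt_iff_lt.2 h2)
      omega
  exact fun F => this _ F rfl

theorem rk_iso {m : ℕ} (H : PPoset L ρ n) (H' : PPoset L' ρ' m) (γ : L ≃o L') (F : L) :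
    ρ' (γ F) = ρ F := by
  have h1 := H.rk_le_iso H' γ F
  have h2 := H'.rk_le_iso H γ.symm (γ F)
  simp at h2
  omega

theorem dim_iso {m : ℕ} (H : PPoset L ρ n) (H' : PPoset L' ρ' m) (γ : L ≃o L') : n = m := by
  obtain ⟨t, ht, ht'⟩ := H.top
  obtain ⟨t', -, ht2'⟩ := H'.top
  have h1 := H.rk_iso H' γ t
  have h2 := H'.rk_le (γ t)
  have h3 := H'.rk_iso H γ.symm t'
  have h4 := H.rk_le (γ.symm t')
  omega

noncomputable def mapFl (H : PPoset L ρ n) (H' : PPoset L' ρ' n) (γ : L ≃o L') (x : Fl L ρ n) : Fl L' ρ' n :=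
  ⟨fun i => γ (x.1 i), fun i hi => by rw [H.rk_iso H' γ, Fl.rk x hi],
    fun i hi => γ.lt_iff_lt.2 (x.2.2.1 i hi), fun i hi => congrArg γ (x.2.2.2 i hi)⟩

theorem mapFl_adj (H : PPoset L ρ n) (H' : PPoset L' ρ' n) (γ : L ≃o L') (i : ℕ) (hi : 0 < i)
    (hi' : i < n) (x : Fl L ρ n) : H.mapFl H' γ (H.adj i x) = H'.adj i (H.mapFl H' γ x) := by
  apply H'.adj_eq ⟨hi, hi'⟩
  · intro j hj
    show γ _ = γ _
    rw [H.adj_off _ hj]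
  · intro h
    apply (H.adj_spec ⟨hi, hi'⟩ x).1
    apply γ.injective
    exact congrArg (fun z : Fl L' ρ' n => z.1 i) h

theorem mapFl_inj (H : PPoset L ρ n) (H' : PPoset L' ρ' n) (γ : L ≃o L') :
    Function.Injective (H.mapFl H' γ) := by
  intro x y h
  apply Fl.ext'
  intro i
  apply γ.injective
  exact congrArg (fun z : Fl L' ρ' n => z.1 i) h

theorem exists_fl (H : PPoset L ρ n) (Φ : Flag L) : ∃ x : Fl L ρ n, Set.range x.1 = (Φ : Set L) := by
  have := H.fin
  obtain ⟨b, hb, hb'⟩ := H.bot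
  obtain ⟨t, ht, ht'⟩ := H.top
  have hbΦ : b ∈ Φ := Flag.mem_iff_forall_le_or_ge.2 fun c _ => Or.inl (hb c)
  have htΦ : t ∈ Φ := Flag.mem_iff_forall_le_or_ge.2 fun c _ => Or.inr (ht c)
  have hex : ∀ i, i ≤ n → ∃ y ∈ Φ, ρ y = i := by
    intro i
    induction i with
    | zero => intro _; exact ⟨b, hbΦ, hb'⟩
    | succ i ih =>
      intro hi
      obtain ⟨z, hz, hz'⟩ := ih (by omega)
      have hne : {w | w ∈ Φ ∧ z < w}.Nonempty := ⟨t, htΦ, H.lt_of_le (ht z) (by omega)⟩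
      obtain ⟨w, ⟨hw1, hw2⟩, hw3⟩ := Set.exists_min_image _ ρ (Set.toFinite _) hne
      obtain ⟨y, y1, y2, y3⟩ := H.exists_atom _ z w le_rfl hw2
      refine ⟨y, Flag.mem_iff_forall_le_or_ge.2 fun c hc => ?_, by omega⟩
      rcases Φ.le_or_le hc hz with h | h
      · exact Or.inr (h.trans y1.le)
      · rcases eq_or_lt_of_le h with h | h
        · rw [← h]; exact Or.inr y1.le
        · left
          refine y2.trans ?_
          rcases Φ.le_or_le hc hw1 with h' | h'
          · rcases eq_or_lt_of_le h' with h2 | h2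
            · rw [h2]
            · have := hw3 c ⟨hc, h⟩
              have := H.mono _ _ h2
              omega
          · exact h'
  haveI : Nonempty L := ⟨b⟩
  choose! c hc hc' using hex
  have huniq : ∀ y ∈ Φ, ∀ z ∈ Φ, ρ y < ρ z → y < z := by
    intro y hy z hz h
    rcases Φ.le_or_le hy hz with h' | h'
    · exact H.lt_of_le h' h
    · have := H.le_mono h'; omega
  have huniq' : ∀ y ∈ Φ, ∀ z ∈ Φ, ρ y = ρ z → y = z := by
    intro y hy z hz h
    rcases Φ.le_or_le hy hz with h' | h'
    · exact H.eq_of_le h' h.ge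
    · exact (H.eq_of_le h' h.le).symm
  refine ⟨⟨fun i => c (min i n), ?_, ?_, ?_⟩, ?_⟩
  · intro i hi; dsimp only; rw [min_eq_left hi, hc' i hi]
  · intro i hi
    dsimp only
    rw [min_eq_left (by omega : i ≤ n), min_eq_left (by omega : i + 1 ≤ n)]
    exact huniq _ (hc _ (by omega)) _ (hc _ (by omega)) (by rw [hc' i (by omega), hc' (i + 1) (by omega)]; omega)
  · intro i hi; dsimp only; rw [min_eq_right hi, min_self]
  · ext y
    constructor
    · rintro ⟨i, rfl⟩; exact hc _ (min_le_right _ _)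
    · intro hy
      have := H.rk_le y
      refine ⟨ρ y, ?_⟩
      dsimp only
      rw [min_eq_left this]
      exact huniq' _ (hc _ this) _ hy (hc' _ this)

theorem fl_range_inj (H : PPoset L ρ n) {x y : Fl L ρ n} (h : Set.range x.1 = Set.range y.1) : x = y := by
  have key : ∀ i, i ≤ n → x.1 i = y.1 i := by
    intro i hi
    obtain ⟨j, hj⟩ : x.1 i ∈ Set.range y.1 := by rw [← h]; exact ⟨i, rfl⟩
    have e1 : ρ (x.1 i) = i := Fl.rk x hi
    rcases le_total j n with hjn | hjn
    · have e2 : ρ (y.1 j) = j := Fl.rk y hjn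
      rw [hj] at e2
      rw [← hj, ← e2, e1]
    · rw [y.2.2.2 j hjn] at hj
      have e2 : ρ (y.1 n) = n := Fl.rk y le_rfl
      rw [hj] at e2
      have : i = n := by omega
      rw [← hj, this]
  apply Fl.ext'
  intro i
  rcases le_total i n with hi | hi
  · exact key i hi
  · rw [x.2.2.2 i hi, y.2.2.2 i hi]; exact key n le_rfl

/-- the maximal chain of a flag function -/
theorem exists_Flag (H : PPoset L ρ n) (x : Fl L ρ n) : ∃ Φ : Flag L, (Φ : Set L) = Set.range x.1 := by
  have hch : IsChain (· ≤ ·) (Set.range x.1) := by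
    rintro _ ⟨i, rfl⟩ _ ⟨j, rfl⟩ _
    rcases le_total i j with h | h
    · exact Or.inl (Fl.mono' x h)
    · exact Or.inr (Fl.mono' x h)
  obtain ⟨Φ, hΦ⟩ := hch.exists_subset_flag
  obtain ⟨y, hy⟩ := H.exists_fl Φ
  refine ⟨Φ, ?_⟩
  rw [← hy] at hΦ ⊢
  have : x = y := by
    have key : ∀ i, i ≤ n → x.1 i = y.1 i := by
      intro i hi
      obtain ⟨j, hj⟩ : x.1 i ∈ Set.range y.1 := hΦ ⟨i, rfl⟩
      have e1 : ρ (x.1 i) = i := Fl.rk x hi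
      rcases le_total j n with hjn | hjn
      · have e2 : ρ (y.1 j) = j := Fl.rk y hjn
        rw [hj] at e2
        rw [← hj, ← e2, e1]
      · rw [y.2.2.2 j hjn] at hj
        have e2 : ρ (y.1 n) = n := Fl.rk y le_rfl
        rw [hj] at e2
        have : i = n := by omega
        rw [← hj, this]
    apply Fl.ext'
    intro i
    rcases le_total i n with hi | hi
    · exact key i hi
    · rw [x.2.2.2 i hi, y.2.2.2 i hi]; exact key n le_rfl
  rw [this]

theorem same_iff (H : PPoset L ρ n) {Φ Ψ : Flag L} {x y : Fl L ρ n} (hx : Set.range x.1 = (Φ : Set L))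
    (hy : Set.range y.1 = (Ψ : Set L)) : SameFlagOrbit Φ Ψ ↔ ∃ γ : L ≃o L, H.mapFl H γ x = y := by
  refine exists_congr fun γ => ?_
  have e : γ '' (Φ : Set L) = Set.range (H.mapFl H γ x).1 := by
    rw [← hx, ← Set.range_comp]; rfl
  rw [e, ← hy]
  exact ⟨fun h => H.fl_range_inj h, fun h => by rw [h]⟩

/-- The classification of two-orbit polytope-like posets. -/
theorem classify (H : PPoset L ρ n) (h2 : TwoFlagOrbits L) :
    n = 4 ∧ ∃ q, (q = 4 ∨ q = 5) ∧ (RType H.adj q ∨ RType (fun i => H.adj (n - i)) q) := by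
  obtain ⟨Φ, Ψ, h1, h2⟩ := h2
  obtain ⟨xt, hxt⟩ := H.exists_fl Φ
  obtain ⟨xf, hxf⟩ := H.exists_fl Ψ
  have comp : ∀ (γ δ : L ≃o L) x, H.mapFl H (γ.trans δ) x = H.mapFl H δ (H.mapFl H γ x) :=
    fun γ δ x => rfl
  have inv : ∀ (γ : L ≃o L) x, H.mapFl H γ.symm (H.mapFl H γ x) = x := by
    intro γ x; apply Fl.ext'; intro i; exact γ.symm_apply_apply _
  have hall : ∀ x : Fl L ρ n, (∃ γ : L ≃o L, H.mapFl H γ x = xt) ∨ ∃ γ : L ≃o L, H.mapFl H γ x = xf := by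
    intro x
    obtain ⟨Ω, hΩ⟩ := H.exists_Flag x
    rcases h2 Ω with h | h
    · exact Or.inl ((H.same_iff hΩ.symm hxt).1 h)
    · exact Or.inr ((H.same_iff hΩ.symm hxf).1 h)
  have hno : ¬ ∃ γ : L ≃o L, H.mapFl H γ xt = xf := fun h => h1 ((H.same_iff hxt hxf).2 h)
  have hno' : ¬ ∃ γ : L ≃o L, H.mapFl H γ xf = xt := by
    rintro ⟨γ, h⟩; exact hno ⟨γ.symm, by rw [← h, inv]⟩
  refine H.fs.classify (fun x => decide (∃ γ : L ≃o L, H.mapFl H γ x = xt)) xt xf ?_ ?_ ?_ ?_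
  · simp only [decide_eq_true_eq]; exact ⟨OrderIso.refl L, rfl⟩
  · simpa using hno'
  · intro x y hxy
    have hγ : ∃ γ : L ≃o L, H.mapFl H γ x = y := by
      have hxy' : (∃ γ : L ≃o L, H.mapFl H γ x = xt) ↔ ∃ γ : L ≃o L, H.mapFl H γ y = xt := by
        simpa using hxy
      rcases hall x with h | h
      · obtain ⟨δ, hδ⟩ := hxy'.1 h
        obtain ⟨γ, hγ⟩ := h
        exact ⟨γ.trans δ.symm, by rw [comp, hγ, ← hδ, inv]⟩
      · rcases hall y with h' | h'
        · obtain ⟨δ, hδ⟩ := h'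
          obtain ⟨γ, hγ⟩ := hxy'.2 ⟨δ, hδ⟩
          exact ⟨γ.trans δ.symm, by rw [comp, hγ, ← hδ, inv]⟩
        · obtain ⟨δ, hδ⟩ := h'
          obtain ⟨γ, hγ⟩ := h
          exact ⟨γ.trans δ.symm, by rw [comp, hγ, ← hδ, inv]⟩
    obtain ⟨γ, hγ⟩ := hγ
    exact ⟨H.mapFl H γ, H.mapFl_inj H γ, hγ, fun i hi hi' z => H.mapFl_adj H γ i hi hi' z⟩
  · rintro x y hxy ⟨f, hfx, hf⟩
    have hfin := H.finFl
    have hsurj := H.fs.surj f hf x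
    have hbij : Function.Bijective f := ⟨Finite.injective_iff_surjective.2 hsurj, hsurj⟩
    obtain ⟨γ, hγ⟩ := H.iso_straight H f hbij hf
    have hxy2 : H.mapFl H γ x = y := by
      rw [← hfx]
      apply Fl.ext'
      intro i
      rcases le_total i n with hi | hi
      · exact hγ x i hi
      · rw [(f x).2.2.2 i hi, (H.mapFl H γ x).2.2.2 i hi]; exact hγ x n le_rfl
    apply hxy
    simp only [decide_eq_decide]
    constructor
    · rintro ⟨δ, hδ⟩
      exact ⟨γ.symm.trans δ, by rw [comp, ← hxy2, inv, hδ]⟩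
    · rintro ⟨δ, hδ⟩
      exact ⟨γ.trans δ, by rw [comp, hxy2, hδ]⟩

end PPoset

open scoped Classical RealInnerProductSpace

/-! ### Face lattices of vector configurations -/

section VLattice
variable {ι : Type} [Fintype ι]

/-- the faces of the configuration given by the space `U` of linear functionals -/
def VL (U : Submodule ℝ (ι → ℝ)) : Type :=
  {Z : Set ι // ∃ u ∈ U, (∀ i, 0 ≤ u i) ∧ ∀ i, u i = 0 ↔ i ∈ Z}

instance (U : Submodule ℝ (ι → ℝ)) : PartialOrder (VL U) := Subtype.partialOrder _

namespace VL
variable {U : Submodule ℝ (ι → ℝ)}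

/-- functionals vanishing on `Z` -/
def K (U : Submodule ℝ (ι → ℝ)) (Z : Set ι) : Submodule ℝ (ι → ℝ) where
  carrier := {u | u ∈ U ∧ ∀ i ∈ Z, u i = 0}
  add_mem' := by
    rintro a b ⟨h1, h2⟩ ⟨h3, h4⟩
    exact ⟨U.add_mem h1 h3, fun i hi => by simp [h2 i hi, h4 i hi]⟩
  zero_mem' := ⟨U.zero_mem, fun i _ => rfl⟩
  smul_mem' := by
    rintro c a ⟨h1, h2⟩
    exact ⟨U.smul_mem c h1, fun i hi => by simp [h2 i hi]⟩

theorem mem_K {Z : Set ι} {u : ι → ℝ} : u ∈ K U Z ↔ u ∈ U ∧ ∀ i ∈ Z, u i = 0 := Iff.rfl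

theorem K_anti {Y Z : Set ι} (h : Y ⊆ Z) : K U Z ≤ K U Y := fun _ hu => ⟨hu.1, fun i hi => hu.2 i (h hi)⟩

/-- rank -/
noncomputable def rk (Z : VL U) : ℕ := Module.finrank ℝ U - Module.finrank ℝ (K U Z.1)

theorem finrank_K_le (Z : Set ι) : Module.finrank ℝ (K U Z) ≤ Module.finrank ℝ U :=
  Submodule.finrank_mono (fun _ h => h.1)

/-- witness -/
noncomputable def W (Z : VL U) : ι → ℝ := Classical.choose Z.2
theorem W_mem (Z : VL U) : W Z ∈ U := (Classical.choose_spec Z.2).1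
theorem W_nonneg (Z : VL U) (i : ι) : 0 ≤ W Z i := (Classical.choose_spec Z.2).2.1 i
theorem W_zero (Z : VL U) (i : ι) : W Z i = 0 ↔ i ∈ Z.1 := (Classical.choose_spec Z.2).2.2 i
theorem W_K (Z : VL U) : W Z ∈ K U Z.1 := ⟨W_mem Z, fun i hi => (W_zero Z i).2 hi⟩
theorem W_pos {Z : VL U} {i : ι} (h : i ∉ Z.1) : 0 < W Z i :=
  lt_of_le_of_ne (W_nonneg Z i) fun h' => h ((W_zero Z i).1 h'.symm)

theorem exists_of_lt {X Y : VL U} (h : X < Y) : ∃ i ∈ Y.1, i ∉ X.1 := by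
  by_contra hc
  push Not at hc
  exact absurd (show Y ≤ X from hc) (not_le_of_gt h)

theorem K_lt {X Y : VL U} (h : X < Y) : K U Y.1 < K U X.1 := by
  refine lt_of_le_of_ne (K_anti h.le) fun he => ?_
  obtain ⟨i, hi, hi'⟩ := exists_of_lt h
  have := W_K X
  rw [← he] at this
  exact hi' ((W_zero X i).1 (this.2 i hi))

theorem rk_mono {X Y : VL U} (h : X < Y) : rk X < rk Y := by
  have h1 := Submodule.finrank_lt_finrank_of_lt (K_lt h)
  have h2 := finrank_K_le (U := U) X.1
  unfold rk; omega

theorem rk_le_mono {X Y : VL U} (h : X ≤ Y) : rk X ≤ rk Y := by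
  rcases eq_or_lt_of_le h with h | h
  · rw [h]
  · exact (rk_mono h).le

theorem eq_of_le {X Y : VL U} (h : X ≤ Y) (h' : rk Y ≤ rk X) : X = Y := by
  rcases eq_or_lt_of_le h with h | h
  · exact h
  · have := rk_mono h; omega

theorem finrank_eq (X Y : VL U) {k : ℕ} (h : rk Y = rk X + k) :
    Module.finrank ℝ (K U X.1) = Module.finrank ℝ (K U Y.1) + k := by
  have h1 := finrank_K_le (U := U) X.1
  have h2 := finrank_K_le (U := U) Y.1
  unfold rk at h; omega

theorem lift (Y : VL U) (u : ι → ℝ) (hu : u ∈ U) (h : ∀ i ∈ Y.1, 0 ≤ u i) :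
    ∃ Z : VL U, ∀ i, i ∈ Z.1 ↔ i ∈ Y.1 ∧ u i = 0 := by
  obtain ⟨T, hT⟩ : ∃ T : ℝ, 0 ≤ T ∧ ∀ i, i ∉ Y.1 → 0 < u i + T * W Y i := by
    refine ⟨∑ i, |u i / W Y i| + 1, by positivity, fun i hi => ?_⟩
    have hp := W_pos hi
    have h1 : |u i / W Y i| ≤ ∑ i, |u i / W Y i| :=
      Finset.single_le_sum (f := fun i => |u i / W Y i|) (fun j _ => abs_nonneg _) (Finset.mem_univ i)
    have h2 := neg_abs_le (u i / W Y i)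
    have h3 : u i = u i / W Y i * W Y i := by field_simp
    rw [h3, ← add_mul]
    apply mul_pos _ hp
    linarith
  refine ⟨⟨{i | i ∈ Y.1 ∧ u i = 0}, u + T • W Y, U.add_mem hu (U.smul_mem _ (W_mem Y)), ?_, ?_⟩, fun i => Iff.rfl⟩
  · intro i
    by_cases hi : i ∈ Y.1
    · simp [(W_zero Y i).2 hi, h i hi]
    · exact (hT.2 i hi).le
  · intro i
    by_cases hi : i ∈ Y.1
    · simp [(W_zero Y i).2 hi, hi]
    · simp only [Set.mem_setOf_eq, hi, false_and, iff_false]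
      exact (hT.2 i hi).ne'

theorem min_ratio {X Y : VL U} (h : X < Y) (g : ι → ℝ) (hg : g ∈ K U X.1) :
    ∃ (m : ℝ) (Z : VL U), X < Z ∧ Z ≤ Y ∧ (∀ i ∈ Z.1, g i = m * W X i) ∧
      ∀ i ∈ Y.1, m * W X i ≤ g i := by
  obtain ⟨i0, h1, h2⟩ := exists_of_lt h
  obtain ⟨j, ⟨hj1, hj2⟩, hj3⟩ := Set.exists_min_image {i | i ∈ Y.1 ∧ i ∉ X.1} (fun i => g i / W X i)
    (Set.toFinite _) ⟨i0, h1, h2⟩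
  set m := g j / W X j with hm
  have hle : ∀ i ∈ Y.1, m * W X i ≤ g i := by
    intro i hi
    by_cases hx : i ∈ X.1
    · rw [(W_zero X i).2 hx, hg.2 i hx]; simp
    · have := hj3 i ⟨hi, hx⟩
      rwa [← le_div_iff₀ (W_pos hx)]
  obtain ⟨Z, hZ⟩ := lift Y (g - m • W X) (U.sub_mem hg.1 (U.smul_mem _ (W_mem X))) (by
    intro i hi; have := hle i hi; simpa using this)
  refine ⟨m, Z, ?_, fun i hi => ((hZ i).1 hi).1, ?_, hle⟩
  · refine lt_of_le_of_ne (fun i hi => (hZ i).2 ⟨h.le hi, ?_⟩) fun he => ?_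
    · simp [(W_zero X i).2 hi, hg.2 i hi]
    · apply hj2
      rw [he, hZ]
      refine ⟨hj1, ?_⟩
      have := (W_pos hj2).ne'
      simp [hm]; field_simp; ring
  · intro i hi
    have := ((hZ i).1 hi).2
    simp at this; linarith

theorem gap {X Y : VL U} (h : X < Y) (h2 : rk X + 2 ≤ rk Y) : ∃ Z, X < Z ∧ Z < Y := by
  have hd : ¬ K U X.1 ≤ K U Y.1 ⊔ Submodule.span ℝ {W X} := by
    intro hle
    have h3 := Submodule.finrank_mono hle
    have h4 := Submodule.finrank_add_le_finrank_add_finrank (K U Y.1) (Submodule.span ℝ {W X})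
    have h5 := finrank_span_le_card (R := ℝ) ({W X} : Set (ι → ℝ))
    simp at h5
    have h1 := finrank_K_le (U := U) X.1
    have h6 := finrank_K_le (U := U) Y.1
    unfold rk at h2; omega
  obtain ⟨g, hg, hg'⟩ := Set.not_subset.1 hd
  obtain ⟨m, Z, z1, z2, z3, -⟩ := min_ratio h g hg
  refine ⟨Z, z1, lt_of_le_of_ne z2 fun he => hg' ?_⟩
  have : g = (g - m • W X) + m • W X := by simp
  rw [this]
  refine Submodule.add_mem_sup ⟨U.sub_mem hg.1 (U.smul_mem _ (W_mem X)), fun i hi => ?_⟩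
    (Submodule.smul_mem _ _ (Submodule.mem_span_singleton_self _))
  rw [← he] at hi
  simp [z3 i hi]

theorem atom_below : ∀ (k : ℕ) (X Y : VL U), rk Y ≤ k → X < Y → ∃ Z, X < Z ∧ Z ≤ Y ∧ rk Z = rk X + 1 := by
  intro k
  induction k with
  | zero => intro X Y h1 h2; have := rk_mono h2; omega
  | succ k ih =>
    intro X Y h1 h2
    have h3 := rk_mono h2
    by_cases h : rk Y = rk X + 1
    · exact ⟨Y, h2, le_rfl, h⟩
    · obtain ⟨Z, z1, z2⟩ := gap h2 (by omega)
      obtain ⟨Z', a1, a2, a3⟩ := ih X Z (by have := rk_mono z2; omega) z1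
      exact ⟨Z', a1, a2.trans z2.le, a3⟩

theorem prop {X Z : VL U} (h : X < Z) (hr : rk Z = rk X + 1) {u : ι → ℝ} (hu : u ∈ K U X.1) :
    ∃ c : ℝ, ∀ i ∈ Z.1, u i = c * W X i := by
  have h1 := finrank_eq X Z hr
  have hlt : K U Z.1 < K U Z.1 ⊔ Submodule.span ℝ {W X} := by
    refine lt_of_le_of_ne le_sup_left fun he => ?_
    have : W X ∈ K U Z.1 := by
      rw [he]; exact Submodule.mem_sup_right (Submodule.mem_span_singleton_self _)
    obtain ⟨i, i1, i2⟩ := exists_of_lt h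
    exact i2 ((W_zero X i).1 (this.2 i i1))
  have hle : K U Z.1 ⊔ Submodule.span ℝ {W X} ≤ K U X.1 := by
    refine sup_le (K_anti h.le) ?_
    rw [Submodule.span_singleton_le_iff_mem]; exact W_K X
  have h2 := Submodule.finrank_lt_finrank_of_lt hlt
  have := Submodule.eq_of_le_of_finrank_le hle (by omega)
  rw [← this] at hu
  obtain ⟨a, ha, b, hb, rfl⟩ := Submodule.mem_sup.1 hu
  obtain ⟨c, rfl⟩ := Submodule.mem_span_singleton.1 hb
  exact ⟨c, fun i hi => by simp [ha.2 i hi]⟩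

theorem atom_vanish {X Z : VL U} (h : X < Z) (hr : rk Z = rk X + 1) {u : ι → ℝ} (hu : u ∈ K U X.1)
    {j : ι} (hj : j ∈ Z.1) (hj' : j ∉ X.1) (h0 : u j = 0) : u ∈ K U Z.1 := by
  obtain ⟨c, hc⟩ := prop h hr hu
  have h1 := hc j hj
  have h2 := (W_pos hj').ne'
  have : c = 0 := by
    rw [h0] at h1
    rcases mul_eq_zero.1 h1.symm with h | h
    · exact h
    · exact absurd h h2
  exact ⟨hu.1, fun i hi => by rw [hc i hi, this, zero_mul]⟩

theorem atom_eq {X Z Z' : VL U} (h : X < Z) (hr : rk Z = rk X + 1) (h' : X < Z') (hr' : rk Z' = rk X + 1)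
    {j : ι} (hj : j ∈ Z.1) (hj2 : j ∈ Z'.1) (hj' : j ∉ X.1) : Z = Z' := by
  have h1 := atom_vanish h hr (K_anti h'.le (W_K Z')) hj hj' ((W_zero Z' j).2 hj2)
  exact eq_of_le (fun i hi => (W_zero Z' i).1 (h1.2 i hi)) (by omega)

theorem diamond {X Y : VL U} (hr : rk Y = rk X + 2) {Z : VL U} (h1 : X < Z) (h2 : Z < Y) :
    ∃ Z', Z' ≠ Z ∧ (X < Z' ∧ Z' < Y) ∧ ∀ w, X < w → w < Y → w = Z ∨ w = Z' := by
  have rkb : ∀ w : VL U, X < w → w < Y → rk w = rk X + 1 := fun w a b => by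
    have := rk_mono a; have := rk_mono b; omega
  have hZ := rkb Z h1 h2
  have hz : W Z ∈ K U X.1 := K_anti h1.le (W_K Z)
  obtain ⟨m, Z', z1, z2, z3, z4⟩ := min_ratio (h1.trans h2) (-(W Z)) ((K U X.1).neg_mem hz)
  obtain ⟨i1, a1, a2⟩ := exists_of_lt h2
  have hm : m < 0 := by
    by_contra hm
    have := z4 i1 a1
    have h5 := W_nonneg X i1
    have h6 := W_pos a2
    simp at this
    nlinarith [mul_nonneg (not_lt.1 hm) h5]
  have hne : Z' ≠ Z := by
    rintro rfl
    obtain ⟨i, b1, b2⟩ := exists_of_lt h1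
    have := z3 i b1
    rw [Pi.neg_apply, (W_zero Z' i).2 b1] at this
    have := mul_neg_of_neg_of_pos hm (W_pos b2)
    linarith
  have hZ'Y : Z' < Y := by
    refine lt_of_le_of_ne z2 fun he => ?_
    obtain ⟨i, b1, b2⟩ := exists_of_lt h1
    have := z3 i (by rw [he]; exact h2.le b1)
    rw [Pi.neg_apply, (W_zero Z i).2 b1] at this
    have := mul_neg_of_neg_of_pos hm (W_pos b2)
    linarith
  refine ⟨Z', hne, ⟨z1, hZ'Y⟩, fun w w1 w2 => ?_⟩
  have hw := rkb w w1 w2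
  have hZ' := rkb Z' z1 hZ'Y
  by_contra hc
  push Not at hc
  -- the witness of `w` is a combination of `W X` and `W Z`
  have hk : W w ∈ K U X.1 := K_anti w1.le (W_K w)
  obtain ⟨a, ha⟩ := prop h1 hZ hk
  have hk2 : W w - a • W X ∈ K U Z.1 := ⟨U.sub_mem (W_mem w) (U.smul_mem _ (W_mem X)), fun i hi => by
    simp [ha i hi]⟩
  obtain ⟨b, hb⟩ := prop h2 (by omega) hk2
  have hb' : ∀ i ∈ Y.1, W w i = a * W X i + b * W Z i := fun i hi => by
    have := hb i hi; simp at this; linarith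
  obtain ⟨j, j1, j2⟩ := exists_of_lt w1
  have jZ : j ∉ Z.1 := fun h => hc.1 (atom_eq w1 hw h1 hZ j1 h j2)
  have jZ' : j ∉ Z'.1 := fun h => hc.2 (atom_eq w1 hw z1 hZ' j1 h j2)
  obtain ⟨k, k1, k2⟩ := exists_of_lt h1
  obtain ⟨l, l1, l2⟩ := exists_of_lt z1
  have lw : l ∉ w.1 := fun h => hc.2 (atom_eq w1 hw z1 hZ' h l1 l2)
  have e1 : 0 < a := by
    have := ha k k1
    have kw : k ∉ w.1 := fun h => hc.1 (atom_eq w1 hw h1 hZ h k1 k2)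
    have p1 := W_pos kw
    have p2 := W_pos k2
    rw [this] at p1
    exact pos_of_mul_pos_left p1 p2.le
  have e2 : 0 < a - b * m := by
    have q1 := hb' l (z2 l1)
    have q2 := z3 l l1
    simp at q2
    have p1 := W_pos lw
    have p2 := W_pos l2
    have : W w l = (a - b * m) * W X l := by
      rw [q1, show W Z l = -(m * W X l) by linarith]; ring
    rw [this] at p1
    exact pos_of_mul_pos_left p1 p2.le
  have q1 := hb' j (w2.le j1)
  rw [(W_zero w j).2 j1] at q1
  have q2 := z4 j (w2.le j1)
  simp at q2
  have q3 := W_pos jZ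
  have q4 := W_pos j2
  by_cases hb0 : 0 ≤ b
  · nlinarith [mul_pos e1 q4, mul_nonneg hb0 q3.le]
  · have : b * (W Z j) ≥ b * (-(m * W X j)) := mul_le_mul_of_nonpos_left (by linarith) (by linarith)
    nlinarith [mul_pos e2 q4]

theorem inter (e f : VL U) : ∃ Z : VL U, Z.1 = e.1 ∩ f.1 := by
  obtain ⟨Z, hZ⟩ := lift e (W f) (W_mem f) (fun i _ => W_nonneg f i)
  exact ⟨Z, by ext i; rw [hZ, W_zero]; rfl⟩

theorem lin {a b e f : VL U} (hab : a ≠ b) (hr : rk a = rk b) (h1 : a < e) (h2 : b < e) (h3 : a < f)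
    (h4 : b < f) (h5 : rk e = rk a + 1) (h6 : rk f = rk a + 1) : e = f := by
  obtain ⟨Z, hZ⟩ := inter e f
  have ha : a ≤ Z := show a.1 ⊆ Z.1 by rw [hZ]; exact Set.subset_inter h1.le h3.le
  have hb : b ≤ Z := show b.1 ⊆ Z.1 by rw [hZ]; exact Set.subset_inter h2.le h4.le
  have ha' : a < Z := lt_of_le_of_ne ha fun h => hab (by
    rw [h] at hr ⊢; exact (eq_of_le hb hr.le).symm)
  have := rk_mono ha'
  have e1 : Z ≤ e := show Z.1 ⊆ e.1 by rw [hZ]; exact Set.inter_subset_left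
  have e2 : Z ≤ f := show Z.1 ⊆ f.1 by rw [hZ]; exact Set.inter_subset_right
  rw [← eq_of_le e1 (by omega), ← eq_of_le e2 (by omega)]

/-- there is an improving neighbour -/
theorem improve {v Y : VL U} (hv : v ≤ Y) {g : ι → ℝ} (hg : g ∈ K U v.1) {j : ι} (hj : j ∈ Y.1) (hj' : g j < 0) :
    ∃ e, v < e ∧ e ≤ Y ∧ rk e = rk v + 1 ∧ ∀ i ∈ e.1, i ∉ v.1 → g i < 0 := by
  have hjv : j ∉ v.1 := fun h => by have := hg.2 j h; linarith
  have hlt : v < Y := lt_of_le_of_ne hv fun h => hjv (h ▸ hj)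
  obtain ⟨m, Z, z1, z2, z3, z4⟩ := min_ratio hlt g hg
  obtain ⟨e, e1, e2, e3⟩ := atom_below _ v Z le_rfl z1
  refine ⟨e, e1, e2.trans z2, e3, fun i hi hi' => ?_⟩
  rw [z3 i (e2 hi)]
  refine mul_neg_of_neg_of_pos ?_ (W_pos hi')
  by_contra hm
  have := z4 j hj
  have := mul_nonneg (not_lt.1 hm) (W_nonneg v j)
  linarith

/-- connectivity of the negative atoms -/
theorem conn_neg {v Y : VL U} {g : ι → ℝ} (hg : g ∈ K U v.1) (b : VL U) (hvb : v < b) (hbY : b ≤ Y)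
    (hrb : rk b = rk v + 1) (hnb : ∀ i ∈ b.1, i ∉ v.1 → g i < 0)
    (a : VL U) (hva : v < a) (haY : a ≤ Y) (hra : rk a = rk v + 1) (hna : ∀ i ∈ a.1, i ∉ v.1 → g i < 0) :
    Relation.ReflTransGen (fun e e' : VL U => v < e ∧ v < e' ∧ e ≠ e' ∧ rk e = rk v + 1 ∧ rk e' = rk v + 1 ∧
      ∃ f, e < f ∧ e' < f ∧ f ≤ Y ∧ rk f = rk v + 2 ∧ ∀ i ∈ f.1, i ∉ v.1 → g i < 0) a b := by
  set R := (fun e e' : VL U => v < e ∧ v < e' ∧ e ≠ e' ∧ rk e = rk v + 1 ∧ rk e' = rk v + 1 ∧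
      ∃ f, e < f ∧ e' < f ∧ f ≤ Y ∧ rk f = rk v + 2 ∧ ∀ i ∈ f.1, i ∉ v.1 → g i < 0) with hR
  have hpick : ∀ e : VL U, ∃ i, v < e → i ∈ e.1 ∧ i ∉ v.1 := by
    intro e
    by_cases h : v < e
    · obtain ⟨i, h1, h2⟩ := exists_of_lt h; exact ⟨i, fun _ => ⟨h1, h2⟩⟩
    · obtain ⟨i, -⟩ := exists_of_lt hva; exact ⟨i, fun h' => absurd h' h⟩
  choose p hp using hpick
  have : Finite (VL U) := Subtype.finite
  obtain ⟨e, ⟨he1, he2, he3, he4, he5⟩, hmin⟩ := Set.exists_min_image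
    {e : VL U | Relation.ReflTransGen R a e ∧ v < e ∧ e ≤ Y ∧ rk e = rk v + 1 ∧ ∀ i ∈ e.1, i ∉ v.1 → g i < 0}
    (fun e => W b (p e) / (- g (p e))) (Set.toFinite _) ⟨a, .refl, hva, haY, hra, hna⟩
  by_cases heb : e = b
  · rw [← heb]; exact he1
  exfalso
  set c := W b (p e) / (- g (p e)) with hc
  obtain ⟨p1, p2⟩ := hp e he2
  have hgp := he5 _ p1 p2
  have hpb : p e ∉ b.1 := fun h => heb (atom_eq he2 he4 hvb hrb p1 h p2)
  have hcpos : 0 < c := div_pos (W_pos hpb) (by linarith)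
  have hh : W b + c • g ∈ K U v.1 := (K U v.1).add_mem (K_anti hvb.le (W_K b)) ((K U v.1).smul_mem _ hg)
  have hh2 : W b + c • g ∈ K U e.1 := atom_vanish he2 he4 hh p1 p2 (by
    have := hgp.ne; simp only [Pi.add_apply, Pi.smul_apply, smul_eq_mul, hc]; field_simp; ring)
  obtain ⟨q1, q2⟩ := hp b hvb
  obtain ⟨f, f1, f2, f3, f4⟩ := improve he3 hh2 (hbY q1) (by
    simp only [Pi.add_apply, Pi.smul_apply, smul_eq_mul, (W_zero b _).2 q1]
    have := mul_neg_of_pos_of_neg hcpos (hnb _ q1 q2); linarith)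
  have f5 : ∀ i ∈ f.1, i ∉ v.1 → g i < 0 := by
    intro i hi hi'
    by_cases hie : i ∈ e.1
    · exact he5 i hie hi'
    · have h1 := f4 i hi hie
      simp only [Pi.add_apply, Pi.smul_apply, smul_eq_mul] at h1
      have h2 := W_nonneg b i
      by_contra h3
      have := mul_nonneg hcpos.le (not_lt.1 h3)
      linarith
  obtain ⟨e', k1, ⟨k2, k3⟩, -⟩ := diamond (by omega : rk f = rk v + 2) he2 f1
  have k4 : rk e' = rk v + 1 := by have := rk_mono k2; have := rk_mono k3; omega
  have hstep : R e e' := ⟨he2, k2, k1.symm, he4, k4, f, f1, k3, f2, by omega, f5⟩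
  have hm := hmin e' ⟨he1.tail hstep, k2, k3.le.trans f2, k4, fun i hi hi' => f5 i (k3.le hi) hi'⟩
  obtain ⟨r1, r2⟩ := hp e' k2
  have r3 : p e' ∉ e.1 := fun h => k1 (atom_eq k2 k4 he2 he4 r1 h r2)
  have h1 := f4 _ (k3.le r1) r3
  have h2 := f5 _ (k3.le r1) r2
  simp only [Pi.add_apply, Pi.smul_apply, smul_eq_mul] at h1
  have h3 : W b (p e') / (- g (p e')) < c := by
    rw [div_lt_iff₀ (by linarith)]; linarith
  exact absurd h3 (not_lt.2 hm)

theorem exists_generic (X : VL U) : ∃ g ∈ K U X.1, ∀ v w : VL U, X < v → X < w → rk v = rk X + 1 → rk w = rk X + 1 →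
    ∀ c : ℝ, (∀ i ∈ v.1, g i = c * W X i) → (∀ i ∈ w.1, g i = c * W X i) → v = w := by
  have : Finite (VL U) := Subtype.finite
  let T : Set (VL U × VL U) := {t | X < t.1 ∧ X < t.2 ∧ rk t.1 = rk X + 1 ∧ rk t.2 = rk X + 1 ∧ t.1 ≠ t.2}
  let M : VL U × VL U → Submodule ℝ (K U X.1) := fun t =>
    { carrier := {g | ∃ c : ℝ, (∀ i ∈ t.1.1, g.1 i = c * W X i) ∧ (∀ i ∈ t.2.1, g.1 i = c * W X i)}
      add_mem' := by
        rintro a b ⟨c, h1, h2⟩ ⟨c', h3, h4⟩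
        refine ⟨c + c', fun i hi => ?_, fun i hi => ?_⟩
        · have e1 := h1 i hi; have e2 := h3 i hi
          simp only [Submodule.coe_add, Pi.add_apply, e1, e2]; ring
        · have e1 := h2 i hi; have e2 := h4 i hi
          simp only [Submodule.coe_add, Pi.add_apply, e1, e2]; ring
      zero_mem' := ⟨0, by simp, by simp⟩
      smul_mem' := by
        rintro r a ⟨c, h1, h2⟩
        refine ⟨r * c, fun i hi => ?_, fun i hi => ?_⟩
        · have e1 := h1 i hi
          simp only [Submodule.coe_smul, Pi.smul_apply, smul_eq_mul, e1]; ring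
        · have e1 := h2 i hi
          simp only [Submodule.coe_smul, Pi.smul_apply, smul_eq_mul, e1]; ring }
  have hfin : T.Finite := Set.toFinite _
  have hM : ∀ t ∈ T, M t ≠ ⊤ := by
    rintro ⟨v, w⟩ ⟨h1, h2, h3, h4, h5⟩ he
    have hm : (⟨W v, K_anti h1.le (W_K v)⟩ : K U X.1) ∈ M (v, w) := by rw [he]; trivial
    obtain ⟨c, c1, c2⟩ := hm
    dsimp only at c1 c2 h1 h2 h3 h4 h5
    obtain ⟨i, i1, i2⟩ := exists_of_lt h1
    obtain ⟨j, j1, j2⟩ := exists_of_lt h2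
    have e1 := c1 i i1
    rw [(W_zero v i).2 i1] at e1
    have hc : c = 0 := by
      rcases mul_eq_zero.1 e1.symm with h | h
      · exact h
      · exact absurd h (W_pos i2).ne'
    have e2 := c2 j j1
    rw [hc, zero_mul, W_zero] at e2
    exact h5 (atom_eq h1 h3 h2 h4 e2 j1 j2)
  have key := Subspace.biUnion_ne_univ_of_top_notMem (s := hfin.toFinset.image M) (by
    intro h
    obtain ⟨t, ht, ht'⟩ := Finset.mem_image.1 h
    exact hM t (hfin.mem_toFinset.1 ht) ht')
  obtain ⟨g, hg⟩ := (Set.ne_univ_iff_exists_notMem _).1 key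
  refine ⟨g.1, g.2, fun v w h1 h2 h3 h4 c c1 c2 => ?_⟩
  by_contra hne
  apply hg
  simp only [Set.mem_iUnion]
  exact ⟨M (v, w), Finset.mem_image.2 ⟨(v, w), hfin.mem_toFinset.2 ⟨h1, h2, h3, h4, hne⟩, rfl⟩, c, c1, c2⟩

theorem sweep (X Y : VL U) : ∃ θ : VL U → ℕ,
    (∀ v w, X < v → X < w → v ≤ Y → w ≤ Y → rk v = rk X + 1 → rk w = rk X + 1 → θ v = θ w → v = w) ∧
    (∀ v w, X < v → X < w → v ≤ Y → w ≤ Y → rk v = rk X + 1 → rk w = rk X + 1 → θ w < θ v →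
      ∃ e v', v < e ∧ v' < e ∧ e ≤ Y ∧ rk e = rk X + 2 ∧ X < v' ∧ rk v' = rk X + 1 ∧ θ v' < θ v) ∧
    (∀ v, X < v → v ≤ Y → rk v = rk X + 1 → ∀ e e' v1 v2, v < e → v < e' → e ≤ Y → e' ≤ Y →
      rk e = rk X + 2 → rk e' = rk X + 2 → X < v1 → v1 < e → θ v1 < θ v → X < v2 → v2 < e' → θ v2 < θ v →
      Relation.ReflTransGen (fun e e' => v < e ∧ v < e' ∧ e ≠ e' ∧ rk e = rk X + 2 ∧ rk e' = rk X + 2 ∧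
        ∃ f, e < f ∧ e' < f ∧ f ≤ Y ∧ rk f = rk X + 3 ∧
          ∀ w, X < w → w < f → rk w = rk X + 1 → w ≠ v → θ w < θ v) e e') := by
  have : Finite (VL U) := Subtype.finite
  obtain ⟨g, hg, hgen⟩ := exists_generic X
  have hτ : ∀ v : VL U, ∃ c : ℝ, X < v → rk v = rk X + 1 → ∀ i ∈ v.1, g i = c * W X i := by
    intro v
    by_cases h : X < v ∧ rk v = rk X + 1
    · obtain ⟨c, hc⟩ := prop h.1 h.2 hg; exact ⟨c, fun _ _ => hc⟩
    · exact ⟨0, fun h1 h2 => absurd ⟨h1, h2⟩ h⟩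
  choose τ hτ using hτ
  let θ : VL U → ℕ := fun v => {w : VL U | τ w < τ v}.ncard
  have θle : ∀ v w, τ v ≤ τ w → θ v ≤ θ w := fun v w h =>
    Set.ncard_le_ncard (fun z (hz : τ z < τ v) => lt_of_lt_of_le hz h) (Set.toFinite _)
  have θlt : ∀ v w, τ v < τ w → θ v < θ w := fun v w h =>
    Set.ncard_lt_ncard ⟨fun z (hz : τ z < τ v) => hz.trans h, fun h' => lt_irrefl (τ v) (h' h)⟩ (Set.toFinite _)
  have θiff : ∀ v w, θ v < θ w → τ v < τ w := fun v w h => by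
    by_contra hc; have := θle _ _ (not_lt.1 hc); omega
  -- the shifted functional
  have hsh : ∀ v, X < v → rk v = rk X + 1 → g - τ v • W X ∈ K U v.1 := fun v h1 h2 =>
    ⟨U.sub_mem hg.1 (U.smul_mem _ (W_mem X)), fun i hi => by simp [hτ v h1 h2 i hi]⟩
  have hneg : ∀ v w, X < w → rk w = rk X + 1 → ∀ i ∈ w.1, i ∉ X.1 →
      ((g - τ v • W X) i < 0 ↔ τ w < τ v) := by
    intro v w h1 h2 i hi hi'
    have p := W_pos hi'
    have e := hτ w h1 h2 i hi
    simp only [Pi.sub_apply, Pi.smul_apply, smul_eq_mul, e]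
    rw [← sub_mul]
    constructor
    · intro h
      by_contra hc
      have := mul_nonneg (sub_nonneg.2 (not_lt.1 hc)) p.le
      linarith
    · intro h; exact mul_neg_of_neg_of_pos (by linarith) p
  refine ⟨θ, ?_, ?_, ?_⟩
  · intro v w h1 h2 _ _ h3 h4 h
    have : τ v = τ w := by
      rcases lt_trichotomy (τ v) (τ w) with h' | h' | h'
      · have := θlt _ _ h'; omega
      · exact h'
      · have := θlt _ _ h'; omega
    exact hgen v w h1 h2 h3 h4 (τ v) (hτ v h1 h3) (by rw [this]; exact hτ w h2 h4)
  · intro v w h1 h2 hv hw h3 h4 h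
    obtain ⟨i, i1, i2⟩ := exists_of_lt h2
    obtain ⟨e, e1, e2, e3, e4⟩ := improve hv (hsh v h1 h3) (hw i1) ((hneg v w h2 h4 i i1 i2).2 (θiff _ _ h))
    obtain ⟨v', k1, ⟨k2, k3⟩, -⟩ := diamond (by omega : rk e = rk X + 2) h1 e1
    have k4 : rk v' = rk X + 1 := by have := rk_mono k2; have := rk_mono k3; omega
    obtain ⟨j, j1, j2⟩ := exists_of_lt k2
    refine ⟨e, v', e1, k3, e2, by omega, k2, k4, θlt _ _ ((hneg v v' k2 k4 j j1 j2).1 (e4 j (k3.le j1) ?_))⟩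
    exact fun h => k1 (atom_eq k2 k4 h1 h3 j1 h j2)
  · intro v h1 hv h3 e e' v1 v2 he he' heY heY' hre hre' a1 a2 a3 b1 b2 b3
    have hall : ∀ e v1, v < e → rk e = rk X + 2 → X < v1 → v1 < e → θ v1 < θ v →
        ∀ i ∈ e.1, i ∉ v.1 → (g - τ v • W X) i < 0 := by
      intro e v1 he hre a1 a2 a3
      obtain ⟨c, hc⟩ := prop he (by omega) (hsh v h1 h3)
      have r1 : rk v1 = rk X + 1 := by have := rk_mono a1; have := rk_mono a2; omega
      obtain ⟨j, j1, j2⟩ := exists_of_lt a1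
      have n1 := (hneg v v1 a1 r1 j j1 j2).2 (θiff _ _ a3)
      rw [hc j (a2.le j1)] at n1
      have hcneg : c < 0 := by
        by_contra h
        have := mul_nonneg (not_lt.1 h) (W_nonneg v j)
        linarith
      intro i hi hi'
      rw [hc i hi]
      exact mul_neg_of_neg_of_pos hcneg (W_pos hi')
    have key := conn_neg (hsh v h1 h3) e' he' heY' (by omega) (hall e' v2 he' hre' b1 b2 b3)
      e he heY (by omega) (hall e v1 he hre a1 a2 a3)
    refine Relation.ReflTransGen.mono ?_ _ _ key
    rintro x y ⟨r1, r2, r3, r4, r5, f, r6, r7, r8, r9, r10⟩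
    refine ⟨r1, r2, r3, by omega, by omega, f, r6, r7, r8, by omega, fun w w1 w2 w3 w4 => ?_⟩
    obtain ⟨j, j1, j2⟩ := exists_of_lt w1
    refine θlt _ _ ((hneg v w w1 w3 j j1 j2).1 (r10 j (w2.le j1) ?_))
    exact fun h => w4 (atom_eq w1 w3 h1 h3 j1 h j2)

theorem pposet (hp : ∃ p ∈ U, ∀ i, 0 < p i) : PPoset (VL U) rk (Module.finrank ℝ U) where
  fin := Subtype.finite
  bot := by
    obtain ⟨p, hp, hp'⟩ := hp
    refine ⟨⟨∅, p, hp, fun i => (hp' i).le, fun i => by simp [(hp' i).ne']⟩, fun x => Set.empty_subset _, ?_⟩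
    have : K U (∅ : Set ι) = U := le_antisymm (fun u h => h.1) fun u h => ⟨h, by simp⟩
    show _ - Module.finrank ℝ (K U (∅ : Set ι)) = 0
    rw [this]; omega
  top := by
    refine ⟨⟨Set.univ, 0, U.zero_mem, by simp, by simp⟩, fun x => Set.subset_univ _, ?_⟩
    have : K U (Set.univ : Set ι) = ⊥ := by
      rw [eq_bot_iff]; rintro u ⟨-, h⟩; simp; ext i; exact h i trivial
    show _ - Module.finrank ℝ (K U (Set.univ : Set ι)) = _
    rw [this]; simp
  mono := fun _ _ h => rk_mono h
  gap := fun _ _ h h' => gap h h'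
  diamond := fun _ _ hr _ h1 h2 => diamond hr h1 h2
  lin := fun _ _ _ _ h1 h2 h3 h4 h5 h6 h7 h8 => lin h1 h2 h3 h4 h5 h6 h7 h8
  sweep := fun X Y _ => sweep X Y

end VL
end VLattice

open scoped Classical RealInnerProductSpace

/-! ### Face lattices of convex polytopes -/

theorem PPoset.transport {L L' : Type} [PartialOrder L] [PartialOrder L'] {ρ : L' → ℕ} {n : ℕ}
    (φ : L ≃o L') (H : PPoset L' ρ n) : PPoset L (fun x => ρ (φ x)) n where
  fin := by have := H.fin; exact Finite.of_equiv L' φ.symm.toEquiv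
  bot := by
    obtain ⟨b, h1, h2⟩ := H.bot
    exact ⟨φ.symm b, fun x => by rw [← φ.le_iff_le]; simpa using h1 _, by simpa using h2⟩
  top := by
    obtain ⟨b, h1, h2⟩ := H.top
    exact ⟨φ.symm b, fun x => by rw [← φ.le_iff_le]; simpa using h1 _, by simpa using h2⟩
  mono := fun x y h => H.mono _ _ (φ.lt_iff_lt.2 h)
  gap := fun x y h h' => by
    obtain ⟨z, h1, h2⟩ := H.gap _ _ (φ.lt_iff_lt.2 h) h'
    exact ⟨φ.symm z, by rw [← φ.lt_iff_lt]; simpa using h1, by rw [← φ.lt_iff_lt]; simpa using h2⟩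
  diamond := fun x y h z h1 h2 => by
    obtain ⟨z', a, ⟨b, c⟩, e⟩ := H.diamond _ _ h (φ z) (φ.lt_iff_lt.2 h1) (φ.lt_iff_lt.2 h2)
    refine ⟨φ.symm z', ?_, ⟨?_, ?_⟩, ?_⟩
    · rintro rfl; simp at a
    · rw [← φ.lt_iff_lt]; simpa using b
    · rw [← φ.lt_iff_lt]; simpa using c
    · intro w w1 w2
      rcases e (φ w) (φ.lt_iff_lt.2 w1) (φ.lt_iff_lt.2 w2) with h | h
      · exact Or.inl (φ.injective h)
      · right; rw [← h]; simp
  lin := fun a b e f h1 h2 h3 h4 h5 h6 h7 h8 => φ.injective (H.lin (φ a) (φ b) (φ e) (φ f)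
    (fun h => h1 (φ.injective h)) h2 (φ.lt_iff_lt.2 h3) (φ.lt_iff_lt.2 h4) (φ.lt_iff_lt.2 h5)
    (φ.lt_iff_lt.2 h6) h7 h8)
  sweep := fun X Y h => by
    obtain ⟨θ, t1, t2, t3⟩ := H.sweep _ _ (φ.lt_iff_lt.2 h)
    have lt1 : ∀ {a b}, a < b → φ a < φ b := fun h => φ.lt_iff_lt.2 h
    have le1 : ∀ {a b}, a ≤ b → φ a ≤ φ b := fun h => φ.le_iff_le.2 h
    have lt2 : ∀ {a b}, a < b → φ.symm a < φ.symm b := fun h => φ.symm.lt_iff_lt.2 h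
    have lt3 : ∀ {a b}, φ a < b → a < φ.symm b := fun h => by rw [← φ.lt_iff_lt]; simpa using h
    have le3 : ∀ {a b}, b ≤ φ a → φ.symm b ≤ a := fun h => by rw [← φ.le_iff_le]; simpa using h
    refine ⟨fun x => θ (φ x), ?_, ?_, ?_⟩
    · intro v w h1 h2 h3 h4 h5 h6 h7
      exact φ.injective (t1 _ _ (lt1 h1) (lt1 h2) (le1 h3) (le1 h4) h5 h6 h7)
    · intro v w h1 h2 h3 h4 h5 h6 h7
      obtain ⟨e, v', a1, a2, a3, a4, a5, a6, a7⟩ := t2 _ _ (lt1 h1) (lt1 h2) (le1 h3) (le1 h4) h5 h6 h7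
      exact ⟨φ.symm e, φ.symm v', lt3 a1, lt2 a2, le3 a3, by simpa using a4, lt3 a5, by simpa using a6,
        by simpa using a7⟩
    · intro v hv1 hv2 hv3 e e' v1 v2 h1 h2 h3 h4 h5 h6 h7 h8 h9 h10 h11 h12
      have key := t3 _ (lt1 hv1) (le1 hv2) hv3 (φ e) (φ e') (φ v1) (φ v2) (lt1 h1) (lt1 h2) (le1 h3) (le1 h4)
        h5 h6 (lt1 h7) (lt1 h8) h9 (lt1 h10) (lt1 h11) h12
      have key2 := Relation.ReflTransGen.lift (r := (fun e e' => φ v < e ∧ φ v < e' ∧ e ≠ e' ∧ ρ e = ρ (φ X) + 2 ∧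
        ρ e' = ρ (φ X) + 2 ∧ ∃ f, e < f ∧ e' < f ∧ f ≤ φ Y ∧ ρ f = ρ (φ X) + 3 ∧
          ∀ w, φ X < w → w < f → ρ w = ρ (φ X) + 1 → w ≠ φ v → θ w < θ (φ v))) φ.symm (p := (fun e e' => v < e ∧ v < e' ∧ e ≠ e' ∧
        ρ (φ e) = ρ (φ X) + 2 ∧ ρ (φ e') = ρ (φ X) + 2 ∧
        ∃ f, e < f ∧ e' < f ∧ f ≤ Y ∧ ρ (φ f) = ρ (φ X) + 3 ∧
          ∀ w, X < w → w < f → ρ (φ w) = ρ (φ X) + 1 → w ≠ v → θ (φ w) < θ (φ v))) (by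
        rintro a b ⟨a1, a2, a3, a4, a5, f, a6, a7, a8, a9, a10⟩
        refine ⟨lt3 a1, lt3 a2, fun h => a3 (φ.symm.injective h), by simpa using a4, by simpa using a5,
          φ.symm f, lt2 a6, lt2 a7, le3 a8, by simpa using a9, fun w w1 w2 w3 w4 => ?_⟩
        exact a10 _ (lt1 w1) (by rw [← φ.symm.lt_iff_lt]; simpa using w2) w3 (fun h => w4 (φ.injective h))) _ _ key
      simpa [Function.onFun] using key2

section PolyFaces
variable {d : ℕ}

theorem hull_max {S : Set (EucSp d)} (l : EucSp d →ₗ[ℝ] ℝ) {M : ℝ} (hM : ∀ s ∈ S, l s ≤ M) {x : EucSp d}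
    (hx : x ∈ convexHull ℝ S) : l x < M ∨ x ∈ convexHull ℝ {s | s ∈ S ∧ l s = M} := by
  have hK : ∀ y ∈ convexHull ℝ {s | s ∈ S ∧ l s = M}, l y = M := by
    intro y hy
    have : Convex ℝ {y | l y = M} := convex_hyperplane l.isLinear M
    exact convexHull_min (fun s hs => hs.2) this hy
  have hconv : Convex ℝ {x | l x < M ∨ x ∈ convexHull ℝ {s | s ∈ S ∧ l s = M}} := by
    intro x hx y hy a b ha hb hab
    rcases eq_or_lt_of_le ha with ha0 | ha0
    · have : b = 1 := by linarith
      rw [← ha0, this]; simpa using hy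
    rcases eq_or_lt_of_le hb with hb0 | hb0
    · have : a = 1 := by linarith
      rw [← hb0, this]; simpa using hx
    rcases hx with hx | hx
    · left
      have hy' : l y ≤ M := by
        rcases hy with h | h
        · exact h.le
        · exact (hK y h).le
      show l _ < M
      simp only [map_add, map_smul, smul_eq_mul]
      have e : M = a * M + b * M := by rw [← add_mul, hab, one_mul]
      have := mul_lt_mul_of_pos_left hx ha0
      have := mul_le_mul_of_nonneg_left hy' hb
      linarith
    · rcases hy with hy | hy
      · left
        have hx' := hK x hx
        show l _ < M
        simp only [map_add, map_smul, smul_eq_mul]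
        have e : M = a * M + b * M := by rw [← add_mul, hab, one_mul]
        have := mul_lt_mul_of_pos_left hy hb0
        rw [hx']; linarith
      · right; exact convex_convexHull ℝ _ hx hy ha hb hab
  refine convexHull_min (fun s hs => ?_) hconv hx
  rcases eq_or_lt_of_le (hM s hs) with h | h
  · right; exact subset_convexHull ℝ _ ⟨hs, h⟩
  · left; exact h

theorem hull_le {S : Set (EucSp d)} (l : EucSp d →ₗ[ℝ] ℝ) {M : ℝ} (hM : ∀ s ∈ S, l s ≤ M) {x : EucSp d}
    (hx : x ∈ convexHull ℝ S) : l x ≤ M := by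
  have : Convex ℝ {y | l y ≤ M} := convex_halfSpace_le l.isLinear M
  exact convexHull_min (fun s hs => hM s hs) this hx

/-- nonempty exposed faces of a polytope are hulls of vertices -/
theorem face_hull {S : Set (EucSp d)} {F : Set (EucSp d)} (hF : IsExposed ℝ (convexHull ℝ S) F) :
    F ⊆ convexHull ℝ {s | s ∈ S ∧ s ∈ F} := by
  intro x hx
  obtain ⟨l, hl⟩ := hF ⟨x, hx⟩
  have hx' := hx
  rw [hl] at hx'
  rcases hull_max l.toLinearMap (M := l x) (fun s hs => hx'.2 s (subset_convexHull ℝ _ hs)) hx'.1 with h | h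
  · exact absurd h (lt_irrefl _)
  · refine convexHull_mono ?_ h
    rintro s ⟨hs, hs'⟩
    refine ⟨hs, ?_⟩
    rw [hl]
    refine ⟨subset_convexHull ℝ _ hs, fun y hy => ?_⟩
    have h1 : l s = l x := hs'
    rw [h1]; exact hx'.2 y hy

theorem face_inner {P F : Set (EucSp d)} (hF : IsExposed ℝ P F) {x : EucSp d} (hx : x ∈ F) :
    ∃ n : EucSp d, F = {y | y ∈ P ∧ ⟪n, y⟫ = ⟪n, x⟫} ∧ ∀ y ∈ P, ⟪n, y⟫ ≤ ⟪n, x⟫ := by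
  obtain ⟨l, hl⟩ := hF ⟨x, hx⟩
  have hx' := hx
  rw [hl] at hx'
  have e : ∀ y, ⟪(InnerProductSpace.toDual ℝ (EucSp d)).symm l, y⟫ = l y := fun y =>
    InnerProductSpace.toDual_symm_apply
  refine ⟨(InnerProductSpace.toDual ℝ (EucSp d)).symm l, ?_, fun y hy => by rw [e, e]; exact hx'.2 y hy⟩
  ext y
  simp only [e]
  rw [hl]
  constructor
  · rintro ⟨h1, h2⟩; exact ⟨h1, le_antisymm (hx'.2 y h1) (h2 x hx'.1)⟩
  · rintro ⟨h1, h2⟩; exact ⟨h1, fun z hz => by rw [h2]; exact hx'.2 z hz⟩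

theorem isExposed_of {P : Set (EucSp d)} (n : EucSp d) (M : ℝ) (hM : ∀ y ∈ P, ⟪n, y⟫ ≤ M) :
    IsExposed ℝ P {y | y ∈ P ∧ ⟪n, y⟫ = M} := by
  rintro ⟨x, hx, hx'⟩
  refine ⟨innerSL ℝ n, ?_⟩
  ext y
  constructor
  · rintro ⟨h1, h2⟩; exact ⟨h1, fun z hz => by simp only [innerSL_apply_apply]; rw [h2]; exact hM z hz⟩
  · rintro ⟨h1, h2⟩
    have := h2 x hx
    simp only [innerSL_apply_apply] at this
    rw [hx'] at this
    exact ⟨h1, le_antisymm (hM y h1) this⟩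

/-- the evaluation map -/
noncomputable def evS (S : Finset (EucSp d)) : (EucSp d × ℝ) →ₗ[ℝ] ({s // s ∈ S} → ℝ) where
  toFun p := fun s => ⟪p.1, s.1⟫ + p.2
  map_add' p q := by ext s; simp [inner_add_left]; ring
  map_smul' c p := by ext s; simp [inner_smul_left]; ring

theorem evS_inj (S : Finset (EucSp d)) (h : (interior (convexHull ℝ (S : Set (EucSp d)))).Nonempty) :
    Function.Injective (evS S) := by
  rw [← LinearMap.ker_eq_bot, eq_bot_iff]
  rintro ⟨n, c⟩ hk
  have hk' : ∀ s ∈ S, ⟪n, s⟫ = -c := fun s hs => by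
    have := congrFun (LinearMap.mem_ker.1 hk) ⟨s, hs⟩
    simp [evS] at this
    linarith
  have hP : ∀ x ∈ convexHull ℝ (S : Set (EucSp d)), ⟪n, x⟫ = -c := by
    intro x hx
    have : Convex ℝ {y | (innerSL ℝ n).toLinearMap y = -c} := convex_hyperplane (innerSL ℝ n).toLinearMap.isLinear _
    exact convexHull_min (fun s hs => by simpa using hk' s hs) this hx
  obtain ⟨x, hx⟩ := h
  have hx2 := interior_subset hx
  have hcont : Filter.Tendsto (fun t : ℝ => x + t • n) (nhds 0) (nhds x) := by
    have : Continuous (fun t : ℝ => x + t • n) := by fun_prop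
    simpa using this.tendsto 0
  have hev := hcont.eventually (mem_interior_iff_mem_nhds.1 hx)
  obtain ⟨ε, hε, hb⟩ := Metric.eventually_nhds_iff.1 hev
  have h1 := hb (y := ε / 2) (by simp [abs_of_pos hε]; linarith)
  have h2 := hP _ h1
  rw [inner_add_right, inner_smul_right, hP x hx2] at h2
  have h3 : ⟪n, n⟫ = 0 := by
    have : ε / 2 * ⟪n, n⟫ = 0 := by linarith
    rcases mul_eq_zero.1 this with h | h
    · linarith
    · exact h
  have hn : n = 0 := inner_self_eq_zero.1 h3
  have hc := hP x hx2
  rw [hn] at hc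
  simp at hc
  simp [hn, hc]

/-- the face lattice as lattice of a vector configuration -/
theorem faces_iso (S : Finset (EucSp d)) :
    Nonempty (Faces (convexHull ℝ (S : Set (EucSp d))) ≃o VL (LinearMap.range (evS S))) := by
  set P := convexHull ℝ (S : Set (EucSp d)) with hP
  have hwd : ∀ F : Faces P, ∃ u ∈ LinearMap.range (evS S), (∀ i, 0 ≤ u i) ∧
      ∀ i, u i = 0 ↔ i ∈ {s : {s // s ∈ S} | s.1 ∈ F.1} := by
    rintro ⟨F, hF⟩
    rcases F.eq_empty_or_nonempty with rfl | ⟨x, hx⟩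
    · refine ⟨_, ⟨(0, 1), rfl⟩, ?_, ?_⟩ <;> simp [evS]
    · obtain ⟨n, h1, h2⟩ := face_inner hF hx
      refine ⟨_, ⟨(-n, ⟪n, x⟫), rfl⟩, fun i => ?_, fun i => ?_⟩
      · have := h2 i.1 (subset_convexHull ℝ _ i.2)
        simp [evS]; linarith
      · have hi : i.1 ∈ P := subset_convexHull ℝ _ i.2
        simp only [evS, LinearMap.coe_mk, AddHom.coe_mk, inner_neg_left]
        show _ ↔ i.1 ∈ F
        rw [h1]
        constructor
        · intro h; exact ⟨hi, by linarith⟩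
        · rintro ⟨-, h⟩; linarith
  let f : Faces P → VL (LinearMap.range (evS S)) := fun F => ⟨_, hwd F⟩
  have hf : ∀ F G, f F ≤ f G ↔ F ≤ G := by
    intro F G
    constructor
    · intro h
      show F.1 ⊆ G.1
      refine (face_hull F.2).trans ?_
      refine convexHull_min ?_ (G.2.convex (convex_convexHull ℝ _))
      rintro s ⟨hs, hs'⟩
      exact h (show (⟨s, hs⟩ : {s // s ∈ S}) ∈ (f F).1 from hs')
    · intro h i hi; exact h hi
  have hsurj : Function.Surjective f := by
    rintro ⟨Z, u, ⟨⟨n, c⟩, rfl⟩, hu, hz⟩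
    rcases Z.eq_empty_or_nonempty with rfl | ⟨s0, hs0⟩
    · exact ⟨⟨∅, isExposed_empty⟩, Subtype.ext (by ext i; simp [f])⟩
    · have hle : ∀ y ∈ P, ⟪-n, y⟫ ≤ c := by
        intro y hy
        refine hull_le (innerSL ℝ (-n)).toLinearMap (fun s hs => ?_) hy
        have := hu ⟨s, hs⟩
        simp [evS] at this
        simp; linarith
      refine ⟨⟨_, isExposed_of (-n) c hle⟩, Subtype.ext ?_⟩
      ext i
      rw [← hz]
      show (i.1 ∈ P ∧ _) ↔ ⟪n, i.1⟫ + c = 0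
      rw [inner_neg_left]
      constructor
      · rintro ⟨-, h⟩; linarith
      · intro h; exact ⟨subset_convexHull ℝ _ i.2, by linarith⟩
  exact ⟨RelIso.ofSurjective (OrderEmbedding.ofMapLEIff f hf) hsurj⟩

theorem exists_pp (P : Set (EucSp d)) (hP : IsConvexPolytope P) :
    ∃ ρ : Faces P → ℕ, PPoset (Faces P) ρ (d + 1) := by
  obtain ⟨⟨S, rfl⟩, hi⟩ := hP
  obtain ⟨φ⟩ := faces_iso S
  have hr : Module.finrank ℝ (LinearMap.range (evS S)) = d + 1 := by
    rw [LinearMap.finrank_range_of_inj (evS_inj S hi)]; simp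
  have := PPoset.transport φ (VL.pposet ⟨_, ⟨(0, 1), rfl⟩, by simp [evS]⟩)
  rw [hr] at this
  exact ⟨_, this⟩

end PolyFaces

open scoped Classical RealInnerProductSpace

/-! ### Models with two orbits of flags -/

theorem iter_eq_of_comm {Ω : Type} {f g : Ω → Ω} (h : ∀ x, f (g x) = g (f x)) {x0 : Ω} (h0 : f x0 = g x0) (k : ℕ) :
    f^[k] x0 = g^[k] x0 := by
  have hc : ∀ k x, f^[k] (g x) = g (f^[k] x) := by
    intro k
    induction k with
    | zero => intro x; rfl
    | succ k ih => intro x; rw [Function.iterate_succ_apply, h, ih, Function.iterate_succ_apply]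
  induction k with
  | zero => rfl
  | succ k ih => rw [Function.iterate_succ_apply, h0, hc, ih, Function.iterate_succ_apply']

namespace PPoset
variable {L : Type} [PartialOrder L] {ρ : L → ℕ}

theorem mapFl_trans {n : ℕ} (H : PPoset L ρ n) (γ δ : L ≃o L) (x : Fl L ρ n) :
    H.mapFl H (γ.trans δ) x = H.mapFl H δ (H.mapFl H γ x) := rfl

theorem mapFl_refl {n : ℕ} (H : PPoset L ρ n) (x : Fl L ρ n) :
    H.mapFl H (OrderIso.refl L) x = x := rfl

/-- strict chains of full length are flags -/
theorem mk_fl (H : PPoset L ρ 4) (c : ℕ → L) (h : ∀ i, i < 4 → c i < c (i + 1)) (h' : ∀ i, 4 ≤ i → c i = c 4) :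
    ∃ x : Fl L ρ 4, ∀ i, x.1 i = c i := by
  refine ⟨⟨c, ?_, h, h'⟩, fun _ => rfl⟩
  have h0 := H.mono _ _ (h 0 (by omega))
  have h1 := H.mono _ _ (h 1 (by omega))
  have h2 := H.mono _ _ (h 2 (by omega))
  have h3 := H.mono _ _ (h 3 (by omega))
  have h4 := H.rk_le (c 4)
  simp only [zero_add, Nat.reduceAdd] at h0 h1 h2 h3
  intro i hi
  interval_cases i <;> omega

theorem model_core (H : PPoset L ρ 4) (A B C : L ≃o L) (Φ Φ' : Fl L ρ 4) (h3 : Φ' = H.adj 3 Φ)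
    (hA : H.mapFl H A Φ = H.adj 1 Φ) (hA' : H.mapFl H A Φ' = H.adj 1 Φ')
    (hB : H.mapFl H B Φ = H.adj 2 Φ) (hC : H.mapFl H C Φ' = H.adj 2 Φ') {q : ℕ} (hq : q = 4 ∨ q = 5)
    (rAB : ∀ x, (fun x => A (B x))^[3] x = x) (rAC : ∀ x, (fun x => A (C x))^[q] x = x)
    (rBC : ∀ x, (fun x => B (C x))^[2] x = x) :
    RType (fun i => H.adj (4 - i)) q ∧ (∀ γ : L ≃o L, H.mapFl H γ Φ ≠ Φ') ∧
    ∀ G : Set (L ≃o L), OrderIso.refl L ∈ G → (∀ γ ∈ G, A.trans γ ∈ G) → (∀ γ ∈ G, B.trans γ ∈ G) →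
      (∀ γ ∈ G, C.trans γ ∈ G) → ∀ x, ∃ γ ∈ G, x = H.mapFl H γ Φ ∨ x = H.mapFl H γ Φ' := by
  have F := H.fs
  have v1 : 0 < 1 ∧ 1 < 4 := by omega
  have v2 : 0 < 2 ∧ 2 < 4 := by omega
  have v3 : 0 < 3 ∧ 3 < 4 := by omega
  have h3' : H.adj 3 Φ' = Φ := by rw [h3, H.adj_invol v3]
  have cm : ∀ (γ : L ≃o L) i, 0 < i → i < 4 → ∀ x, H.adj i (H.mapFl H γ x) = H.mapFl H γ (H.adj i x) :=
    fun γ i h h' x => (H.mapFl_adj H γ i h h' x).symm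
  have horb : ∀ G : Set (L ≃o L), OrderIso.refl L ∈ G → (∀ γ ∈ G, A.trans γ ∈ G) → (∀ γ ∈ G, B.trans γ ∈ G) →
      (∀ γ ∈ G, C.trans γ ∈ G) → ∀ x, ∃ γ ∈ G, x = H.mapFl H γ Φ ∨ x = H.mapFl H γ Φ' := by
    intro G g0 gA gB gC x
    refine (F.conn Φ x).inv (fun x => ∃ γ ∈ G, x = H.mapFl H γ Φ ∨ x = H.mapFl H γ Φ') ?_
      ⟨_, g0, Or.inl rfl⟩
    rintro i ⟨i0, i4⟩ z ⟨γ, hγ, hz⟩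
    have : i = 1 ∨ i = 2 ∨ i = 3 := by omega
    rcases this with rfl | rfl | rfl <;> rcases hz with rfl | rfl
    · exact ⟨_, gA γ hγ, Or.inl (by rw [cm γ 1 i0 i4, ← hA, mapFl_trans])⟩
    · exact ⟨_, gA γ hγ, Or.inr (by rw [cm γ 1 i0 i4, ← hA', mapFl_trans])⟩
    · exact ⟨_, gB γ hγ, Or.inl (by rw [cm γ 2 i0 i4, ← hB, mapFl_trans])⟩
    · exact ⟨_, gC γ hγ, Or.inr (by rw [cm γ 2 i0 i4, ← hC, mapFl_trans])⟩
    · exact ⟨γ, hγ, Or.inr (by rw [cm γ 3 i0 i4, h3])⟩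
    · exact ⟨γ, hγ, Or.inl (by rw [cm γ 3 i0 i4, h3'])⟩
  have hpow : ∀ (γ δ : L ≃o L) k x, (∀ y, (fun y => γ (δ y))^[k] y = y) →
      (fun z => H.mapFl H γ (H.mapFl H δ z))^[k] x = x := by
    intro γ δ k x h
    have : ∀ k x i, ((fun z => H.mapFl H γ (H.mapFl H δ z))^[k] x).1 i = (fun y => γ (δ y))^[k] (x.1 i) := by
      intro k
      induction k with
      | zero => intro x i; rfl
      | succ k ih => intro x i; rw [Function.iterate_succ_apply, ih, Function.iterate_succ_apply]; rfl
    apply Fl.ext'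
    intro i
    rw [this, h]
  have pinv : ∀ (γ : L ≃o L) i j, (0 < i ∧ i < 4) → (0 < j ∧ j < 4) → ∀ x,
      Per H.adj i j (H.mapFl H γ x) = Per H.adj i j x := by
    intro γ i j hi hj x
    exact Per_map (H.mapFl H γ) (H.mapFl_inj H γ) (fun x => H.mapFl_adj H γ i hi.1 hi.2 x)
      (fun x => H.mapFl_adj H γ j hj.1 hj.2 x) x
  have p1 : Per H.adj 2 1 Φ = 3 := by
    have e : (H.adj 2 ∘ H.adj 1)^[3] Φ = Φ := by
      rw [iter_eq_of_comm (g := fun z => H.mapFl H A (H.mapFl H B z))]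
      · exact hpow A B 3 Φ rAB
      · intro x; simp [cm]
      · show H.adj 2 (H.adj 1 Φ) = _
        rw [← hA, cm A 2 v2.1 v2.2, hB]
    have h1 : Per H.adj 2 1 Φ ∣ 3 := Function.IsPeriodicPt.minimalPeriod_dvd e
    have h2 := F.Per_ge' v2 v1 (by omega) Φ
    have := Nat.le_of_dvd (by omega) h1
    omega
  have p2 : Per H.adj 2 1 Φ' = q := by
    have e : (H.adj 2 ∘ H.adj 1)^[q] Φ' = Φ' := by
      rw [iter_eq_of_comm (g := fun z => H.mapFl H A (H.mapFl H C z))]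
      · exact hpow A C q Φ' rAC
      · intro x; simp [cm]
      · show H.adj 2 (H.adj 1 Φ') = _
        rw [← hA', cm A 2 v2.1 v2.2, hC]
    have h1 : Per H.adj 2 1 Φ' ∣ q := Function.IsPeriodicPt.minimalPeriod_dvd e
    have h2 := F.Per_ge' v2 v1 (by omega) Φ'
    have h3 := Nat.le_of_dvd (by omega) h1
    generalize Per H.adj 2 1 Φ' = m at *
    rcases hq with rfl | rfl <;> interval_cases m <;> omega
  have p3 : Per H.adj 3 2 Φ = 4 := by
    have e : ((H.adj 3 ∘ H.adj 2)^[2])^[2] Φ = Φ := by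
      rw [iter_eq_of_comm (g := fun z => H.mapFl H B (H.mapFl H C z))]
      · exact hpow B C 2 Φ rBC
      · intro x; simp [cm]
      · show H.adj 3 (H.adj 2 (H.adj 3 (H.adj 2 Φ))) = _
        rw [← hB, cm B 3 v3.1 v3.2, ← h3, cm B 2 v2.1 v2.2, ← hC, cm B 3 v3.1 v3.2, cm C 3 v3.1 v3.2, h3']
    rw [← Function.iterate_mul] at e
    have h1 : Per H.adj 3 2 Φ ∣ 4 := Function.IsPeriodicPt.minimalPeriod_dvd e
    have h2 := F.Per_ge' v3 v2 (by omega) Φ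
    have h3 := Nat.le_of_dvd (by omega) h1
    generalize Per H.adj 3 2 Φ = m at *
    interval_cases m <;> omega
  have p4 : Per H.adj 3 2 Φ' = 4 := by
    rw [h3, Per_left (F.iv v3) (F.iv v2), p3]
  have hall := horb Set.univ trivial (fun _ _ => trivial) (fun _ _ => trivial) (fun _ _ => trivial)
  refine ⟨⟨fun x => decide (Per H.adj 2 1 x = 3), ?_, ?_, ?_, ?_, ?_⟩, ?_, horb⟩
  · intro x
    show decide (Per H.adj 2 1 (H.adj 3 x) = 3) = !decide (Per H.adj 2 1 x = 3)
    obtain ⟨γ, -, rfl | rfl⟩ := hall x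
    · rw [cm γ 3 v3.1 v3.2, ← h3, pinv γ 2 1 v2 v1, pinv γ 2 1 v2 v1, p1, p2]
      simp; omega
    · rw [cm γ 3 v3.1 v3.2, h3', pinv γ 2 1 v2 v1, pinv γ 2 1 v2 v1, p1, p2]
      simp; omega
  · intro x
    show decide (Per H.adj 2 1 (H.adj 2 x) = 3) = decide (Per H.adj 2 1 x = 3)
    rw [Per_left (F.iv v2) (F.iv v1)]
  · intro x
    show decide (Per H.adj 2 1 (H.adj 1 x) = 3) = decide (Per H.adj 2 1 x = 3)
    rw [Per_right (F.iv v2) (F.iv v1)]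
  · intro x
    show Per H.adj 3 2 x = 4
    obtain ⟨γ, -, rfl | rfl⟩ := hall x
    · rw [pinv γ 3 2 v3 v2, p3]
    · rw [pinv γ 3 2 v3 v2, p4]
  · intro x
    show Per H.adj 2 1 x = cond (decide (Per H.adj 2 1 x = 3)) 3 q
    obtain ⟨γ, -, rfl | rfl⟩ := hall x
    · rw [pinv γ 2 1 v2 v1, p1]; simp
    · rw [pinv γ 2 1 v2 v1, p2]
      rcases hq with rfl | rfl <;> simp
  · intro γ h
    have := pinv γ 2 1 v2 v1 Φ
    rw [h, p1, p2] at this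
    omega

end PPoset

section FaceMaps
variable {d : ℕ}

theorem exposed_image {Q F : Set (EucSp d)} (γ : EucSp d ≃ᵢ EucSp d) (h : γ '' Q = Q) (hF : IsExposed ℝ Q F) :
    IsExposed ℝ Q (γ '' F) := by
  rintro ⟨_, x, hx, rfl⟩
  obtain ⟨l, hl⟩ := hF ⟨x, hx⟩
  let A := γ.toRealAffineIsometryEquiv
  have hA : ∀ a b, γ b - γ a = A.linearIsometryEquiv (b - a) := by
    intro a b
    have := A.map_vsub b a
    simp only [vsub_eq_sub] at this
    rw [this]; rfl
  let l' : StrongDual ℝ (EucSp d) := l.comp A.linearIsometryEquiv.symm.toContinuousLinearEquiv.toContinuousLinearMap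
  have hl' : ∀ a b, l' (γ a) ≤ l' (γ b) ↔ l a ≤ l b := by
    intro a b
    rw [← sub_nonneg, ← map_sub, hA]
    have : l' (A.linearIsometryEquiv (b - a)) = l (b - a) := by simp [l']
    rw [this, map_sub, sub_nonneg]
  refine ⟨l', ?_⟩
  ext z
  constructor
  · rintro ⟨y, hy, rfl⟩
    rw [hl] at hy
    refine ⟨by rw [← h]; exact ⟨y, hy.1, rfl⟩, ?_⟩
    rw [← h]
    rintro _ ⟨w, hw, rfl⟩
    exact (hl' _ _).2 (hy.2 w hw)
  · rintro ⟨h1, h2⟩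
    rw [← h] at h1
    obtain ⟨y, hy, rfl⟩ := h1
    refine ⟨y, ?_, rfl⟩
    rw [hl]
    refine ⟨hy, fun w hw => (hl' _ _).1 (h2 _ ?_)⟩
    rw [← h]; exact ⟨w, hw, rfl⟩

theorem symm_image {Q : Set (EucSp d)} (γ : EucSp d ≃ᵢ EucSp d) (h : γ '' Q = Q) : γ.symm '' Q = Q := by
  conv_lhs => rw [← h]
  rw [← Set.image_comp]
  simp

/-- the action of a symmetry on faces -/
noncomputable def faceMap (Q : Set (EucSp d)) (γ : EucSp d ≃ᵢ EucSp d) (h : γ '' Q = Q) : Faces Q ≃o Faces Q where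
  toFun F := ⟨γ '' F.1, exposed_image γ h F.2⟩
  invFun F := ⟨γ.symm '' F.1, exposed_image γ.symm (symm_image γ h) F.2⟩
  left_inv F := Subtype.ext (by
    show γ.symm '' (γ '' F.1) = F.1
    rw [← Set.image_comp]; simp)
  right_inv F := Subtype.ext (by
    show γ '' (γ.symm '' F.1) = F.1
    rw [← Set.image_comp]; simp)
  map_rel_iff' {F G} := by
    show γ '' F.1 ⊆ γ '' G.1 ↔ F.1 ⊆ G.1
    exact Set.image_subset_image_iff γ.injective

theorem geom_two {Q : Set (EucSp 3)} {ρ : Faces Q → ℕ} (H : PPoset (Faces Q) ρ 4) (x y : Fl (Faces Q) ρ 4)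
    (hne : ∀ γ : Faces Q ≃o Faces Q, H.mapFl H γ x ≠ y)
    (hall : ∀ z : Fl (Faces Q) ρ 4, ∃ γ : EucSp 3 ≃ᵢ EucSp 3, γ '' Q = Q ∧
      ((∀ i, (z.1 i).1 = γ '' (x.1 i).1) ∨ ∀ i, (z.1 i).1 = γ '' (y.1 i).1)) : GeomTwoOrbit Q := by
  obtain ⟨Φ, hΦ⟩ := H.exists_Flag x
  obtain ⟨Ψ, hΨ⟩ := H.exists_Flag y
  have vr : ∀ f : ℕ → Faces Q, (Subtype.val '' (Set.range f) : Set (Set (EucSp 3))) = Set.range (fun i => (f i).1) :=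
    fun f => (Set.range_comp _ _).symm
  have key : ∀ (z w : Fl (Faces Q) ρ 4) (Ω Ξ : Flag (Faces Q)), (Ω : Set (Faces Q)) = Set.range z.1 →
      (Ξ : Set (Faces Q)) = Set.range w.1 → ∀ γ : EucSp 3 ≃ᵢ EucSp 3, γ '' Q = Q →
      (∀ i, (z.1 i).1 = γ '' (w.1 i).1) → GeomSameFlagOrbit Q Ω Ξ := by
    intro z w Ω Ξ hz hw γ hγ h
    refine ⟨γ.symm, symm_image γ hγ, ?_⟩
    rw [hz, hw]
    refine (congrArg (fun A => (fun F : Set (EucSp 3) => γ.symm '' F) '' A) (vr z.1)).trans (Eq.trans ?_ (vr w.1).symm)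
    refine (Set.range_comp _ _).symm.trans (congrArg Set.range ?_)
    funext i
    show γ.symm '' (z.1 i).1 = (w.1 i).1
    rw [h, ← Set.image_comp]; simp
  refine ⟨Φ, Ψ, ?_, ?_⟩
  · rintro ⟨γ, hγ, h⟩
    apply hne (faceMap Q γ hγ)
    apply H.fl_range_inj
    rw [← hΨ]
    apply Set.image_injective.2 Subtype.val_injective
    rw [← h, hΦ]
    refine (vr _).trans ?_
    refine Eq.trans ?_ (congrArg (fun A => (fun F : Set (EucSp 3) => γ '' F) '' A) (vr x.1)).symm
    exact Set.range_comp (fun F : Set (EucSp 3) => γ '' F) (fun i => (x.1 i).1)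
  · intro Ω
    obtain ⟨z, hz⟩ := H.exists_fl Ω
    obtain ⟨γ, hγ, h | h⟩ := hall z
    · exact Or.inl (key z x Ω Φ hz.symm hΦ γ hγ h)
    · exact Or.inr (key z y Ω Ψ hz.symm hΨ γ hγ h)

end FaceMaps

open scoped Classical RealInnerProductSpace

/-! ### Geometric models -/

/-- the conclusion needed for a model: two orbits under linear isometries, and its type -/
structure Model (T : Set (EucSp 3)) (ρ : Faces T → ℕ) (H : PPoset (Faces T) ρ 4)
    (Φ Φ' : Fl (Faces T) ρ 4) (q : ℕ) : Prop where
  typ : RType (fun i => H.adj (4 - i)) q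
  ne : ∀ γ : Faces T ≃o Faces T, H.mapFl H γ Φ ≠ Φ'
  orb : ∀ z : Fl (Faces T) ρ 4, ∃ g : EucSp 3 ≃ₗᵢ[ℝ] EucSp 3, g '' T = T ∧
      ((∀ i, (z.1 i).1 = g '' (Φ.1 i).1) ∨ ∀ i, (z.1 i).1 = g '' (Φ'.1 i).1)

theorem Model.geom {T : Set (EucSp 3)} {ρ : Faces T → ℕ} {H : PPoset (Faces T) ρ 4}
    {Φ Φ' : Fl (Faces T) ρ 4} {q : ℕ} (M : Model T ρ H Φ Φ' q) : GeomTwoOrbit T := by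
  refine geom_two H Φ Φ' M.ne ?_
  intro z
  obtain ⟨g, h, h'⟩ := M.orb z
  exact ⟨g.toIsometryEquiv, h, h'⟩

theorem image_hull {S : Set (EucSp 3)} (R : EucSp 3 ≃ₗᵢ[ℝ] EucSp 3) (h : ∀ s ∈ S, R s ∈ S)
    (h' : ∀ x, R (R x) = x) : R '' (convexHull ℝ S) = convexHull ℝ S := by
  have e : R '' S = S := by
    ext x
    constructor
    · rintro ⟨s, hs, rfl⟩; exact h s hs
    · intro hx; exact ⟨R x, h x hx, h' x⟩
  have := LinearMap.image_convexHull (R.toLinearEquiv : EucSp 3 →ₗ[ℝ] EucSp 3) S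
  have e1 : ∀ A : Set (EucSp 3), (R.toLinearEquiv : EucSp 3 →ₗ[ℝ] EucSp 3) '' A = R '' A := fun A => rfl
  rw [e1, e1, e] at this
  exact this

theorem image_face {T : Set (EucSp 3)} (R : EucSp 3 ≃ₗᵢ[ℝ] EucSp 3) (hT : R '' T = T) {n : EucSp 3}
    (hn : R n = n) (M : ℝ) : R '' {y | y ∈ T ∧ ⟪n, y⟫ = M} = {y | y ∈ T ∧ ⟪n, y⟫ = M} := by
  ext x
  constructor
  · rintro ⟨y, ⟨h1, h2⟩, rfl⟩
    refine ⟨by rw [← hT]; exact ⟨y, h1, rfl⟩, ?_⟩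
    rw [← hn, R.inner_map_map, h2]
  · rintro ⟨h1, h2⟩
    rw [← hT] at h1
    obtain ⟨y, hy, rfl⟩ := h1
    refine ⟨y, ⟨hy, ?_⟩, rfl⟩
    rw [← hn, R.inner_map_map] at h2
    exact h2

theorem iter_faceMap {T : Set (EucSp 3)} (A B : EucSp 3 ≃ₗᵢ[ℝ] EucSp 3) (hA : A '' T = T) (hB : B '' T = T)
    (k : ℕ) (h : ∀ x, (fun x => A (B x))^[k] x = x) (F : Faces T) :
    (fun F => faceMap T A.toIsometryEquiv hA (faceMap T B.toIsometryEquiv hB F))^[k] F = F := by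
  have : ∀ k F, ((fun F => faceMap T A.toIsometryEquiv hA (faceMap T B.toIsometryEquiv hB F))^[k] F).1
      = (fun x => A (B x))^[k] '' F.1 := by
    intro k
    induction k with
    | zero => intro F; exact (Set.image_id _).symm
    | succ k ih =>
      intro F
      rw [Function.iterate_succ_apply, ih, Function.iterate_succ, Set.image_comp]
      congr 1
      show A '' (B '' F.1) = _
      rw [← Set.image_comp]; rfl
  apply Subtype.ext
  refine (this k F).trans ?_
  rw [show (fun x => A (B x))^[k] = id from funext h, Set.image_id]

theorem geo_model {S T : Set (EucSp 3)} (hT : T = convexHull ℝ S) {ρ : Faces T → ℕ}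
    (H : PPoset (Faces T) ρ 4) (A B C : EucSp 3 ≃ₗᵢ[ℝ] EucSp 3)
    (hA : ∀ s ∈ S, A s ∈ S) (hB : ∀ s ∈ S, B s ∈ S) (hC : ∀ s ∈ S, C s ∈ S)
    (iA : ∀ x, A (A x) = x) (iB : ∀ x, B (B x) = x) (iC : ∀ x, C (C x) = x)
    {q : ℕ} (hq : q = 4 ∨ q = 5)
    (rAB : ∀ x, (fun x => A (B x))^[3] x = x) (rAC : ∀ x, (fun x => A (C x))^[q] x = x)
    (rBC : ∀ x, (fun x => B (C x))^[2] x = x)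
    {p0 p1 p2 p3 nF nG : EucSp 3} {N MF MG : ℝ} (hp0 : p0 ∈ S) (hp1 : p1 ∈ S)
    (hN : ∀ s ∈ S, ⟪s, s⟫ = N) (hF : ∀ s ∈ S, ⟪nF, s⟫ ≤ MF) (hG : ∀ s ∈ S, ⟪nG, s⟫ ≤ MG)
    (h01 : p1 ≠ p0)
    (F0 : ⟪nF, p0⟫ = MF) (F1 : ⟪nF, p1⟫ = MF) (F3 : ⟪nF, p3⟫ ≠ MF)
    (G0 : ⟪nG, p0⟫ = MG) (G1 : ⟪nG, p1⟫ = MG) (G2 : ⟪nG, p2⟫ ≠ MG)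
    (A0 : A p0 = p1) (AF : A nF = nF) (AG : A nG = nG)
    (B0 : B p0 = p0) (B1 : B p1 = p2) (BF : B nF = nF)
    (C0 : C p0 = p0) (C1 : C p1 = p3) (CG : C nG = nG) :
    ∃ Φ Φ', Model T ρ H Φ Φ' q := by
  have ST : ∀ s ∈ S, s ∈ T := fun s hs => hT ▸ subset_convexHull ℝ S hs
  have TA : A '' T = T := hT ▸ image_hull A hA iA
  have TB : B '' T = T := hT ▸ image_hull B hB iB
  have TC : C '' T = T := hT ▸ image_hull C hC iC
  have hp2 : p2 ∈ S := B1 ▸ hB _ hp1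
  have hp3 : p3 ∈ S := C1 ▸ hC _ hp1
  have B2 : B p2 = p1 := by rw [← B1, iB]
  have F2 : ⟪nF, p2⟫ = MF := by rw [← B1, ← F1]; conv_lhs => rw [← BF]
                                rw [B.inner_map_map]
  have G3 : ⟪nG, p3⟫ = MG := by rw [← C1, ← G1]; conv_lhs => rw [← CG]
                                rw [C.inner_map_map]
  have EF : IsExposed ℝ T {y | y ∈ T ∧ ⟪nF, y⟫ = MF} :=
    isExposed_of nF MF fun y hy => hull_le (innerₛₗ ℝ nF) hF (hT ▸ hy)
  have EG : IsExposed ℝ T {y | y ∈ T ∧ ⟪nG, y⟫ = MG} :=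
    isExposed_of nG MG fun y hy => hull_le (innerₛₗ ℝ nG) hG (hT ▸ hy)
  have hs0 : ∀ s ∈ S, ⟪s - p0, s - p0⟫ = 2 * N - 2 * ⟪p0, s⟫ := by
    intro s hs
    rw [inner_sub_left, inner_sub_right, inner_sub_right, hN s hs, hN p0 hp0, real_inner_comm p0 s]
    ring
  have hle : ∀ s ∈ S, ⟪p0, s⟫ ≤ N := by
    intro s hs
    have h1 := hs0 s hs
    have h2 : 0 ≤ ⟪s - p0, s - p0⟫ := real_inner_self_nonneg
    linarith
  have E0' : IsExposed ℝ T {y | y ∈ T ∧ ⟪p0, y⟫ = N} :=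
    isExposed_of p0 N fun y hy => hull_le (innerₛₗ ℝ p0) hle (hT ▸ hy)
  have e0 : {y | y ∈ T ∧ ⟪p0, y⟫ = N} = {p0} := by
    apply Set.Subset.antisymm
    · have E1 := E0'
      rw [hT] at E1
      rw [hT]
      refine (face_hull E1).trans ?_
      have : {s | s ∈ S ∧ s ∈ {y | y ∈ convexHull ℝ S ∧ ⟪p0, y⟫ = N}} ⊆ {p0} := by
        rintro s ⟨hs, -, h⟩
        have h1 := hs0 s hs
        rw [h, sub_self] at h1
        exact sub_eq_zero.1 (inner_self_eq_zero.1 h1)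
      exact (convexHull_mono this).trans (by rw [convexHull_singleton])
    · rintro _ rfl
      exact ⟨ST _ hp0, hN _ hp0⟩
  rw [e0] at E0'
  let f0 : Faces T := ⟨∅, isExposed_empty⟩
  let f1 : Faces T := ⟨{p0}, E0'⟩
  let fF : Faces T := ⟨_, EF⟩
  let fG : Faces T := ⟨_, EG⟩
  let f2 : Faces T := ⟨_, EF.inter EG⟩
  let f4 : Faces T := ⟨T, IsExposed.refl T⟩
  have lt_of : ∀ (a b : Faces T) (x : EucSp 3), a.1 ⊆ b.1 → x ∈ b.1 → x ∉ a.1 → a < b := by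
    intro a b x h1 h2 h3
    refine lt_of_le_of_ne h1 ?_
    rintro rfl
    exact h3 h2
  have l01 : f0 < f1 := lt_of _ _ p0 (Set.empty_subset _) rfl (fun h => h)
  have l12 : f1 < f2 := lt_of _ _ p1 (Set.singleton_subset_iff.2 ⟨⟨ST _ hp0, F0⟩, ⟨ST _ hp0, G0⟩⟩)
    ⟨⟨ST _ hp1, F1⟩, ⟨ST _ hp1, G1⟩⟩ (fun h => h01 h)
  have l2F : f2 < fF := lt_of _ _ p2 Set.inter_subset_left ⟨ST _ hp2, F2⟩ (fun h => G2 h.2.2)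
  have l2G : f2 < fG := lt_of _ _ p3 Set.inter_subset_right ⟨ST _ hp3, G3⟩ (fun h => F3 h.1.2)
  have lF4 : fF < f4 := lt_of _ _ p3 (fun x h => h.1) (ST _ hp3) (fun h => F3 h.2)
  have lG4 : fG < f4 := lt_of _ _ p2 (fun x h => h.1) (ST _ hp2) (fun h => G2 h.2)
  let c : Faces T → ℕ → Faces T := fun f i =>
    if i = 0 then f0 else if i = 1 then f1 else if i = 2 then f2 else if i = 3 then f else f4
  have hc : ∀ f, f2 < f → f < f4 → ∃ x : Fl (Faces T) ρ 4, ∀ i, x.1 i = c f i := by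
    intro f h h'
    apply H.mk_fl
    · intro i hi
      interval_cases i <;> simp only [c] <;> norm_num <;> assumption
    · intro i hi
      have : i ≠ 0 ∧ i ≠ 1 ∧ i ≠ 2 ∧ i ≠ 3 := by omega
      simp [c, this]
  obtain ⟨Φ, hΦ⟩ := hc fF l2F lF4
  obtain ⟨Φ', hΦ'⟩ := hc fG l2G lG4
  have v1 : 0 < 1 ∧ 1 < 4 := by omega
  have v2 : 0 < 2 ∧ 2 < 4 := by omega
  have v3 : 0 < 3 ∧ 3 < 4 := by omega
  -- the action on the base faces
  have fx : ∀ (γ : EucSp 3 ≃ₗᵢ[ℝ] EucSp 3) (h : γ '' T = T), faceMap T γ.toIsometryEquiv h f0 = f0 ∧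
      faceMap T γ.toIsometryEquiv h f4 = f4 :=
    fun γ h => ⟨Subtype.ext (Set.image_empty _), Subtype.ext h⟩
  have fF' : ∀ (γ : EucSp 3 ≃ₗᵢ[ℝ] EucSp 3) (h : γ '' T = T), γ nF = nF →
      faceMap T γ.toIsometryEquiv h fF = fF :=
    fun γ h h' => Subtype.ext (image_face γ h h' _)
  have fG' : ∀ (γ : EucSp 3 ≃ₗᵢ[ℝ] EucSp 3) (h : γ '' T = T), γ nG = nG →
      faceMap T γ.toIsometryEquiv h fG = fG :=
    fun γ h h' => Subtype.ext (image_face γ h h' _)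
  have f1' : ∀ (γ : EucSp 3 ≃ₗᵢ[ℝ] EucSp 3) (h : γ '' T = T), γ p0 = p0 →
      faceMap T γ.toIsometryEquiv h f1 = f1 :=
    fun γ h h' => Subtype.ext (by show γ '' {p0} = {p0}; rw [Set.image_singleton, h'])
  have f2' : faceMap T A.toIsometryEquiv TA f2 = f2 := by
    apply Subtype.ext
    show A '' (_ ∩ _) = _ ∩ _
    rw [Set.image_inter A.injective, image_face A TA AF, image_face A TA AG]
  have cs : ∀ j : ℕ, j = 0 ∨ j = 1 ∨ j = 2 ∨ j = 3 ∨ (j ≠ 0 ∧ j ≠ 1 ∧ j ≠ 2 ∧ j ≠ 3) := by omega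
  have kA : ∀ f (Ψ : Fl (Faces T) ρ 4), (∀ i, Ψ.1 i = c f i) → faceMap T A.toIsometryEquiv TA f = f →
      H.mapFl H (faceMap T A.toIsometryEquiv TA) Ψ = H.adj 1 Ψ := by
    intro f Ψ hΨ hf
    apply H.adj_eq v1
    · intro j hj
      show faceMap T A.toIsometryEquiv TA (Ψ.1 j) = Ψ.1 j
      rw [hΨ]
      rcases cs j with rfl | rfl | rfl | rfl | h
      · exact (fx A TA).1
      · exact absurd rfl hj
      · exact f2'
      · exact hf
      · simp only [c, h, if_false]; exact (fx A TA).2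
    · intro h
      have h1 : faceMap T A.toIsometryEquiv TA (Ψ.1 1) = Ψ.1 1 := congrFun (congrArg Subtype.val h) 1
      rw [hΨ] at h1
      have h2 : A '' {p0} = {p0} := congrArg Subtype.val h1
      rw [Set.image_singleton, A0] at h2
      exact h01 (Set.singleton_injective h2)
  have kB : ∀ f (Ψ : Fl (Faces T) ρ 4) (γ : EucSp 3 ≃ₗᵢ[ℝ] EucSp 3) (h : γ '' T = T), (∀ i, Ψ.1 i = c f i) →
      faceMap T γ.toIsometryEquiv h f = f → γ p0 = p0 → γ p1 ∉ f2.1 →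
      H.mapFl H (faceMap T γ.toIsometryEquiv h) Ψ = H.adj 2 Ψ := by
    intro f Ψ γ h hΨ hf h0 h1
    apply H.adj_eq v2
    · intro j hj
      show faceMap T γ.toIsometryEquiv h (Ψ.1 j) = Ψ.1 j
      rw [hΨ]
      rcases cs j with rfl | rfl | rfl | rfl | h'
      · exact (fx γ h).1
      · exact f1' γ h h0
      · exact absurd rfl hj
      · exact hf
      · simp only [c, h', if_false]; exact (fx γ h).2
    · intro h'
      have h1' : faceMap T γ.toIsometryEquiv h (Ψ.1 2) = Ψ.1 2 := congrFun (congrArg Subtype.val h') 2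
      rw [hΨ] at h1'
      have h2 : γ '' f2.1 = f2.1 := congrArg Subtype.val h1'
      apply h1
      rw [← h2]
      exact ⟨p1, ⟨⟨ST _ hp1, F1⟩, ⟨ST _ hp1, G1⟩⟩, rfl⟩
  have h3 : Φ' = H.adj 3 Φ := by
    apply H.adj_eq v3
    · intro j hj
      rw [hΦ, hΦ']
      simp only [c, hj, if_false]
    · intro h
      have h1 : Φ'.1 3 = Φ.1 3 := by rw [h]
      rw [hΦ, hΦ'] at h1
      have h2 : fG = fF := h1
      have h4 : p2 ∈ fG.1 := by rw [h2]; exact ⟨ST _ hp2, F2⟩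
      exact G2 h4.2
  obtain ⟨m1, m2, m3⟩ := H.model_core (faceMap T A.toIsometryEquiv TA) (faceMap T B.toIsometryEquiv TB)
    (faceMap T C.toIsometryEquiv TC) Φ Φ' h3 (kA _ _ hΦ (fF' A TA AF)) (kA _ _ hΦ' (fG' A TA AG))
    (kB _ _ B TB hΦ (fF' B TB BF) B0 (fun h => G2 (by rw [← B1]; exact h.2.2)))
    (kB _ _ C TC hΦ' (fG' C TC CG) C0 (fun h => F3 (by rw [← C1]; exact h.1.2))) hq
    (iter_faceMap A B TA TB 3 rAB) (iter_faceMap A C TA TC q rAC) (iter_faceMap B C TB TC 2 rBC)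
  refine ⟨Φ, Φ', m1, m2, ?_⟩
  have gs : ∀ (R : EucSp 3 ≃ₗᵢ[ℝ] EucSp 3) (hR : R '' T = T),
      ∀ γ ∈ {γ : Faces T ≃o Faces T | ∃ g : EucSp 3 ≃ₗᵢ[ℝ] EucSp 3, g '' T = T ∧ ∀ F, (γ F).1 = g '' F.1},
      (faceMap T R.toIsometryEquiv hR).trans γ ∈
      {γ : Faces T ≃o Faces T | ∃ g : EucSp 3 ≃ₗᵢ[ℝ] EucSp 3, g '' T = T ∧ ∀ F, (γ F).1 = g '' F.1} := by
    rintro R hR γ ⟨g, h, h'⟩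
    refine ⟨R.trans g, ?_, ?_⟩
    · rw [LinearIsometryEquiv.coe_trans, Set.image_comp, hR, h]
    · intro F
      refine (h' _).trans ?_
      rw [LinearIsometryEquiv.coe_trans, Set.image_comp]
      rfl
  intro z
  obtain ⟨γ, ⟨g, hg, hg'⟩, hz⟩ := m3
    {γ : Faces T ≃o Faces T | ∃ g : EucSp 3 ≃ₗᵢ[ℝ] EucSp 3, g '' T = T ∧ ∀ F, (γ F).1 = g '' F.1}
    ⟨LinearIsometryEquiv.refl ℝ _, Set.image_id _, fun F => (Set.image_id _).symm⟩
    (gs A TA) (gs B TB) (gs C TC) z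
  refine ⟨g, hg, ?_⟩
  rcases hz with rfl | rfl
  · exact Or.inl fun i => hg' _
  · exact Or.inr fun i => hg' _

open scoped Classical RealInnerProductSpace

/-! ### Duality -/

/-- a pair of polytopes dual to each other -/
structure DP (T Q : Set (EucSp 3)) (r : ℝ) : Prop where
  polT : ∃ S : Set (EucSp 3), S.Finite ∧ T = convexHull ℝ S
  polQ : ∃ S : Set (EucSp 3), S.Finite ∧ Q = convexHull ℝ S
  le : ∀ x ∈ T, ∀ y ∈ Q, ⟪x, y⟫ ≤ r
  fT : ∀ F, IsExposed ℝ T F → F ≠ T → ∃ y ∈ Q, F = {x | x ∈ T ∧ ⟪x, y⟫ = r}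
  fQ : ∀ F, IsExposed ℝ Q F → F ≠ Q → ∃ x ∈ T, F = {y | y ∈ Q ∧ ⟪x, y⟫ = r}

theorem DP.symm {T Q : Set (EucSp 3)} {r : ℝ} (h : DP T Q r) : DP Q T r where
  polT := h.polQ
  polQ := h.polT
  le x hx y hy := by rw [real_inner_comm]; exact h.le y hy x hx
  fT F hF hne := by
    obtain ⟨x, hx, e⟩ := h.fQ F hF hne
    refine ⟨x, hx, e.trans ?_⟩
    ext y; simp [real_inner_comm]
  fQ F hF hne := by
    obtain ⟨x, hx, e⟩ := h.fT F hF hne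
    refine ⟨x, hx, e.trans ?_⟩
    ext y; simp [real_inner_comm]

/-- the dual face -/
def dface (Q : Set (EucSp 3)) (r : ℝ) (F : Set (EucSp 3)) : Set (EucSp 3) :=
  {y | y ∈ Q ∧ ∀ x ∈ F, ⟪x, y⟫ = r}

theorem DP.exposed {T Q : Set (EucSp 3)} {r : ℝ} (h : DP T Q r) {F : Set (EucSp 3)} (hF : IsExposed ℝ T F) :
    IsExposed ℝ Q (dface Q r F) := by
  obtain ⟨S, fS, hS⟩ := h.polT
  have key : ∀ A : Set (EucSp 3), A.Finite → A ⊆ T → IsExposed ℝ Q (dface Q r A) := by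
    intro A hA
    induction A, hA using Set.Finite.induction_on with
    | empty =>
      intro _
      have : dface Q r ∅ = Q := by ext y; simp [dface]
      rw [this]
    | @insert a A _ _ ih =>
      intro hs
      have h1 := ih ((Set.subset_insert _ _).trans hs)
      have h2 : IsExposed ℝ Q {y | y ∈ Q ∧ ⟪a, y⟫ = r} :=
        isExposed_of a r (fun y hy => h.le a (hs (Set.mem_insert _ _)) y hy)
      have : dface Q r (insert a A) = {y | y ∈ Q ∧ ⟪a, y⟫ = r} ∩ dface Q r A := by
        ext y
        simp only [dface, Set.mem_insert_iff, forall_eq_or_imp, Set.mem_ofPred_eq, Set.mem_inter_iff]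
        tauto
      rw [this]
      exact h2.inter h1
  have : dface Q r F = dface Q r {s | s ∈ S ∧ s ∈ F} := by
    ext y
    constructor
    · rintro ⟨h1, h2⟩
      exact ⟨h1, fun x hx => h2 x hx.2⟩
    · rintro ⟨h1, h2⟩
      refine ⟨h1, fun x hx => ?_⟩
      subst hS
      have hx' := face_hull hF hx
      have hc : Convex ℝ {x : EucSp 3 | (innerₛₗ ℝ y) x = r} := convex_hyperplane (innerₛₗ ℝ y).isLinear r
      have := convexHull_min (fun s hs => ?_) hc hx'
      · rw [real_inner_comm]; exact this
      · show ⟪y, s⟫ = r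
        rw [real_inner_comm]; exact h2 s hs
  rw [this]
  apply key
  · exact fS.subset (fun s hs => hs.1)
  · intro s hs; exact hF.subset hs.2

theorem DP.dd {T Q : Set (EucSp 3)} {r : ℝ} (h : DP T Q r) {F : Set (EucSp 3)} (hF : IsExposed ℝ T F) :
    dface T r (dface Q r F) = F := by
  apply Set.Subset.antisymm
  · rintro x ⟨hx, h1⟩
    by_cases hFT : F = T
    · rw [hFT]; exact hx
    obtain ⟨y, hy, e⟩ := h.fT F hF hFT
    have : y ∈ dface Q r F := ⟨hy, fun x hx => by rw [e] at hx; exact hx.2⟩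
    have := h1 y this
    rw [e]
    exact ⟨hx, by rw [real_inner_comm]; exact this⟩
  · intro x hx
    exact ⟨hF.subset hx, fun y hy => by rw [real_inner_comm]; exact hy.2 x hx⟩

/-- the duality of faces -/
noncomputable def DP.dl {T Q : Set (EucSp 3)} {r : ℝ} (h : DP T Q r) (F : Faces T) : Faces Q :=
  ⟨dface Q r F.1, h.exposed F.2⟩

theorem DP.dl_dl {T Q : Set (EucSp 3)} {r : ℝ} (h : DP T Q r) (F : Faces T) : h.symm.dl (h.dl F) = F :=
  Subtype.ext (h.dd F.2)

theorem DP.dl_anti {T Q : Set (EucSp 3)} {r : ℝ} (h : DP T Q r) {F G : Faces T} (hl : F ≤ G) :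
    h.dl G ≤ h.dl F := by
  rintro y ⟨h1, h2⟩
  exact ⟨h1, fun x hx => h2 x (hl hx)⟩

theorem DP.dl_lt {T Q : Set (EucSp 3)} {r : ℝ} (h : DP T Q r) {F G : Faces T} (hl : F < G) :
    h.dl G < h.dl F := by
  refine lt_of_le_of_ne (h.dl_anti hl.le) ?_
  intro e
  have := congrArg h.symm.dl e
  rw [h.dl_dl, h.dl_dl] at this
  exact hl.ne' this

noncomputable def DP.iso {T Q : Set (EucSp 3)} {r : ℝ} (h : DP T Q r) : (Faces T)ᵒᵈ ≃o Faces Q where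
  toFun F := h.dl (OrderDual.ofDual F)
  invFun F := OrderDual.toDual (h.symm.dl F)
  left_inv F := h.dl_dl F
  right_inv F := h.symm.dl_dl F
  map_rel_iff' {F G} := by
    constructor
    · intro hl
      have h1 : h.dl (OrderDual.ofDual F) ≤ h.dl (OrderDual.ofDual G) := hl
      have := h.symm.dl_anti h1
      rw [h.dl_dl, h.dl_dl] at this
      exact this
    · intro hl
      exact h.dl_anti hl

theorem dface_image {Q : Set (EucSp 3)} {r : ℝ} (g : EucSp 3 ≃ₗᵢ[ℝ] EucSp 3) (hQ : g '' Q = Q)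
    (F : Set (EucSp 3)) : dface Q r (g '' F) = g '' dface Q r F := by
  ext y
  constructor
  · rintro ⟨h1, h2⟩
    rw [← hQ] at h1
    obtain ⟨z, hz, rfl⟩ := h1
    refine ⟨z, ⟨hz, fun x hx => ?_⟩, rfl⟩
    have := h2 (g x) ⟨x, hx, rfl⟩
    rwa [g.inner_map_map] at this
  · rintro ⟨z, ⟨h1, h2⟩, rfl⟩
    refine ⟨by rw [← hQ]; exact ⟨z, h1, rfl⟩, ?_⟩
    rintro _ ⟨x, hx, rfl⟩
    rw [g.inner_map_map, h2 x hx]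

theorem DP.star {T Q : Set (EucSp 3)} {r : ℝ} (h : DP T Q r) {ρ : Faces T → ℕ} {ρ' : Faces Q → ℕ}
    (H' : PPoset (Faces Q) ρ' 4) (x : Fl (Faces T) ρ 4) :
    ∃ y : Fl (Faces Q) ρ' 4, ∀ i, y.1 i = h.dl (x.1 (4 - i)) := by
  apply H'.mk_fl
  · intro i hi
    apply h.dl_lt
    have := x.2.2.1 (4 - (i + 1)) (by omega)
    rwa [show 4 - (i + 1) + 1 = 4 - i by omega] at this
  · intro i hi
    rw [show 4 - i = 4 - 4 by omega]

theorem Model.dual_geom {T Q : Set (EucSp 3)} {ρ : Faces T → ℕ} {H : PPoset (Faces T) ρ 4}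
    {Φ Φ' : Fl (Faces T) ρ 4} {q : ℕ} (M : Model T ρ H Φ Φ' q) {ρ' : Faces Q → ℕ} (H' : PPoset (Faces Q) ρ' 4)
    {r : ℝ} (h : DP T Q r) (hinv : ∀ g : EucSp 3 ≃ₗᵢ[ℝ] EucSp 3, g '' T = T → g '' Q = Q) : GeomTwoOrbit Q := by
  obtain ⟨x, hx⟩ := h.star H' Φ
  obtain ⟨y, hy⟩ := h.star H' Φ'
  have fl4 : ∀ (z : Fl (Faces T) ρ 4) i, z.1 (4 - (4 - i)) = z.1 i := by
    intro z i
    by_cases hi : i ≤ 4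
    · rw [show 4 - (4 - i) = i by omega]
    · rw [show 4 - (4 - i) = 4 by omega, z.2.2.2 i (by omega)]
  have fl4' : ∀ (z : Fl (Faces Q) ρ' 4) i, z.1 (4 - (4 - i)) = z.1 i := by
    intro z i
    by_cases hi : i ≤ 4
    · rw [show 4 - (4 - i) = i by omega]
    · rw [show 4 - (4 - i) = 4 by omega, z.2.2.2 i (by omega)]
  refine geom_two H' x y ?_ ?_
  · intro γ e
    refine M.ne ((h.iso.trans (γ.trans h.iso.symm)).dual) ?_
    apply PPoset.Fl.ext'
    intro i
    show h.symm.dl (γ (h.dl (Φ.1 i))) = Φ'.1 i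
    have e1 : γ (x.1 (4 - i)) = y.1 (4 - i) := congrFun (congrArg Subtype.val e) (4 - i)
    rw [hx, hy, fl4, fl4] at e1
    rw [e1, h.dl_dl]
  · intro z
    obtain ⟨w, hw⟩ := h.symm.star H z
    obtain ⟨g, hg, hz⟩ := M.orb w
    have hgQ := hinv g hg
    refine ⟨g.toIsometryEquiv, hgQ, ?_⟩
    have key : ∀ (Ψ : Fl (Faces T) ρ 4) (v : Fl (Faces Q) ρ' 4), (∀ i, v.1 i = h.dl (Ψ.1 (4 - i))) →
        (∀ i, (w.1 i).1 = g '' (Ψ.1 i).1) → ∀ i, (z.1 i).1 = g '' (v.1 i).1 := by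
      intro Ψ v hv hΨ i
      have h1 : h.dl (w.1 (4 - i)) = z.1 i := by rw [hw, fl4', h.symm.dl_dl]
      rw [← h1, hv]
      show dface Q r (w.1 (4 - i)).1 = g '' dface Q r (Ψ.1 (4 - i)).1
      rw [hΨ, dface_image g hgQ]
    rcases hz with hz | hz
    · exact Or.inl (key Φ x hx hz)
    · exact Or.inr (key Φ' y hy hz)

open scoped Classical RealInnerProductSpace

/-! ### Polars -/

/-- the polar set at level `r` -/
def polr (T : Set (EucSp 3)) (r : ℝ) : Set (EucSp 3) := {y | ∀ x ∈ T, ⟪x, y⟫ ≤ r}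

theorem polr_inv {T : Set (EucSp 3)} {r : ℝ} (g : EucSp 3 ≃ₗᵢ[ℝ] EucSp 3) (h : g '' T = T) :
    g '' polr T r = polr T r := by
  ext y
  constructor
  · rintro ⟨z, hz, rfl⟩ x hx
    rw [← h] at hx
    obtain ⟨w, hw, rfl⟩ := hx
    rw [g.inner_map_map]
    exact hz w hw
  · intro hy
    refine ⟨g.symm y, fun x hx => ?_, g.apply_symm_apply y⟩
    rw [← g.inner_map_map, g.apply_symm_apply]
    exact hy _ (by rw [← h]; exact ⟨x, hx, rfl⟩)

theorem pos_of_int {T : Set (EucSp 3)} (h0 : (0 : EucSp 3) ∈ interior T) {n : EucSp 3} (hn : n ≠ 0) {M : ℝ}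
    (hM : ∀ x ∈ T, ⟪n, x⟫ ≤ M) : 0 < M := by
  have h1 : ∀ᶠ t : ℝ in nhds 0, t • n ∈ T := by
    have hc : Filter.Tendsto (fun t : ℝ => t • n) (nhds 0) (nhds (0 : EucSp 3)) := by
      have : Continuous (fun t : ℝ => t • n) := by fun_prop
      simpa using this.tendsto 0
    exact hc (mem_interior_iff_mem_nhds.1 h0)
  have h2 : ∀ᶠ t : ℝ in nhdsWithin 0 (Set.Ioi 0), t • n ∈ T ∧ 0 < t :=
    (h1.filter_mono nhdsWithin_le_nhds).and self_mem_nhdsWithin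
  obtain ⟨t, ht, ht0⟩ := h2.exists
  have := hM _ ht
  rw [inner_smul_right] at this
  have h3 : 0 < ⟪n, n⟫ := real_inner_self_pos.2 hn
  have := mul_pos ht0 h3
  linarith

theorem polr_conv (T : Set (EucSp 3)) (r : ℝ) : Convex ℝ (polr T r) := by
  have : polr T r = ⋂ x ∈ T, {y | (innerₛₗ ℝ x) y ≤ r} := by ext y; simp [polr]
  rw [this]
  exact convex_iInter₂ fun x _ => convex_halfSpace_le (innerₛₗ ℝ x).isLinear r

theorem polr_closed (T : Set (EucSp 3)) (r : ℝ) : IsClosed (polr T r) := by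
  have : polr T r = ⋂ x ∈ T, {y | ⟪x, y⟫ ≤ r} := by ext y; simp [polr]
  rw [this]
  refine isClosed_biInter fun x _ => isClosed_le ?_ continuous_const
  fun_prop

theorem polr_hull (S : Set (EucSp 3)) (r : ℝ) : polr (convexHull ℝ S) r = {y | ∀ x ∈ S, ⟪x, y⟫ ≤ r} := by
  ext y
  constructor
  · intro h x hx; exact h x (subset_convexHull ℝ S hx)
  · intro h x hx
    rw [real_inner_comm]
    exact hull_le (innerₛₗ ℝ y) (fun s hs => by show ⟪y, s⟫ ≤ r; rw [real_inner_comm]; exact h s hs) hx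

theorem polr_bdd {T : Set (EucSp 3)} {r : ℝ} (hr : 0 < r) (h0 : (0 : EucSp 3) ∈ interior T) :
    Bornology.IsBounded (polr T r) := by
  obtain ⟨ε, hε, hb⟩ := Metric.mem_nhds_iff.1 (mem_interior_iff_mem_nhds.1 h0)
  rw [isBounded_iff_forall_norm_le]
  refine ⟨2 * r / ε, fun y hy => ?_⟩
  by_cases h : y = 0
  · rw [h, norm_zero]; positivity
  have hn : 0 < ‖y‖ := norm_pos_iff.2 h
  have := hy ((ε / (2 * ‖y‖)) • y) (hb (by
    rw [mem_ball_zero_iff, norm_smul, Real.norm_of_nonneg (by positivity)]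
    field_simp
    linarith))
  rw [inner_smul_left, real_inner_self_eq_norm_sq] at this
  simp only [conj_trivial] at this
  rw [le_div_iff₀ hε]
  have e : ε / (2 * ‖y‖) * ‖y‖ ^ 2 = ε * ‖y‖ / 2 := by field_simp
  rw [e] at this
  linarith

theorem polr_int {T : Set (EucSp 3)} {r : ℝ} (hr : 0 < r) (hT : Bornology.IsBounded T) :
    (0 : EucSp 3) ∈ interior (polr T r) := by
  obtain ⟨R, hR, hb⟩ := hT.exists_pos_norm_le
  rw [mem_interior_iff_mem_nhds, Metric.mem_nhds_iff]
  refine ⟨r / R, by positivity, fun y hy x hx => ?_⟩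
  rw [mem_ball_zero_iff, lt_div_iff₀ hR] at hy
  have h1 := real_inner_le_norm x y
  have h2 := mul_le_mul_of_nonneg_right (hb x hx) (norm_nonneg y)
  linarith

theorem bipolar {T : Set (EucSp 3)} {r : ℝ} (hr : 0 < r) (h0 : (0 : EucSp 3) ∈ T) (hc : Convex ℝ T)
    (hcl : IsClosed T) {x : EucSp 3} (hx : ∀ y ∈ polr T r, ⟪x, y⟫ ≤ r) : x ∈ T := by
  by_contra hxT
  obtain ⟨f, u, h1, h2⟩ := geometric_hahn_banach_closed_point hc hcl hxT
  obtain ⟨m, rfl⟩ := (InnerProductSpace.toDual ℝ (EucSp 3)).surjective f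
  simp only [InnerProductSpace.toDual_apply_apply] at h1 h2
  have hu : 0 < u := by simpa using h1 0 h0
  have := hx ((r / u) • m) (fun z hz => by
    have := h1 z hz
    rw [inner_smul_right, real_inner_comm, div_mul_eq_mul_div, div_le_iff₀ hu]
    nlinarith)
  rw [inner_smul_right, real_inner_comm, div_mul_eq_mul_div, div_le_iff₀ hu] at this
  nlinarith

/-- extreme points of a polar polytope are finite in number -/
theorem polr_ext_finite {S : Set (EucSp 3)} (fS : S.Finite) (r : ℝ) :
    ((polr (convexHull ℝ S) r).extremePoints ℝ).Finite := by
  set Q := polr (convexHull ℝ S) r with hQ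
  have hQ' : Q = {y | ∀ x ∈ S, ⟪x, y⟫ ≤ r} := polr_hull S r
  have : (Q.extremePoints ℝ).InjOn (fun y => {s | s ∈ S ∧ ⟪s, y⟫ = r}) := by
    intro y hy z hz e
    by_contra hne
    have hyQ : y ∈ Q := hy.1
    have hzQ : z ∈ Q := hz.1
    rw [hQ'] at hyQ hzQ
    have h1 : ∀ᶠ t : ℝ in nhdsWithin 0 (Set.Ioi 0), (∀ s ∈ S, ⟪s, y + t • (y - z)⟫ ≤ r) ∧ 0 < t := by
      refine Filter.Eventually.and ?_ self_mem_nhdsWithin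
      rw [Filter.eventually_all_finite fS]
      intro s hs
      rcases (hyQ s hs).lt_or_eq with h | h
      · apply Filter.Eventually.filter_mono nhdsWithin_le_nhds
        have hc : Continuous (fun t : ℝ => ⟪s, y + t • (y - z)⟫) := by fun_prop
        have := (hc.tendsto 0).eventually_lt_const (u := r) (by simpa using h)
        exact this.mono fun t ht => ht.le
      · have h' : ⟪s, z⟫ = r := by
          have : s ∈ {s | s ∈ S ∧ ⟪s, y⟫ = r} := ⟨hs, h⟩
          have e' : {s | s ∈ S ∧ ⟪s, y⟫ = r} = {s | s ∈ S ∧ ⟪s, z⟫ = r} := e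
          rw [e'] at this
          exact this.2
        refine Filter.Eventually.of_forall fun t => ?_
        rw [inner_add_right, inner_smul_right, inner_sub_right, h, h']
        simp
    obtain ⟨t, ht, ht0⟩ := h1.exists
    have hw : y + t • (y - z) ∈ Q := by rw [hQ']; exact ht
    have hseg : y ∈ openSegment ℝ (y + t • (y - z)) z := by
      refine ⟨1 / (1 + t), t / (1 + t), by positivity, by positivity, by field_simp, ?_⟩
      have : (1 + t) ≠ 0 := by positivity
      rw [smul_add, smul_smul, smul_sub]
      have e1 : (1 / (1 + t)) • y + ((1 / (1 + t) * t) • y - (1 / (1 + t) * t) • z) + (t / (1 + t)) • z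
        = (1 / (1 + t) + 1 / (1 + t) * t) • y + (t / (1 + t) - 1 / (1 + t) * t) • z := by module
      rw [e1]
      have e2 : 1 / (1 + t) + 1 / (1 + t) * t = 1 := by field_simp
      have e3 : t / (1 + t) - 1 / (1 + t) * t = 0 := by field_simp; ring
      rw [e2, e3]; simp
    have h3 := mem_extremePoints.1 hy
    exact hne (h3.2 _ hw z hz.1 hseg).2.symm
  refine Set.Finite.of_finite_image (Set.Finite.subset fS.finite_subsets ?_) this
  rintro _ ⟨y, -, rfl⟩ s hs
  exact hs.1

theorem exists_normal {T F : Set (EucSp 3)} (h0 : (0 : EucSp 3) ∈ interior T) (hF : IsExposed ℝ T F) (hne : F ≠ T)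
    {r : ℝ} (hr : 0 < r) : ∃ y : EucSp 3, y ∈ polr T r ∧ F = {x | x ∈ T ∧ ⟪x, y⟫ = r} := by
  rcases F.eq_empty_or_nonempty with rfl | ⟨x1, hx1⟩
  · refine ⟨0, fun x _ => by simp [hr.le], ?_⟩
    symm
    rw [Set.eq_empty_iff_forall_notMem]
    rintro x ⟨-, h⟩
    rw [inner_zero_right] at h
    exact hr.ne h
  · obtain ⟨n, e, hM⟩ := face_inner hF hx1
    generalize hMM : ⟪n, x1⟫ = M at *
    have hn : n ≠ 0 := by
      rintro rfl
      apply hne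
      rw [e, ← hMM]
      ext x; simp
    have hM0 := pos_of_int h0 hn hM
    refine ⟨(r / M) • n, fun x hx => ?_, ?_⟩
    · rw [inner_smul_right, real_inner_comm, div_mul_eq_mul_div, div_le_iff₀ hM0]
      exact mul_le_mul_of_nonneg_left (hM x hx) hr.le
    · rw [e]
      ext x
      refine and_congr Iff.rfl ?_
      rw [inner_smul_right, real_inner_comm, div_mul_eq_mul_div, div_eq_iff hM0.ne']
      exact (mul_right_inj' hr.ne').symm

theorem polr_dp {S T : Set (EucSp 3)} (fS : S.Finite) (hT : T = convexHull ℝ S) (h0 : (0 : EucSp 3) ∈ interior T)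
    {r : ℝ} (hr : 0 < r) : DP T (polr T r) r ∧ IsConvexPolytope (polr T r) := by
  have hcl : IsClosed T := by rw [hT]; exact fS.isClosed_convexHull ℝ
  have hcv : Convex ℝ T := by rw [hT]; exact convex_convexHull ℝ S
  have hbd : Bornology.IsBounded T := by rw [hT]; exact isBounded_convexHull.2 fS.isBounded
  have hQ0 : (0 : EucSp 3) ∈ interior (polr T r) := polr_int hr hbd
  have fE : ((polr T r).extremePoints ℝ).Finite := by rw [hT]; exact polr_ext_finite fS r
  have hQc : polr T r = convexHull ℝ ((polr T r).extremePoints ℝ) := by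
    have hk : IsCompact (polr T r) := Metric.isCompact_of_isClosed_isBounded (polr_closed T r) (polr_bdd hr h0)
    have := closure_convexHull_extremePoints hk (polr_conv T r)
    rw [(fE.isClosed_convexHull ℝ).closure_eq] at this
    exact this.symm
  refine ⟨⟨⟨S, fS, hT⟩, ⟨_, fE, hQc⟩, fun x hx y hy => hy x hx, ?_, ?_⟩, ⟨⟨fE.toFinset, ?_⟩, ⟨0, hQ0⟩⟩⟩
  · intro F hF hne
    exact exists_normal h0 hF hne hr
  · intro F hF hne
    obtain ⟨x, hx, e⟩ := exists_normal hQ0 hF hne hr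
    refine ⟨x, bipolar hr (interior_subset h0) hcv hcl (fun y hy => ?_), ?_⟩
    · rw [real_inner_comm]; exact hx y hy
    · rw [e]; ext y; simp [real_inner_comm]
  · rw [Set.Finite.coe_toFinset]; exact hQc

/-- a symmetric criterion for an interior point -/
theorem zero_int {S T : Set (EucSp 3)} (fS : S.Finite) (hT : T = convexHull ℝ S) {a : ℝ} (ha : 0 < a)
    (h : ∀ i, (EuclideanSpace.single i a ∈ T) ∧ EuclideanSpace.single i (-a) ∈ T) : (0 : EucSp 3) ∈ interior T := by
  have hcl : IsClosed T := by rw [hT]; exact fS.isClosed_convexHull ℝ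
  have hcv : Convex ℝ T := by rw [hT]; exact convex_convexHull ℝ S
  rw [mem_interior_iff_mem_nhds, Metric.mem_nhds_iff]
  refine ⟨a / 3, by positivity, fun x hx => ?_⟩
  rw [mem_ball_zero_iff] at hx
  by_contra hxT
  obtain ⟨f, u, h1, h2⟩ := geometric_hahn_banach_closed_point hcv hcl hxT
  obtain ⟨m, rfl⟩ := (InnerProductSpace.toDual ℝ (EucSp 3)).surjective f
  simp only [InnerProductSpace.toDual_apply_apply] at h1 h2
  have k : ∀ i, a * |m i| < u := by
    intro i
    have p1 := h1 _ (h i).1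
    have p2 := h1 _ (h i).2
    rw [EuclideanSpace.inner_single_right] at p1 p2
    simp only [conj_trivial] at p1 p2
    rcases abs_cases (m i) with ⟨e, -⟩ | ⟨e, -⟩ <;> rw [e] <;> linarith
  have kx : ∀ i, |x i| ≤ a / 3 := fun i => (by
    have := PiLp.norm_apply_le x i
    rw [Real.norm_eq_abs] at this
    linarith)
  have e : ⟪m, x⟫ = ∑ i, x i * m i := by
    rw [PiLp.inner_apply]; simp
  rw [e, Fin.sum_univ_three] at h2
  have kk : ∀ i, x i * m i ≤ u / 3 := by
    intro i
    have q1 : x i * m i ≤ |x i| * |m i| := by rw [← abs_mul]; exact le_abs_self _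
    have q2 : |x i| * |m i| ≤ a / 3 * |m i| := mul_le_mul_of_nonneg_right (kx i) (abs_nonneg _)
    have := k i
    linarith
  have := kk 0
  have := kk 1
  have := kk 2
  linarith

open scoped Classical RealInnerProductSpace

/-! ### Coordinates -/

theorem pt3_zero (a b c : ℝ) : pt3 a b c 0 = a := rfl
theorem pt3_one (a b c : ℝ) : pt3 a b c 1 = b := rfl
theorem pt3_two (a b c : ℝ) : pt3 a b c 2 = c := rfl

theorem pt3_eta (x : EucSp 3) : pt3 (x 0) (x 1) (x 2) = x := by
  ext i
  fin_cases i <;> rfl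

theorem pt3_surj (x : EucSp 3) : ∃ a b c, x = pt3 a b c := ⟨_, _, _, (pt3_eta x).symm⟩

theorem pt3_congr {a b c a' b' c' : ℝ} (h : a = a') (h' : b = b') (h'' : c = c') : pt3 a b c = pt3 a' b' c' := by
  rw [h, h', h'']

theorem pt3_inner (a b c a' b' c' : ℝ) : ⟪pt3 a b c, pt3 a' b' c'⟫ = a * a' + b * b' + c * c' := by
  rw [PiLp.inner_apply, Fin.sum_univ_three]
  simp [pt3_zero, pt3_one, pt3_two]
  ring

theorem pt3_single (a : ℝ) : EuclideanSpace.single (0 : Fin 3) a = pt3 a 0 0 ∧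
    EuclideanSpace.single (1 : Fin 3) a = pt3 0 a 0 ∧ EuclideanSpace.single (2 : Fin 3) a = pt3 0 0 a := by
  refine ⟨?_, ?_, ?_⟩ <;> (ext i; fin_cases i <;> simp [pt3])

theorem pt3_add (a b c a' b' c' : ℝ) : pt3 a b c + pt3 a' b' c' = pt3 (a + a') (b + b') (c + c') := by
  ext i; fin_cases i <;> simp [pt3]

theorem pt3_smul (t a b c : ℝ) : t • pt3 a b c = pt3 (t * a) (t * b) (t * c) := by
  ext i; fin_cases i <;> simp [pt3]

theorem pt3_finite {C : Set ℝ} (hC : C.Finite) : {x | ∃ a ∈ C, ∃ b ∈ C, ∃ c ∈ C, x = pt3 a b c}.Finite := by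
  refine ((hC.prod (hC.prod hC)).image (fun p : ℝ × ℝ × ℝ => pt3 p.1 p.2.1 p.2.2)).subset ?_
  rintro _ ⟨a, ha, b, hb, c, hc, rfl⟩
  exact ⟨(a, b, c), ⟨ha, hb, hc⟩, rfl⟩

/-- linear isometries of order two from symmetric matrices -/
theorem exists_refl (a b c d e f : ℝ) (h1 : a * a + b * b + c * c = 1) (h2 : b * b + d * d + e * e = 1)
    (h3 : c * c + e * e + f * f = 1) (h4 : a * b + b * d + c * e = 0) (h5 : a * c + b * e + c * f = 0)
    (h6 : b * c + d * e + e * f = 0) :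
    ∃ R : EucSp 3 ≃ₗᵢ[ℝ] EucSp 3,
      (∀ x y z, R (pt3 x y z) = pt3 (a * x + b * y + c * z) (b * x + d * y + e * z) (c * x + e * y + f * z)) ∧
      ∀ x, R (R x) = x := by
  let L : EucSp 3 →ₗ[ℝ] EucSp 3 :=
    { toFun := fun v => pt3 (a * v 0 + b * v 1 + c * v 2) (b * v 0 + d * v 1 + e * v 2) (c * v 0 + e * v 1 + f * v 2)
      map_add' := fun v w => by
        rw [pt3_add]
        apply pt3_congr <;> simp only [PiLp.add_apply] <;> ring
      map_smul' := fun t v => by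
        rw [pt3_smul]
        apply pt3_congr <;> simp only [PiLp.smul_apply, smul_eq_mul, RingHom.id_apply] <;> ring }
  have hL : ∀ x y z, L (pt3 x y z) = pt3 (a * x + b * y + c * z) (b * x + d * y + e * z) (c * x + e * y + f * z) :=
    fun x y z => rfl
  have hLL : ∀ v, L (L v) = v := by
    intro v
    obtain ⟨x, y, z, rfl⟩ := pt3_surj v
    rw [hL, hL]
    apply pt3_congr
    · linear_combination x * h1 + y * h4 + z * h5
    · linear_combination x * h4 + y * h2 + z * h6
    · linear_combination x * h5 + y * h6 + z * h3
  have hn : ∀ v, ‖L v‖ = ‖v‖ := by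
    intro v
    obtain ⟨x, y, z, rfl⟩ := pt3_surj v
    rw [← sq_eq_sq₀ (norm_nonneg _) (norm_nonneg _), ← real_inner_self_eq_norm_sq, ← real_inner_self_eq_norm_sq,
      hL, pt3_inner, pt3_inner]
    linear_combination x * x * h1 + y * y * h2 + z * z * h3 + 2 * x * y * h4 + 2 * x * z * h5 + 2 * y * z * h6
  let Le : EucSp 3 ≃ₗ[ℝ] EucSp 3 := LinearEquiv.ofInvolutive L hLL
  exact ⟨⟨Le, hn⟩, hL, hLL⟩

/-! ### The cuboctahedron and the rhombic dodecahedron -/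

theorem cubo_finite : cuboctaVerts.Finite := by
  refine (pt3_finite (C := {0, 1, -1}) (by simp)).subset ?_
  rintro x ⟨ε, δ, hε, hδ, h⟩
  rcases h with rfl | rfl | rfl
  · exact ⟨ε, by simp [hε], δ, by simp [hδ], 0, by simp, rfl⟩
  · exact ⟨ε, by simp [hε], 0, by simp, δ, by simp [hδ], rfl⟩
  · exact ⟨0, by simp, ε, by simp [hε], δ, by simp [hδ], rfl⟩

theorem cubo_mem1 {a b : ℝ} (ha : a = 1 ∨ a = -1) (hb : b = 1 ∨ b = -1) : pt3 a b 0 ∈ cuboctaVerts :=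
  ⟨a, b, ha, hb, Or.inl rfl⟩
theorem cubo_mem2 {a b : ℝ} (ha : a = 1 ∨ a = -1) (hb : b = 1 ∨ b = -1) : pt3 a 0 b ∈ cuboctaVerts :=
  ⟨a, b, ha, hb, Or.inr (Or.inl rfl)⟩
theorem cubo_mem3 {a b : ℝ} (ha : a = 1 ∨ a = -1) (hb : b = 1 ∨ b = -1) : pt3 0 a b ∈ cuboctaVerts :=
  ⟨a, b, ha, hb, Or.inr (Or.inr rfl)⟩

theorem cubo_int : (0 : EucSp 3) ∈ interior Cuboctahedron := by
  refine zero_int cubo_finite (T := Cuboctahedron) rfl one_pos ?_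
  have mid : ∀ x y : EucSp 3, x ∈ cuboctaVerts → y ∈ cuboctaVerts → (1 / 2 : ℝ) • x + (1 / 2 : ℝ) • y ∈ Cuboctahedron :=
    fun x y hx hy => (convex_convexHull ℝ cuboctaVerts) (subset_convexHull ℝ _ hx) (subset_convexHull ℝ _ hy)
      (by norm_num) (by norm_num) (by norm_num)
  have k : ∀ a : ℝ, (a = 1 ∨ a = -1) → pt3 a 0 0 ∈ Cuboctahedron ∧ pt3 0 a 0 ∈ Cuboctahedron ∧
      pt3 0 0 a ∈ Cuboctahedron := by
    intro a ha
    refine ⟨?_, ?_, ?_⟩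
    · have := mid _ _ (cubo_mem1 ha (Or.inl rfl)) (cubo_mem1 ha (Or.inr rfl))
      rw [pt3_smul, pt3_smul, pt3_add] at this
      convert this using 2 <;> ring
    · have := mid _ _ (cubo_mem3 ha (Or.inl rfl)) (cubo_mem3 ha (Or.inr rfl))
      rw [pt3_smul, pt3_smul, pt3_add] at this
      convert this using 2 <;> ring
    · have := mid _ _ (cubo_mem3 (Or.inl rfl) ha) (cubo_mem3 (Or.inr rfl) ha)
      rw [pt3_smul, pt3_smul, pt3_add] at this
      convert this using 2 <;> ring
  have k1 := k 1 (Or.inl rfl)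
  have k2 := k (-1) (Or.inr rfl)
  intro i
  have s1 := pt3_single 1
  have s2 := pt3_single (-1)
  fin_cases i
  · exact ⟨s1.1 ▸ k1.1, s2.1 ▸ k2.1⟩
  · exact ⟨s1.2.1 ▸ k1.2.1, s2.2.1 ▸ k2.2.1⟩
  · exact ⟨s1.2.2 ▸ k1.2.2, s2.2.2 ▸ k2.2.2⟩

theorem poly_of_verts {S : Set (EucSp 3)} (fS : S.Finite) (h : (0 : EucSp 3) ∈ interior (convexHull ℝ S)) :
    IsConvexPolytope (convexHull ℝ S) :=
  ⟨⟨fS.toFinset, by rw [fS.coe_toFinset]⟩, ⟨0, h⟩⟩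

theorem cubo_model {ρ : Faces Cuboctahedron → ℕ} (H : PPoset (Faces Cuboctahedron) ρ 4) :
    ∃ Φ Φ', Model Cuboctahedron ρ H Φ Φ' 4 := by
  obtain ⟨A, hA, iA⟩ := exists_refl 1 0 0 0 1 0 (by norm_num) (by norm_num) (by norm_num) (by norm_num) (by norm_num)
    (by norm_num)
  obtain ⟨B, hB, iB⟩ := exists_refl 0 1 0 0 0 1 (by norm_num) (by norm_num) (by norm_num) (by norm_num) (by norm_num)
    (by norm_num)
  obtain ⟨C, hC, iC⟩ := exists_refl 1 0 0 1 0 (-1) (by norm_num) (by norm_num) (by norm_num) (by norm_num)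
    (by norm_num) (by norm_num)
  have hA' : ∀ x y z, A (pt3 x y z) = pt3 x z y := fun x y z => by rw [hA]; apply pt3_congr <;> ring
  have hB' : ∀ x y z, B (pt3 x y z) = pt3 y x z := fun x y z => by rw [hB]; apply pt3_congr <;> ring
  have hC' : ∀ x y z, C (pt3 x y z) = pt3 x y (-z) := fun x y z => by rw [hC]; apply pt3_congr <;> ring
  have neg : ∀ a : ℝ, (a = 1 ∨ a = -1) → (-a = 1 ∨ -a = -1) := by
    rintro a (rfl | rfl) <;> norm_num
  refine geo_model (S := cuboctaVerts) rfl H A B C ?_ ?_ ?_ iA iB iC (Or.inl rfl) ?_ ?_ ?_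
    (p0 := pt3 1 1 0) (p1 := pt3 1 0 1) (p2 := pt3 0 1 1) (p3 := pt3 1 0 (-1)) (nF := pt3 1 1 1) (nG := pt3 1 0 0)
    (N := 2) (MF := 2) (MG := 1) (cubo_mem1 (Or.inl rfl) (Or.inl rfl)) (cubo_mem2 (Or.inl rfl) (Or.inl rfl))
    ?_ ?_ ?_ ?_ ?_ ?_ ?_ ?_ ?_ ?_ ?_ ?_ ?_ ?_ ?_ ?_ ?_ ?_ ?_
  · rintro _ ⟨ε, δ, hε, hδ, rfl | rfl | rfl⟩ <;> rw [hA']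
    · exact cubo_mem2 hε hδ
    · exact cubo_mem1 hε hδ
    · exact cubo_mem3 hδ hε
  · rintro _ ⟨ε, δ, hε, hδ, rfl | rfl | rfl⟩ <;> rw [hB']
    · exact cubo_mem1 hδ hε
    · exact cubo_mem3 hε hδ
    · exact cubo_mem2 hε hδ
  · rintro _ ⟨ε, δ, hε, hδ, rfl | rfl | rfl⟩ <;> rw [hC']
    · rw [neg_zero]; exact cubo_mem1 hε hδ
    · exact cubo_mem2 hε (neg _ hδ)
    · exact cubo_mem3 hε (neg _ hδ)
  · intro v
    obtain ⟨x, y, z, rfl⟩ := pt3_surj v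
    simp only [Function.iterate_succ, Function.iterate_zero, Function.comp_apply, id, hA', hB']
  · intro v
    obtain ⟨x, y, z, rfl⟩ := pt3_surj v
    simp only [Function.iterate_succ, Function.iterate_zero, Function.comp_apply, id, hA', hC', neg_neg]
  · intro v
    obtain ⟨x, y, z, rfl⟩ := pt3_surj v
    simp only [Function.iterate_succ, Function.iterate_zero, Function.comp_apply, id, hB', hC', neg_neg]
  · rintro _ ⟨ε, δ, rfl | rfl, rfl | rfl, rfl | rfl | rfl⟩ <;> rw [pt3_inner] <;> norm_num
  · rintro _ ⟨ε, δ, rfl | rfl, rfl | rfl, rfl | rfl | rfl⟩ <;> rw [pt3_inner] <;> norm_num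
  · rintro _ ⟨ε, δ, rfl | rfl, rfl | rfl, rfl | rfl | rfl⟩ <;> rw [pt3_inner] <;> norm_num
  · intro h
    have := congrArg (fun v : EucSp 3 => v 1) h
    simp only [pt3_one] at this
    norm_num at this
  all_goals first
    | (rw [pt3_inner]; norm_num; done)
    | (rw [hA']; done)
    | (rw [hB']; done)
    | (rw [hC', neg_zero]; done)
    | (rw [hC']; done)

theorem rd_eq : RhombicDodecahedron = polr Cuboctahedron 2 := by
  have hp : polr Cuboctahedron 2 = {y | ∀ x ∈ cuboctaVerts, ⟪x, y⟫ ≤ 2} := polr_hull _ _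
  have fin : rhombicDodecaVerts.Finite := by
    refine (pt3_finite (C := {0, 1, -1, 2, -2}) (by simp)).subset ?_
    rintro x (⟨ε₁, ε₂, ε₃, h1, h2, h3, rfl⟩ | ⟨ε, h, rfl | rfl | rfl⟩)
    · exact ⟨ε₁, by rcases h1 with h | h <;> simp [h], ε₂, by rcases h2 with h | h <;> simp [h], ε₃,
        by rcases h3 with h | h <;> simp [h], rfl⟩
    · exact ⟨ε, by rcases h with h | h <;> simp [h], 0, by simp, 0, by simp, rfl⟩
    · exact ⟨0, by simp, ε, by rcases h with h | h <;> simp [h], 0, by simp, rfl⟩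
    · exact ⟨0, by simp, 0, by simp, ε, by rcases h with h | h <;> simp [h], rfl⟩
  apply Set.Subset.antisymm
  · refine convexHull_min ?_ (polr_conv _ _)
    rw [hp]
    rintro _ (⟨ε₁, ε₂, ε₃, h1, h2, h3, rfl⟩ | ⟨ε, h, rfl | rfl | rfl⟩) _ ⟨a, b, ha, hb, rfl | rfl | rfl⟩ <;>
      rw [pt3_inner]
    · rcases h1 with rfl | rfl <;> rcases h2 with rfl | rfl <;> rcases ha with rfl | rfl <;>
        rcases hb with rfl | rfl <;> norm_num
    · rcases h1 with rfl | rfl <;> rcases h3 with rfl | rfl <;> rcases ha with rfl | rfl <;>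
        rcases hb with rfl | rfl <;> norm_num
    · rcases h2 with rfl | rfl <;> rcases h3 with rfl | rfl <;> rcases ha with rfl | rfl <;>
        rcases hb with rfl | rfl <;> norm_num
    all_goals rcases h with rfl | rfl <;> rcases ha with rfl | rfl <;> rcases hb with rfl | rfl <;> norm_num
  · intro y hy
    by_contra hyn
    obtain ⟨f, u, h1, h2⟩ := geometric_hahn_banach_closed_point (convex_convexHull ℝ rhombicDodecaVerts)
      (fin.isClosed_convexHull ℝ) hyn
    obtain ⟨m, rfl⟩ := (InnerProductSpace.toDual ℝ (EucSp 3)).surjective f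
    simp only [InnerProductSpace.toDual_apply_apply] at h1 h2
    obtain ⟨m0, m1, m2, rfl⟩ := pt3_surj m
    obtain ⟨y0, y1, y2, rfl⟩ := pt3_surj y
    rw [hp] at hy
    have sg : ∀ t : ℝ, ∃ s : ℝ, (s = 1 ∨ s = -1) ∧ s * t = |t| := by
      intro t
      rcases abs_cases t with ⟨h, -⟩ | ⟨h, -⟩
      · exact ⟨1, Or.inl rfl, by rw [h]; ring⟩
      · exact ⟨-1, Or.inr rfl, by rw [h]; ring⟩
    have sg2 : ∀ t : ℝ, ∃ s : ℝ, (s = 2 ∨ s = -2) ∧ s * t = 2 * |t| := by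
      intro t
      rcases abs_cases t with ⟨h, -⟩ | ⟨h, -⟩
      · exact ⟨2, Or.inl rfl, by rw [h]⟩
      · exact ⟨-2, Or.inr rfl, by rw [h]; ring⟩
    rw [pt3_inner] at h2
    obtain ⟨s0, hs0, e0⟩ := sg m0
    obtain ⟨s1, hs1, e1⟩ := sg m1
    obtain ⟨s2, hs2, e2⟩ := sg m2
    obtain ⟨t0, ht0, f0⟩ := sg2 m0
    obtain ⟨t1, ht1, f1⟩ := sg2 m1
    obtain ⟨t2, ht2, f2⟩ := sg2 m2
    obtain ⟨a0, ha0, g0⟩ := sg y0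
    obtain ⟨a1, ha1, g1⟩ := sg y1
    obtain ⟨a2, ha2, g2⟩ := sg y2
    have q := h1 _ (subset_convexHull ℝ _ (Or.inl ⟨s0, s1, s2, hs0, hs1, hs2, rfl⟩))
    have q0 := h1 _ (subset_convexHull ℝ _ (Or.inr ⟨t0, ht0, Or.inl rfl⟩))
    have q1 := h1 _ (subset_convexHull ℝ _ (Or.inr ⟨t1, ht1, Or.inr (Or.inl rfl)⟩))
    have q2 := h1 _ (subset_convexHull ℝ _ (Or.inr ⟨t2, ht2, Or.inr (Or.inr rfl)⟩))
    have r0 := hy _ (cubo_mem1 ha0 ha1)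
    have r1 := hy _ (cubo_mem2 ha0 ha2)
    have r2 := hy _ (cubo_mem3 ha1 ha2)
    rw [pt3_inner] at q q0 q1 q2 r0 r1 r2
    have w0 : m0 * y0 ≤ |m0| * |y0| := by rw [← abs_mul]; exact le_abs_self _
    have w1 : m1 * y1 ≤ |m1| * |y1| := by rw [← abs_mul]; exact le_abs_self _
    have w2 : m2 * y2 ≤ |m2| * |y2| := by rw [← abs_mul]; exact le_abs_self _
    have core : ∀ a b c x y z : ℝ, 0 ≤ a → 0 ≤ b → 0 ≤ c → 0 ≤ x → 0 ≤ y → 0 ≤ z → x + y ≤ 2 → x + z ≤ 2 →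
        a + b + c < u → 2 * a < u → 1 ≤ x → a * x + b * y + c * z ≤ u := by
      intro a b c x y z a0 b0 c0 x0 y0 z0 h1 h2 h3 h4 h5
      have k1 : b * y ≤ b * (2 - x) := mul_le_mul_of_nonneg_left (by linarith) b0
      have k2 : c * z ≤ c * (2 - x) := mul_le_mul_of_nonneg_left (by linarith) c0
      have k3 : 0 ≤ (u - (a + b + c)) * (2 - x) := mul_nonneg (by linarith) (by linarith)
      have k4 : 0 ≤ (u - 2 * a) * (x - 1) := mul_nonneg (by linarith) (by linarith)
      nlinarith
    have p0 := abs_nonneg m0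
    have p1 := abs_nonneg m1
    have p2 := abs_nonneg m2
    have n0 := abs_nonneg y0
    have n1 := abs_nonneg y1
    have n2 := abs_nonneg y2
    generalize |m0| = A0 at *
    generalize |m1| = A1 at *
    generalize |m2| = A2 at *
    generalize |y0| = B0 at *
    generalize |y1| = B1 at *
    generalize |y2| = B2 at *
    have fin3 : A0 * B0 + A1 * B1 + A2 * B2 ≤ u := by
      by_cases c0 : 1 ≤ B0
      · exact core A0 A1 A2 B0 B1 B2 p0 p1 p2 n0 n1 n2 (by linarith) (by linarith) (by linarith) (by linarith) c0
      by_cases c1 : 1 ≤ B1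
      · have := core A1 A0 A2 B1 B0 B2 p1 p0 p2 n1 n0 n2 (by linarith) (by linarith) (by linarith) (by linarith) c1
        linarith
      by_cases c2 : 1 ≤ B2
      · have := core A2 A0 A1 B2 B0 B1 p2 p0 p1 n2 n0 n1 (by linarith) (by linarith) (by linarith) (by linarith) c2
        linarith
      have k0 : A0 * B0 ≤ A0 * 1 := mul_le_mul_of_nonneg_left (by linarith) p0
      have k1 : A1 * B1 ≤ A1 * 1 := mul_le_mul_of_nonneg_left (by linarith) p1
      have k2 : A2 * B2 ≤ A2 * 1 := mul_le_mul_of_nonneg_left (by linarith) p2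
      linarith
    linarith

open scoped Classical RealInnerProductSpace

/-! ### The icosidodecahedron -/

theorem gphi_sq : goldenφ * goldenφ = goldenφ + 1 := by
  have h : Real.sqrt 5 * Real.sqrt 5 = 5 := Real.mul_self_sqrt (by norm_num)
  unfold goldenφ
  linear_combination (1 / 4) * h

theorem gphi_lt : 3 / 2 < goldenφ ∧ goldenφ < 2 := by
  have h1 : (2 : ℝ) < Real.sqrt 5 := by
    rw [Real.lt_sqrt (by norm_num)]; norm_num
  have h2 : Real.sqrt 5 < 3 := by
    rw [Real.sqrt_lt' (by norm_num)]; norm_num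
  unfold goldenφ
  constructor <;> linarith

theorem gphi_sq' : goldenφ ^ 2 = goldenφ + 1 := by rw [sq, gphi_sq]

theorem icosi_m1 {a : ℝ} (ha : a = 1 ∨ a = -1) : pt3 0 0 (a * goldenφ) ∈ icosidodecaVerts :=
  Or.inl ⟨a, ha, Or.inl rfl⟩
theorem icosi_m2 {a : ℝ} (ha : a = 1 ∨ a = -1) : pt3 (a * goldenφ) 0 0 ∈ icosidodecaVerts :=
  Or.inl ⟨a, ha, Or.inr (Or.inl rfl)⟩
theorem icosi_m3 {a : ℝ} (ha : a = 1 ∨ a = -1) : pt3 0 (a * goldenφ) 0 ∈ icosidodecaVerts :=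
  Or.inl ⟨a, ha, Or.inr (Or.inr rfl)⟩
theorem icosi_m4 {a b c : ℝ} (ha : a = 1 ∨ a = -1) (hb : b = 1 ∨ b = -1) (hc : c = 1 ∨ c = -1) :
    pt3 (a / 2) (b * goldenφ / 2) (c * (goldenφ + 1) / 2) ∈ icosidodecaVerts := by
  rw [← gphi_sq']
  exact Or.inr ⟨a, b, c, ha, hb, hc, Or.inl rfl⟩
theorem icosi_m5 {a b c : ℝ} (ha : a = 1 ∨ a = -1) (hb : b = 1 ∨ b = -1) (hc : c = 1 ∨ c = -1) :
    pt3 (c * (goldenφ + 1) / 2) (a / 2) (b * goldenφ / 2) ∈ icosidodecaVerts := by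
  rw [← gphi_sq']
  exact Or.inr ⟨a, b, c, ha, hb, hc, Or.inr (Or.inl rfl)⟩
theorem icosi_m6 {a b c : ℝ} (ha : a = 1 ∨ a = -1) (hb : b = 1 ∨ b = -1) (hc : c = 1 ∨ c = -1) :
    pt3 (b * goldenφ / 2) (c * (goldenφ + 1) / 2) (a / 2) ∈ icosidodecaVerts := by
  rw [← gphi_sq']
  exact Or.inr ⟨a, b, c, ha, hb, hc, Or.inr (Or.inr rfl)⟩

theorem icosi_cases {P : EucSp 3 → Prop}
    (h1 : ∀ a : ℝ, (a = 1 ∨ a = -1) → P (pt3 0 0 (a * goldenφ)))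
    (h2 : ∀ a : ℝ, (a = 1 ∨ a = -1) → P (pt3 (a * goldenφ) 0 0))
    (h3 : ∀ a : ℝ, (a = 1 ∨ a = -1) → P (pt3 0 (a * goldenφ) 0))
    (h4 : ∀ a b c : ℝ, (a = 1 ∨ a = -1) → (b = 1 ∨ b = -1) → (c = 1 ∨ c = -1) →
      P (pt3 (a / 2) (b * goldenφ / 2) (c * (goldenφ + 1) / 2)))
    (h5 : ∀ a b c : ℝ, (a = 1 ∨ a = -1) → (b = 1 ∨ b = -1) → (c = 1 ∨ c = -1) →
      P (pt3 (c * (goldenφ + 1) / 2) (a / 2) (b * goldenφ / 2)))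
    (h6 : ∀ a b c : ℝ, (a = 1 ∨ a = -1) → (b = 1 ∨ b = -1) → (c = 1 ∨ c = -1) →
      P (pt3 (b * goldenφ / 2) (c * (goldenφ + 1) / 2) (a / 2))) :
    ∀ x ∈ icosidodecaVerts, P x := by
  rintro x (⟨a, ha, rfl | rfl | rfl⟩ | ⟨a, b, c, ha, hb, hc, rfl | rfl | rfl⟩)
  · exact h1 a ha
  · exact h2 a ha
  · exact h3 a ha
  · rw [gphi_sq']; exact h4 a b c ha hb hc
  · rw [gphi_sq']; exact h5 a b c ha hb hc
  · rw [gphi_sq']; exact h6 a b c ha hb hc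

theorem icosi_finite : icosidodecaVerts.Finite := by
  refine (pt3_finite (C := {0, 1 * goldenφ, (-1) * goldenφ, 1 / 2, (-1) / 2, 1 * goldenφ / 2, (-1) * goldenφ / 2,
    1 * (goldenφ + 1) / 2, (-1) * (goldenφ + 1) / 2}) (by simp)).subset ?_
  apply icosi_cases (P := fun x => x ∈ {x | ∃ a ∈ _, ∃ b ∈ _, ∃ c ∈ _, x = pt3 a b c})
  · rintro a ha
    exact ⟨_, by simp, _, by simp, _, by rcases ha with rfl | rfl <;> simp, rfl⟩
  · rintro a ha
    exact ⟨_, by rcases ha with rfl | rfl <;> simp, _, by simp, _, by simp, rfl⟩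
  · rintro a ha
    exact ⟨_, by simp, _, by rcases ha with rfl | rfl <;> simp, _, by simp, rfl⟩
  · rintro a b c ha hb hc
    exact ⟨_, by rcases ha with rfl | rfl <;> simp, _, by rcases hb with rfl | rfl <;> simp, _,
      by rcases hc with rfl | rfl <;> simp, rfl⟩
  · rintro a b c ha hb hc
    exact ⟨_, by rcases hc with rfl | rfl <;> simp, _, by rcases ha with rfl | rfl <;> simp, _,
      by rcases hb with rfl | rfl <;> simp, rfl⟩
  · rintro a b c ha hb hc
    exact ⟨_, by rcases hb with rfl | rfl <;> simp, _, by rcases hc with rfl | rfl <;> simp, _,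
      by rcases ha with rfl | rfl <;> simp, rfl⟩

theorem icosi_int : (0 : EucSp 3) ∈ interior Icosidodecahedron := by
  have hpos : 0 < goldenφ := by linarith [gphi_lt.1]
  refine zero_int icosi_finite (T := Icosidodecahedron) rfl hpos ?_
  have k : ∀ x ∈ icosidodecaVerts, x ∈ Icosidodecahedron := fun x hx => subset_convexHull ℝ _ hx
  have s1 := pt3_single goldenφ
  have s2 := pt3_single (-goldenφ)
  have e1 : goldenφ = 1 * goldenφ := by ring
  have e2 : -goldenφ = (-1) * goldenφ := by ring
  intro i
  fin_cases i
  · exact ⟨k _ (by rw [Fin.zero_eta, s1.1, e1]; exact icosi_m2 (Or.inl rfl)),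
      k _ (by rw [Fin.zero_eta, s2.1, e2]; exact icosi_m2 (Or.inr rfl))⟩
  · exact ⟨k _ (by rw [Fin.mk_one, s1.2.1, e1]; exact icosi_m3 (Or.inl rfl)),
      k _ (by rw [Fin.mk_one, s2.2.1, e2]; exact icosi_m3 (Or.inr rfl))⟩
  · exact ⟨k _ (by change EuclideanSpace.single (2 : Fin 3) goldenφ ∈ _; rw [s1.2.2, e1]; exact icosi_m1 (Or.inl rfl)),
      k _ (by change EuclideanSpace.single (2 : Fin 3) (-goldenφ) ∈ _; rw [s2.2.2, e2]; exact icosi_m1 (Or.inr rfl))⟩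

theorem icosi_reflect (A : EucSp 3 → EucSp 3)
    (hA : ∀ x y z, A (pt3 x y z) = pt3 ((x - goldenφ * y + (goldenφ - 1) * z) / 2)
      ((-goldenφ * x + (1 - goldenφ) * y + z) / 2) (((goldenφ - 1) * x + y + goldenφ * z) / 2)) :
    ∀ s ∈ icosidodecaVerts, A s ∈ icosidodecaVerts := by
  have hφ := gphi_sq
  have mm : ∀ {a b c x y z : ℝ}, pt3 a b c ∈ icosidodecaVerts →
      (x - goldenφ * y + (goldenφ - 1) * z) / 2 = a → (-goldenφ * x + (1 - goldenφ) * y + z) / 2 = b →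
      ((goldenφ - 1) * x + y + goldenφ * z) / 2 = c → A (pt3 x y z) ∈ icosidodecaVerts := by
    intro a b c x y z h h1 h2 h3
    rw [hA, h1, h2, h3]; exact h
  apply icosi_cases
  all_goals first
    | rintro a b c (rfl | rfl) (rfl | rfl) (rfl | rfl)
    | rintro a (rfl | rfl)
  · exact mm (icosi_m4 (Or.inl rfl) (Or.inl rfl) (Or.inl rfl)) (by linarith) (by linarith) (by linarith)
  · exact mm (icosi_m4 (Or.inr rfl) (Or.inr rfl) (Or.inr rfl)) (by linarith) (by linarith) (by linarith)
  · exact mm (icosi_m6 (Or.inl rfl) (Or.inl rfl) (Or.inr rfl)) (by linarith) (by linarith) (by linarith)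
  · exact mm (icosi_m6 (Or.inr rfl) (Or.inr rfl) (Or.inl rfl)) (by linarith) (by linarith) (by linarith)
  · exact mm (icosi_m5 (Or.inr rfl) (Or.inl rfl) (Or.inr rfl)) (by linarith) (by linarith) (by linarith)
  · exact mm (icosi_m5 (Or.inl rfl) (Or.inr rfl) (Or.inl rfl)) (by linarith) (by linarith) (by linarith)
  · exact mm (icosi_m1 (Or.inl rfl)) (by linarith) (by linarith) (by linarith)
  · exact mm (icosi_m6 (Or.inr rfl) (Or.inr rfl) (Or.inr rfl)) (by linarith) (by linarith) (by linarith)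
  · exact mm (icosi_m5 (Or.inl rfl) (Or.inl rfl) (Or.inl rfl)) (by linarith) (by linarith) (by linarith)
  · exact mm (icosi_m4 (Or.inl rfl) (Or.inr rfl) (Or.inr rfl)) (by linarith) (by linarith) (by linarith)
  · exact mm (icosi_m4 (Or.inr rfl) (Or.inl rfl) (Or.inl rfl)) (by linarith) (by linarith) (by linarith)
  · exact mm (icosi_m5 (Or.inr rfl) (Or.inr rfl) (Or.inr rfl)) (by linarith) (by linarith) (by linarith)
  · exact mm (icosi_m6 (Or.inl rfl) (Or.inl rfl) (Or.inl rfl)) (by linarith) (by linarith) (by linarith)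
  · exact mm (icosi_m1 (Or.inr rfl)) (by linarith) (by linarith) (by linarith)
  · exact mm (icosi_m4 (Or.inl rfl) (Or.inr rfl) (Or.inl rfl)) (by linarith) (by linarith) (by linarith)
  · exact mm (icosi_m6 (Or.inl rfl) (Or.inr rfl) (Or.inl rfl)) (by linarith) (by linarith) (by linarith)
  · exact mm (icosi_m3 (Or.inr rfl)) (by linarith) (by linarith) (by linarith)
  · exact mm (icosi_m5 (Or.inl rfl) (Or.inr rfl) (Or.inr rfl)) (by linarith) (by linarith) (by linarith)
  · exact mm (icosi_m5 (Or.inr rfl) (Or.inl rfl) (Or.inl rfl)) (by linarith) (by linarith) (by linarith)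
  · exact mm (icosi_m3 (Or.inl rfl)) (by linarith) (by linarith) (by linarith)
  · exact mm (icosi_m6 (Or.inr rfl) (Or.inl rfl) (Or.inr rfl)) (by linarith) (by linarith) (by linarith)
  · exact mm (icosi_m4 (Or.inr rfl) (Or.inl rfl) (Or.inr rfl)) (by linarith) (by linarith) (by linarith)
  · exact mm (icosi_m4 (Or.inr rfl) (Or.inr rfl) (Or.inl rfl)) (by linarith) (by linarith) (by linarith)
  · exact mm (icosi_m2 (Or.inl rfl)) (by linarith) (by linarith) (by linarith)
  · exact mm (icosi_m5 (Or.inl rfl) (Or.inl rfl) (Or.inr rfl)) (by linarith) (by linarith) (by linarith)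
  · exact mm (icosi_m6 (Or.inr rfl) (Or.inl rfl) (Or.inl rfl)) (by linarith) (by linarith) (by linarith)
  · exact mm (icosi_m6 (Or.inl rfl) (Or.inr rfl) (Or.inr rfl)) (by linarith) (by linarith) (by linarith)
  · exact mm (icosi_m5 (Or.inr rfl) (Or.inr rfl) (Or.inl rfl)) (by linarith) (by linarith) (by linarith)
  · exact mm (icosi_m2 (Or.inr rfl)) (by linarith) (by linarith) (by linarith)
  · exact mm (icosi_m4 (Or.inl rfl) (Or.inl rfl) (Or.inr rfl)) (by linarith) (by linarith) (by linarith)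

theorem icosi_model {ρ : Faces Icosidodecahedron → ℕ} (H : PPoset (Faces Icosidodecahedron) ρ 4) :
    ∃ Φ Φ', Model Icosidodecahedron ρ H Φ Φ' 5 := by
  have hφ := gphi_sq
  obtain ⟨hl, hu⟩ := gphi_lt
  obtain ⟨A, hA, iA⟩ := exists_refl (1 / 2) (-goldenφ / 2) ((goldenφ - 1) / 2) ((1 - goldenφ) / 2) (1 / 2) (goldenφ / 2)
    (by linarith) (by linarith) (by linarith) (by linarith) (by linarith) (by linarith)
  obtain ⟨B, hB, iB⟩ := exists_refl (-1) 0 0 1 0 1 (by norm_num) (by norm_num) (by norm_num) (by norm_num) (by norm_num)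
    (by norm_num)
  obtain ⟨C, hC, iC⟩ := exists_refl 1 0 0 (-1) 0 1 (by norm_num) (by norm_num) (by norm_num) (by norm_num)
    (by norm_num) (by norm_num)
  have hA' : ∀ x y z, A (pt3 x y z) = pt3 ((x - goldenφ * y + (goldenφ - 1) * z) / 2)
      ((-goldenφ * x + (1 - goldenφ) * y + z) / 2) (((goldenφ - 1) * x + y + goldenφ * z) / 2) :=
    fun x y z => by rw [hA]; apply pt3_congr <;> ring
  have hB' : ∀ x y z, B (pt3 x y z) = pt3 (-x) y z := fun x y z => by rw [hB]; apply pt3_congr <;> ring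
  have hC' : ∀ x y z, C (pt3 x y z) = pt3 x (-y) z := fun x y z => by rw [hC]; apply pt3_congr <;> ring
  have neg : ∀ a : ℝ, (a = 1 ∨ a = -1) → (-a = 1 ∨ -a = -1) := by
    rintro a (rfl | rfl) <;> norm_num
  have ms : ∀ {a b c a' b' c' : ℝ}, pt3 a b c ∈ icosidodecaVerts → a' = a → b' = b → c' = c →
      pt3 a' b' c' ∈ icosidodecaVerts := by
    intro a b c a' b' c' h h1 h2 h3
    rw [h1, h2, h3]; exact h
  have rab : ∀ v, A (B (A (B v))) = B (A v) := by
    intro v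
    obtain ⟨x, y, z, rfl⟩ := pt3_surj v
    have hx : goldenφ * goldenφ * x = (goldenφ + 1) * x := by rw [hφ]
    have hy : goldenφ * goldenφ * y = (goldenφ + 1) * y := by rw [hφ]
    have hz : goldenφ * goldenφ * z = (goldenφ + 1) * z := by rw [hφ]
    rw [hB', hA', hB', hA', hA', hB']
    apply pt3_congr <;> linarith
  have rac2 : ∀ x y z, A (C (A (C (pt3 x y z)))) = pt3 (((1 - goldenφ) * x + y + goldenφ * z) / 2)
      ((-x - goldenφ * y + (goldenφ - 1) * z) / 2) ((goldenφ * x + (1 - goldenφ) * y + z) / 2) := by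
    intro x y z
    have hx : goldenφ * goldenφ * x = (goldenφ + 1) * x := by rw [hφ]
    have hy : goldenφ * goldenφ * y = (goldenφ + 1) * y := by rw [hφ]
    have hz : goldenφ * goldenφ * z = (goldenφ + 1) * z := by rw [hφ]
    rw [hC', hA', hC', hA']
    apply pt3_congr <;> linarith
  have rac4 : ∀ v, A (C (A (C (A (C (A (C v))))))) = C (A v) := by
    intro v
    obtain ⟨x, y, z, rfl⟩ := pt3_surj v
    have hx : goldenφ * goldenφ * x = (goldenφ + 1) * x := by rw [hφ]
    have hy : goldenφ * goldenφ * y = (goldenφ + 1) * y := by rw [hφ]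
    have hz : goldenφ * goldenφ * z = (goldenφ + 1) * z := by rw [hφ]
    rw [rac2, rac2, hA', hC']
    apply pt3_congr <;> linarith
  refine geo_model (S := icosidodecaVerts) rfl H A B C (icosi_reflect A hA') ?_ ?_ iA iB iC (Or.inr rfl) ?_ ?_ ?_
    (p0 := pt3 0 0 (1 * goldenφ)) (p1 := pt3 (1 / 2) (1 * goldenφ / 2) (1 * (goldenφ + 1) / 2))
    (p2 := pt3 ((-1) / 2) (1 * goldenφ / 2) (1 * (goldenφ + 1) / 2))
    (p3 := pt3 (1 / 2) ((-1) * goldenφ / 2) (1 * (goldenφ + 1) / 2))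
    (nF := pt3 0 1 (goldenφ + 1)) (nG := pt3 1 0 goldenφ)
    (N := goldenφ + 1) (MF := 2 * goldenφ + 1) (MG := goldenφ + 1) (icosi_m1 (Or.inl rfl))
    (icosi_m4 (Or.inl rfl) (Or.inl rfl) (Or.inl rfl))
    ?_ ?_ ?_ ?_ ?_ ?_ ?_ ?_ ?_ ?_ ?_ ?_ ?_ ?_ ?_ ?_ ?_ ?_ ?_
  · apply icosi_cases
    · intro a ha; rw [hB']; exact ms (icosi_m1 ha) (by ring) rfl rfl
    · intro a ha; rw [hB']; exact ms (icosi_m2 (neg a ha)) (by ring) rfl rfl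
    · intro a ha; rw [hB']; exact ms (icosi_m3 ha) (by ring) rfl rfl
    · intro a b c ha hb hc; rw [hB']; exact ms (icosi_m4 (neg a ha) hb hc) (by ring) rfl rfl
    · intro a b c ha hb hc; rw [hB']; exact ms (icosi_m5 ha hb (neg c hc)) (by ring) rfl rfl
    · intro a b c ha hb hc; rw [hB']; exact ms (icosi_m6 ha (neg b hb) hc) (by ring) rfl rfl
  · apply icosi_cases
    · intro a ha; rw [hC']; exact ms (icosi_m1 ha) rfl (by ring) rfl
    · intro a ha; rw [hC']; exact ms (icosi_m2 ha) rfl (by ring) rfl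
    · intro a ha; rw [hC']; exact ms (icosi_m3 (neg a ha)) rfl (by ring) rfl
    · intro a b c ha hb hc; rw [hC']; exact ms (icosi_m4 ha (neg b hb) hc) rfl (by ring) rfl
    · intro a b c ha hb hc; rw [hC']; exact ms (icosi_m5 (neg a ha) hb hc) rfl (by ring) rfl
    · intro a b c ha hb hc; rw [hC']; exact ms (icosi_m6 ha hb (neg c hc)) rfl (by ring) rfl
  · intro v
    show A (B (A (B (A (B v))))) = v
    rw [rab, iA, iB]
  · intro v
    show A (C (A (C (A (C (A (C (A (C v))))))))) = v
    rw [rac4, iA, iC]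
  · intro v
    obtain ⟨x, y, z, rfl⟩ := pt3_surj v
    simp only [Function.iterate_succ, Function.iterate_zero, Function.comp_apply, id, hB', hC', neg_neg]
  · apply icosi_cases
    all_goals first
      | (rintro a b c (rfl | rfl) (rfl | rfl) (rfl | rfl) <;> rw [pt3_inner] <;> linarith)
      | (rintro a (rfl | rfl) <;> rw [pt3_inner] <;> linarith)
  · apply icosi_cases
    all_goals first
      | (rintro a b c (rfl | rfl) (rfl | rfl) (rfl | rfl) <;> rw [pt3_inner] <;> linarith)
      | (rintro a (rfl | rfl) <;> rw [pt3_inner] <;> linarith)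
  · apply icosi_cases
    all_goals first
      | (rintro a b c (rfl | rfl) (rfl | rfl) (rfl | rfl) <;> rw [pt3_inner] <;> linarith)
      | (rintro a (rfl | rfl) <;> rw [pt3_inner] <;> linarith)
  · intro h
    have := congrArg (fun v : EucSp 3 => v 0) h
    simp only [pt3_zero] at this
    norm_num at this
  all_goals first
    | (rw [pt3_inner]; linarith)
    | (rw [pt3_inner]; intro h; linarith)
    | (rw [hA']; apply pt3_congr <;> linarith)
    | (rw [hB']; apply pt3_congr <;> ring)
    | (rw [hC']; apply pt3_congr <;> ring)

/-- the four models -/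
theorem models : (∃ ρ, ∃ H : PPoset (Faces Cuboctahedron) ρ 4, ∃ Φ Φ', Model Cuboctahedron ρ H Φ Φ' 4) ∧
    (∃ ρ, ∃ H : PPoset (Faces Icosidodecahedron) ρ 4, ∃ Φ Φ', Model Icosidodecahedron ρ H Φ Φ' 5) ∧
    IsConvexPolytope Cuboctahedron ∧ IsConvexPolytope Icosidodecahedron ∧
    (IsConvexPolytope RhombicDodecahedron ∧ GeomTwoOrbit RhombicDodecahedron ∧
      Nonempty ((Faces Cuboctahedron)ᵒᵈ ≃o Faces RhombicDodecahedron)) ∧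
    (IsConvexPolytope RhombicTriacontahedron ∧ GeomTwoOrbit RhombicTriacontahedron ∧
      Nonempty ((Faces Icosidodecahedron)ᵒᵈ ≃o Faces RhombicTriacontahedron)) := by
  have pC : IsConvexPolytope Cuboctahedron := poly_of_verts cubo_finite cubo_int
  have pI : IsConvexPolytope Icosidodecahedron := poly_of_verts icosi_finite icosi_int
  obtain ⟨ρ, H⟩ := exists_pp Cuboctahedron pC
  obtain ⟨ρ', H'⟩ := exists_pp Icosidodecahedron pI
  obtain ⟨Φ, Φ', M⟩ := cubo_model H
  obtain ⟨Ψ, Ψ', M'⟩ := icosi_model H'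
  obtain ⟨D, hD⟩ := polr_dp cubo_finite (T := Cuboctahedron) rfl cubo_int (r := 2) (by norm_num)
  obtain ⟨D', hD'⟩ := polr_dp icosi_finite (T := Icosidodecahedron) rfl icosi_int (r := 1) (by norm_num)
  obtain ⟨ρ₁, H₁⟩ := exists_pp _ hD
  obtain ⟨ρ₂, H₂⟩ := exists_pp _ hD'
  refine ⟨⟨ρ, H, Φ, Φ', M⟩, ⟨ρ', H', Ψ, Ψ', M'⟩, pC, pI, ?_, ?_⟩
  · rw [rd_eq]
    exact ⟨hD, M.dual_geom H₁ D (fun g hg => polr_inv g hg), ⟨D.iso⟩⟩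
  · exact ⟨hD', M'.dual_geom H₂ D' (fun g hg => polr_inv g hg), ⟨D'.iso⟩⟩

open scoped Classical RealInnerProductSpace

theorem PPoset.asm_main {L L' : Type} [PartialOrder L] [PartialOrder L'] {ρ : L → ℕ} {ρ' : L' → ℕ}
    (H : PPoset L ρ 4) (H' : PPoset L' ρ' 4) {q : ℕ}
    (h : RType H.adj q ∨ RType (fun i => H.adj (4 - i)) q)
    (h' : RType (fun i => H'.adj (4 - i)) q) : Nonempty (L ≃o L') ∨ Nonempty (L ≃o L'ᵒᵈ) := by
  obtain ⟨x0⟩ := H.exists_flag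
  obtain ⟨x0'⟩ := H'.exists_flag
  rcases h with h | h
  · obtain ⟨f, hb, hf⟩ := RType.exists_equiv H.fs H'.fs.rev h h' x0 x0'
    exact Or.inr (H.iso_dual H' f hb hf)
  · obtain ⟨f, hb, hf⟩ := RType.exists_equiv H.fs.rev H'.fs.rev h h' x0 x0'
    refine Or.inl ?_
    obtain ⟨φ, -⟩ := H.iso_straight H' f hb (fun i h1 h2 x => by
      have := hf (4 - i) (by omega) (by omega) x
      have e : 4 - (4 - i) = i := by omega
      simpa only [e] using this)
    exact ⟨φ⟩

/-- Any combinatorially two-orbit convex `d`-polytope (`d ≥ 1`) satisfies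
`d = 3`, and its face lattice is order-isomorphic to the face lattice of the cuboctahedron,
the icosidodecahedron, the rhombic dodecahedron, or the rhombic triacontahedron.
In particular, it is isomorphic to a convex polytope whose symmetry group has exactly two
orbits on flags. -/
theorem combinatorially_two_orbit_polytope {d : ℕ} (hd : 1 ≤ d)
    (P : Set (EucSp d)) (hP : IsConvexPolytope P)
    (h2 : TwoFlagOrbits (Faces P)) :
    d = 3 ∧
    (Nonempty (Faces P ≃o Faces Cuboctahedron) ∨
     Nonempty (Faces P ≃o Faces Icosidodecahedron) ∨
     Nonempty (Faces P ≃o Faces RhombicDodecahedron) ∨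
     Nonempty (Faces P ≃o Faces RhombicTriacontahedron)) ∧
    ∃ Q : Set (EucSp 3), IsConvexPolytope Q ∧ Nonempty (Faces P ≃o Faces Q) ∧
      GeomTwoOrbit Q := by
  obtain ⟨ρ, H⟩ := exists_pp P hP
  obtain ⟨hn, q, hq, hT⟩ := H.classify h2
  obtain rfl : d = 3 := by omega
  obtain ⟨⟨ρ1, H1, Φ1, Φ1', M1⟩, ⟨ρ2, H2, Φ2, Φ2', M2⟩, p1, p2, ⟨p3, g3, ⟨e3⟩⟩, ⟨p4, g4, ⟨e4⟩⟩⟩ := models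
  refine ⟨rfl, ?_⟩
  rcases hq with rfl | rfl
  · rcases PPoset.asm_main H H1 hT M1.typ with ⟨⟨φ⟩⟩ | ⟨⟨φ⟩⟩
    · exact ⟨Or.inl ⟨φ⟩, _, p1, ⟨φ⟩, M1.geom⟩
    · exact ⟨Or.inr (Or.inr (Or.inl ⟨φ.trans e3⟩)), _, p3, ⟨φ.trans e3⟩, g3⟩
  · rcases PPoset.asm_main H H2 hT M2.typ with ⟨⟨φ⟩⟩ | ⟨⟨φ⟩⟩
    · exact ⟨Or.inr (Or.inl ⟨φ⟩), _, p2, ⟨φ⟩, M2.geom⟩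
    · exact ⟨Or.inr (Or.inr (Or.inr ⟨φ.trans e4⟩)), _, p4, ⟨φ.trans e4⟩, g4⟩
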